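/- For β sufficiently large there exist constants c>0 and ε∈(0,1) such that, on the n×n grid [n]² with A the set of boundary vertices (|A| ≤ 4n) pinned to −1, the A-corrupted Glauber dynamics has mixing time at most exp(c·n^ε). Consequently, starting from the all +1 configuration, the 4n-corrupted dynamics converges to the −1 phase in sub-exponential time. -/

import Mathlib

open Real Finset
open scoped Classical

noncomputable section

/-- The `n × n` grid graph on `[n]² = Fin n × Fin n`. -/
def grid (n : ℕ) : SimpleGraph (Fin n × Fin n) :=
  SimpleGraph.fromRel (fun p q =>
    (p.1 = q.1 ∧ p.2.val + 1 = q.2.val) ∨ (p.2 = q.2 ∧ p.1.val + 1 = q.1.val))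

variable {V : Type*} [Fintype V] [DecidableEq V]

/-- The real value of a spin: `true ↦ +1`, `false ↦ -1`. -/
def spinVal (b : Bool) : ℝ := if b then 1 else -1

/-- Sum of the spins of the neighbors of `v`. -/
def nbrSum (G : SimpleGraph V) (σ : V → Bool) (v : V) : ℝ :=
  ∑ u : V, if G.Adj v u then spinVal (σ u) else 0

/-- Glauber probability of updating `v` to `+1`. -/
def glauberP (β : ℝ) (G : SimpleGraph V) (σ : V → Bool) (v : V) : ℝ :=
  exp (β * nbrSum G σ v) / (exp (β * nbrSum G σ v) + exp (-(β * nbrSum G σ v)))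

/-- One-step kernel of the `A`-corrupted Glauber dynamics with `A` pinned to spin `s`. -/
def pinnedK (G : SimpleGraph V) (β : ℝ) (A : Finset V) (s : Bool)
    (σ σ' : V → Bool) : ℝ :=
  (Fintype.card V : ℝ)⁻¹ * ∑ v : V,
    if v ∈ A then (if σ' = Function.update σ v s then 1 else 0)
    else (if σ' = Function.update σ v true then glauberP β G σ v else 0)
       + (if σ' = Function.update σ v false then 1 - glauberP β G σ v else 0)

/-- Evolution of a distribution under `t` steps of a Markov kernel. -/
def evolve (K : (V → Bool) → (V → Bool) → ℝ) : ℕ → ((V → Bool) → ℝ) → ((V → Bool) → ℝ)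
  | 0, ν => ν
  | t+1, ν => fun σ' => ∑ σ : V → Bool, evolve K t ν σ * K σ σ'

/-- Point mass at `σ₀`. -/
def delta (σ₀ : V → Bool) : (V → Bool) → ℝ := fun σ => if σ = σ₀ then 1 else 0

/-- Total variation distance between two distributions on configurations. -/
def tvDist (ν₁ ν₂ : (V → Bool) → ℝ) : ℝ := (1/2) * ∑ σ : V → Bool, |ν₁ σ - ν₂ σ|

/-- Ising Hamiltonian `H(σ) = ∑_{uv ∈ E} σ(u)σ(v)`. -/
def ham (G : SimpleGraph V) (σ : V → Bool) : ℝ :=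
  ∑ e ∈ G.edgeFinset,
    Sym2.lift ⟨fun u v => spinVal (σ u) * spinVal (σ v), fun u v => mul_comm _ _⟩ e

/-- Partition function of the Ising model restricted to configurations that are `s` on `A`. -/
def condZ (G : SimpleGraph V) (β : ℝ) (A : Finset V) (s : Bool) : ℝ :=
  ∑ σ : V → Bool, if (∀ v ∈ A, σ v = s) then exp (β * ham G σ) else 0

/-- Ising measure conditioned on being `s` on `A`; the stationary distribution of the
`A`-corrupted (pinned) Glauber dynamics. -/
def condIsing (G : SimpleGraph V) (β : ℝ) (A : Finset V) (s : Bool) (σ : V → Bool) : ℝ :=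
  if (∀ v ∈ A, σ v = s) then exp (β * ham G σ) / condZ G β A s else 0

/-- (1/4)-mixing time of the kernel `K` with stationary distribution `pi`. -/
def mixingTime (K : (V → Bool) → (V → Bool) → ℝ) (pi : (V → Bool) → ℝ) : ℕ :=
  sInf {t : ℕ | ∀ σ₀ : V → Bool, tvDist (evolve K t (delta σ₀)) pi ≤ 1/4}


/-- The boundary vertices of the `n × n` grid. -/
def gridBoundary (n : ℕ) : Finset (Fin n × Fin n) :=
  univ.filter (fun p => p.1.val = 0 ∨ p.1.val = n - 1 ∨ p.2.val = 0 ∨ p.2.val = n - 1)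

set_option linter.all false
notation "oO" => (by omega)
notation "pP" => (by positivity)
notation "nN" => (by norm_num)
notation "lL" => (by linarith)
notation "mll" => mul_le_mul_of_nonneg_left
notation "mlr" => mul_le_mul_of_nonneg_right
notation:max "Fn" U:max => (U → Bool) → ℝ
notation:max "Ed" U:max => Finset (U × U)

lemma spinVal_sq (b : Bool) : spinVal b * spinVal b = 1 := by
  cases b <;> simp [spinVal]

lemma spinVal_cases (b : Bool) : spinVal b = 1 ∨ spinVal b = -1 := by
  cases b <;> simp [spinVal]

inductive Cone {U X ι : Type*} [Fintype U] [Fintype ι] (φ : ι → X → ℝ) : ((U → X) → ℝ) → Prop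
  | base (c : ℝ) (hc : 0 ≤ c) (k : U → ι → ℕ) :
      Cone φ (fun σ => c * ∏ u, ∏ i, φ i (σ u) ^ k u i)
  | add (f g : (U → X) → ℝ) : Cone φ f → Cone φ g → Cone φ (fun σ => f σ + g σ)

section cone
variable {U X ι : Type*} [Fintype U] [DecidableEq U] [Fintype ι] {φ : ι → X → ℝ}

lemma Cone.const (c : ℝ) (hc : 0 ≤ c) : Cone (U := U) φ (fun _ => c) := by
  have := Cone.base (U := U) (φ := φ) c hc (fun _ _ => 0)
  simpa using this

lemma Cone.site (u : U) (i : ι) : Cone (U := U) φ (fun σ => φ i (σ u)) := by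
  have := Cone.base (U := U) (φ := φ) 1 zero_le_one (fun v j => if v = u then (if j = i then 1 else 0) else 0)
  convert this using 2 with σ
  rw [Finset.prod_eq_single u]
  · rw [Finset.prod_eq_single i] <;> simp +contextual
  · intro b _ hb; simp [hb]
  · simp

lemma Cone.mul {f g : (U → X) → ℝ} (hf : Cone φ f) (hg : Cone φ g) :
    Cone φ (fun σ => f σ * g σ) := by
  induction hf with
  | base c hc k =>
    induction hg with
    | base c' hc' k' =>
      have := Cone.base (U := U) (φ := φ) (c * c') (mul_nonneg hc hc') (fun u i => k u i + k' u i)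
      convert this using 2 with σ
      simp only [pow_add, Finset.prod_mul_distrib]; ring
    | add f g _ _ h1 h2 =>
      have := Cone.add _ _ h1 h2
      convert this using 2 with σ; ring
  | add f g _ _ h1 h2 =>
      have := Cone.add _ _ h1 h2
      convert this using 2 with σ; ring

lemma Cone.prod {κ : Type*} (s : Finset κ) (f : κ → (U → X) → ℝ) (h : ∀ k ∈ s, Cone φ (f k)) :
    Cone φ (fun σ => ∏ k ∈ s, f k σ) := by
  induction s using Finset.induction_on with
  | empty => simpa using Cone.const (U := U) (φ := φ) 1 zero_le_one
  | insert a s ha ih =>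
    have := Cone.mul (h a (by simp)) (ih (fun k hk => h k (by simp [hk])))
    simpa [Finset.prod_insert ha] using this

lemma Cone.sum {κ : Type*} (s : Finset κ) (f : κ → (U → X) → ℝ) (h : ∀ k ∈ s, Cone φ (f k)) :
    Cone φ (fun σ => ∑ k ∈ s, f k σ) := by
  induction s using Finset.induction_on with
  | empty => simpa using Cone.const (U := U) (φ := φ) 0 le_rfl
  | insert a s ha ih =>
    have := Cone.add _ _ (h a (by simp)) (ih (fun k hk => h k (by simp [hk])))
    simpa [Finset.sum_insert ha] using this

lemma Cone.pow {f : (U → X) → ℝ} (hf : Cone φ f) (n : ℕ) : Cone φ (fun σ => f σ ^ n) := by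
  have := Cone.prod (Finset.range n) (fun _ => f) (fun _ _ => hf)
  simpa using this

lemma Cone.nonneg [Fintype X] (ρ : U → X → ℝ)
    (hρ : ∀ u (k : ι → ℕ), 0 ≤ ∑ x, ρ u x * ∏ i, φ i x ^ k i)
    {f : (U → X) → ℝ} (hf : Cone φ f) : 0 ≤ ∑ σ : U → X, (∏ u, ρ u (σ u)) * f σ := by
  induction hf with
  | base c hc k =>
    have : ∑ σ : U → X, (∏ u, ρ u (σ u)) * (c * ∏ u, ∏ i, φ i (σ u) ^ k u i)
        = c * ∏ u, ∑ x, ρ u x * ∏ i, φ i x ^ k u i := by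
      rw [Finset.prod_univ_sum, Finset.mul_sum, Fintype.piFinset_univ]
      refine Finset.sum_congr rfl fun σ _ => ?_
      rw [Finset.prod_mul_distrib]; ring
    rw [this]
    exact mul_nonneg hc (Finset.prod_nonneg fun u _ => hρ u _)
  | add f g _ _ h1 h2 =>
    simp only [mul_add, Finset.sum_add_distrib]; linarith
end cone

section corr
variable {U : Type*} [Fintype U] [DecidableEq U]

def bw (t : ℝ) (E : Ed U) (σ : U → Bool) : ℝ :=
  ∏ e ∈ E, (1 + t * (spinVal (σ e.1) * spinVal (σ e.2)))

def bS (t : ℝ) (E : Ed U) (F : Fn U) : ℝ := ∑ σ, bw t E σ * F σ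

def cG (t : ℝ) (E : Ed U) (u v : U) : ℝ :=
  bS t E (fun σ => spinVal (σ u) * spinVal (σ v)) / bS t E (fun _ => 1)

lemma bond_pos {t : ℝ} (ht : 0 ≤ t) (ht1 : t ≤ 1/2) (a b : Bool) :
    0 < 1 + t * (spinVal a * spinVal b) := by
  cases a <;> cases b <;> simp [spinVal] <;> linarith

lemma bw_pos {t : ℝ} (ht : 0 ≤ t) (ht1 : t ≤ 1/2) (E : Ed U) (σ : U → Bool) :
    0 < bw t E σ := Finset.prod_pos fun _ _ => bond_pos ht ht1 _ _

lemma bS_one_pos {t : ℝ} (ht : 0 ≤ t) (ht1 : t ≤ 1/2) (E : Ed U) :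
    0 < bS t E (fun _ => 1) := by
  unfold bS
  exact Finset.sum_pos (fun σ _ => by simpa using bw_pos ht ht1 E σ) ⟨fun _ => true, by simp⟩

lemma bS_add (t : ℝ) (E : Ed U) (F H : Fn U) :
    bS t E (fun σ => F σ + H σ) = bS t E F + bS t E H := by
  simp [bS, mul_add, Finset.sum_add_distrib]

lemma bS_smul (t : ℝ) (E : Ed U) (c : ℝ) (F : Fn U) :
    bS t E (fun σ => c * F σ) = c * bS t E F := by
  simp only [bS, Finset.mul_sum]
  exact Finset.sum_congr rfl fun σ _ => by ring

lemma bS_insert (t : ℝ) (E : Ed U) (e : U × U) (he : e ∉ E) (F : Fn U) :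
    bS t (insert e E) F = bS t E F + t * bS t E (fun σ => F σ * (spinVal (σ e.1) * spinVal (σ e.2))) := by
  rw [← bS_smul, ← bS_add]
  unfold bS bw
  refine Finset.sum_congr rfl fun σ _ => ?_
  rw [Finset.prod_insert he]; ring

lemma gks1 {t : ℝ} (ht : 0 ≤ t) (E : Ed U) (l : List U) :
    0 ≤ bS t E (fun σ => (l.map (fun u => spinVal (σ u))).prod) := by
  have hl : Cone (U := U) (fun (_ : Unit) => spinVal) (fun σ => (l.map (fun u => spinVal (σ u))).prod) := by
    induction l with
    | nil => simpa using Cone.const (U := U) 1 zero_le_one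
    | cons a l ih => simpa using Cone.mul (Cone.site (φ := fun (_ : Unit) => spinVal) a ()) ih
  have hw : Cone (U := U) (fun (_ : Unit) => spinVal) (bw t E) := by
    refine Cone.prod _ _ fun e _ => ?_
    refine Cone.add _ _ (Cone.const 1 zero_le_one) (Cone.mul (Cone.const t ht) (Cone.mul ?_ ?_))
    · exact Cone.site (φ := fun (_ : Unit) => spinVal) e.1 ()
    · exact Cone.site (φ := fun (_ : Unit) => spinVal) e.2 ()
  have := Cone.nonneg (fun _ _ => 1) ?_ (Cone.mul hw hl)
  · simpa [bS] using this
  · intro u k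
    simp [spinVal]
    rcases Nat.even_or_odd (k ()) with h | h <;> simp [h.neg_one_pow]
end corr

section corr2
variable {U : Type*} [Fintype U] [DecidableEq U]

def sprod (l : List U) (σ : U → Bool) : ℝ := (l.map (fun u => spinVal (σ u))).prod

def phi2 (i : Bool) (x : Bool × Bool) : ℝ :=
  if i then spinVal x.1 + spinVal x.2 else spinVal x.1 - spinVal x.2

lemma gks2 {t : ℝ} (ht : 0 ≤ t) (ht1 : t ≤ 1/2) (E : Ed U) (l l' : List U) :
    bS t E (sprod l) * bS t E (sprod l') ≤ bS t E (fun σ => sprod l σ * sprod l' σ) * bS t E (fun _ => 1) := by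
  have s1 : ∀ u, Cone (U := U) phi2 (fun σ => spinVal (σ u).1 + spinVal (σ u).2) := fun u => by
    simpa [phi2] using Cone.site (φ := phi2) u true
  have s2 : ∀ u, Cone (U := U) phi2 (fun σ => spinVal (σ u).1 - spinVal (σ u).2) := fun u => by
    simpa [phi2] using Cone.site (φ := phi2) u false
  have hh : (0:ℝ) ≤ 1/2 := by norm_num
  have key : ∀ l : List U,
      Cone (U := U) phi2 (fun σ => sprod l (fun u => (σ u).1) + sprod l (fun u => (σ u).2)) ∧
      Cone (U := U) phi2 (fun σ => sprod l (fun u => (σ u).1) - sprod l (fun u => (σ u).2)) := by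
    intro l
    induction l with
    | nil =>
      constructor
      · simpa [sprod] using Cone.const (U := U) (φ := phi2) (1+1) nN
      · simpa [sprod] using Cone.const (U := U) (φ := phi2) 0 le_rfl
    | cons a l ih =>
      constructor
      · have := Cone.mul (Cone.const (U := U) (φ := phi2) (1/2) hh)
          (Cone.add _ _ (Cone.mul (s1 a) ih.1) (Cone.mul (s2 a) ih.2))
        convert this using 2 with σ
        simp only [sprod, List.map_cons, List.prod_cons]; ring
      · have := Cone.mul (Cone.const (U := U) (φ := phi2) (1/2) hh)
          (Cone.add _ _ (Cone.mul (s1 a) ih.2) (Cone.mul (s2 a) ih.1))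
        convert this using 2 with σ
        simp only [sprod, List.map_cons, List.prod_cons]; ring
  have hF : Cone (U := U) phi2 (fun σ => sprod l (fun u => (σ u).1)) := by
    have := Cone.mul (Cone.const (U := U) (φ := phi2) (1/2) hh) (Cone.add _ _ (key l).1 (key l).2)
    convert this using 2 with σ; ring
  have hw : Cone (U := U) phi2 (fun σ => bw t E (fun u => (σ u).1) * bw t E (fun u => (σ u).2)) := by
    have : ∀ e ∈ E, Cone (U := U) phi2 (fun σ => (1 + t * (spinVal (σ e.1).1 * spinVal (σ e.2).1)) *
        (1 + t * (spinVal (σ e.1).2 * spinVal (σ e.2).2))) := by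
      intro e _
      have hY := Cone.mul (Cone.const (U := U) (φ := phi2) (1/2) hh)
        (Cone.add _ _ (Cone.mul (s1 e.1) (s1 e.2)) (Cone.mul (s2 e.1) (s2 e.2)))
      have := Cone.add _ _ (Cone.const (U := U) (φ := phi2) (1 - t^2) (by nlinarith))
        (Cone.add _ _ (Cone.mul (Cone.const (U := U) (φ := phi2) t ht) hY)
          (Cone.mul (Cone.const (U := U) (φ := phi2) (t^2/2) pP) (Cone.pow hY 2)))
      convert this using 2 with σ
      rcases spinVal_cases (σ e.1).1 with h1 | h1 <;> rcases spinVal_cases (σ e.1).2 with h2 | h2 <;>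
      rcases spinVal_cases (σ e.2).1 with h3 | h3 <;> rcases spinVal_cases (σ e.2).2 with h4 | h4 <;>
      rw [h1, h2, h3, h4] <;> ring
    have := Cone.prod _ _ this
    convert this using 2 with σ
    simp only [bw, Finset.prod_mul_distrib]
  have := Cone.nonneg (fun _ _ => 1) ?_ (Cone.mul hw (Cone.mul hF (key l').2))
  · simp only [Finset.prod_const_one, one_mul] at this
    rw [← (Equiv.arrowProdEquivProdArrow U (fun _ => Bool) (fun _ => Bool)).symm.sum_comp,
      Fintype.sum_prod_type] at this
    simp only [Equiv.arrowProdEquivProdArrow, Equiv.coe_fn_symm_mk] at this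
    have h2 : bS t E (fun σ => sprod l σ * sprod l' σ) * bS t E (fun _ => 1) - bS t E (sprod l) * bS t E (sprod l')
      = ∑ x : U → Bool, ∑ y : U → Bool, bw t E x * bw t E y * (sprod l x * (sprod l' x - sprod l' y)) := by
      simp only [bS, Finset.sum_mul_sum, ← Finset.sum_sub_distrib]
      refine Finset.sum_congr rfl fun x _ => Finset.sum_congr rfl fun y _ => by ring
    linarith
  · intro u k
    simp [phi2, spinVal, Fintype.sum_prod_type]
    norm_num
    rcases Nat.even_or_odd (k true) with h | h <;> rcases Nat.even_or_odd (k false) with h' | h' <;>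
      simp only [h.neg_pow, h'.neg_pow] <;> 
      nlinarith [pow_nonneg (zero_le_two (α := ℝ)) (k true), pow_nonneg (zero_le_two (α := ℝ)) (k false), pow_nonneg (le_refl (0:ℝ)) (k true), pow_nonneg (le_refl (0:ℝ)) (k false), mul_nonneg (pow_nonneg (zero_le_two (α := ℝ)) (k true)) (pow_nonneg (le_refl (0:ℝ)) (k false)), mul_nonneg (pow_nonneg (zero_le_two (α := ℝ)) (k false)) (pow_nonneg (le_refl (0:ℝ)) (k true))]
end corr2

section corr3
variable {U : Type*} [Fintype U] [DecidableEq U]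

abbrev X4 := (Bool × Bool) × (Bool × Bool)

def phi4 (i : Fin 4) (x : X4) : ℝ :=
  ![(spinVal x.1.1 + spinVal x.1.2 + spinVal x.2.1 + spinVal x.2.2) / 2,
    (spinVal x.1.1 + spinVal x.1.2 - spinVal x.2.1 - spinVal x.2.2) / 2,
    (spinVal x.1.1 - spinVal x.1.2 + spinVal x.2.1 - spinVal x.2.2) / 2,
    (-spinVal x.1.1 + spinVal x.1.2 + spinVal x.2.1 - spinVal x.2.2) / 2] i

lemma phi4_moment (k : Fin 4 → ℕ) : 0 ≤ ∑ x, ∏ i, phi4 i x ^ k i := by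
  simp [phi4, spinVal, Fintype.sum_prod_type, Fin.prod_univ_four]
  norm_num
  rcases Nat.even_or_odd (k 0) with h | h <;> rcases Nat.even_or_odd (k 1) with h' | h' <;>
  rcases Nat.even_or_odd (k 2) with h1 | h1 <;> rcases Nat.even_or_odd (k 3) with h2 | h2 <;>
    simp only [h.neg_pow, h'.neg_pow, h1.neg_pow, h2.neg_pow, one_pow] <;> 
    ring_nf <;> positivity

def pbS (x : U) (t : ℝ) (E : Ed U) (F : Fn U) : ℝ :=
  bS t E (fun σ => (if σ x then 1 else 0) * F σ)

lemma ghs_cone {t : ℝ} (ht : 0 ≤ t) (ht1 : t ≤ 1/2) (E : Ed U) (x a b y : U) :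
    0 ≤ ∑ σ : U → X4, (if σ x = ((true, true), (true, true)) then 1 else 0) *
      (bw t E (fun u => (σ u).1.1) * bw t E (fun u => (σ u).1.2) * bw t E (fun u => (σ u).2.1) * bw t E (fun u => (σ u).2.2)
      * (phi4 1 (σ a) * phi4 2 (σ b) * phi4 3 (σ y))) := by
  have st : ∀ u i, Cone (U := U) phi4 (fun σ => phi4 i (σ u)) := fun u i => Cone.site (φ := phi4) u i
  have hw : Cone (U := U) phi4 (fun σ => bw t E (fun u => (σ u).1.1) * bw t E (fun u => (σ u).1.2) * bw t E (fun u => (σ u).2.1) * bw t E (fun u => (σ u).2.2)) := by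
    have : ∀ e ∈ E, Cone (U := U) phi4 (fun σ => (1 + t * (spinVal (σ e.1).1.1 * spinVal (σ e.2).1.1)) *
        (1 + t * (spinVal (σ e.1).1.2 * spinVal (σ e.2).1.2)) * (1 + t * (spinVal (σ e.1).2.1 * spinVal (σ e.2).2.1)) *
        (1 + t * (spinVal (σ e.1).2.2 * spinVal (σ e.2).2.2))) := by
      intro e _
      have hY := Cone.sum Finset.univ _ (fun i (_ : i ∈ (Finset.univ : Finset (Fin 4))) => Cone.mul (st e.1 i) (st e.2 i))
      have cc : ∀ c : ℝ, 0 ≤ c → Cone (U := U) phi4 (fun _ => c) := fun c hc => Cone.const c hc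
      have t2 : t ^ 2 ≤ 1 / 4 := by nlinarith
      have := Cone.add _ _ (cc ((1 - t^2)^2) pP)
        (Cone.add _ _ (Cone.mul (cc (t - 10/6*t^3) (by nlinarith)) hY)
         (Cone.add _ _ (Cone.mul (cc (t^2/2 - 16/24*t^4) (by nlinarith [sq_nonneg t])) (Cone.pow hY 2))
          (Cone.add _ _ (Cone.mul (cc (t^3/6) pP) (Cone.pow hY 3))
           (Cone.mul (cc (t^4/24) pP) (Cone.pow hY 4)))))
      have hz : ∀ σ : U → X4, ∑ i, phi4 i (σ e.1) * phi4 i (σ e.2) = spinVal (σ e.1).1.1 * spinVal (σ e.2).1.1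
        + spinVal (σ e.1).1.2 * spinVal (σ e.2).1.2 + spinVal (σ e.1).2.1 * spinVal (σ e.2).2.1
        + spinVal (σ e.1).2.2 * spinVal (σ e.2).2.2 := by
        intro σ
        simp [Fin.sum_univ_four, phi4]; ring
      simp only [hz] at this
      convert this using 2 with σ
      have hs : ∀ b c : Bool, spinVal b * spinVal c = 1 ∨ spinVal b * spinVal c = -1 := by
        intro b c; cases b <;> cases c <;> simp [spinVal]
      rcases hs (σ e.1).1.1 (σ e.2).1.1 with h1 | h1 <;> rcases hs (σ e.1).1.2 (σ e.2).1.2 with h2 | h2 <;>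
      rcases hs (σ e.1).2.1 (σ e.2).2.1 with h3 | h3 <;> rcases hs (σ e.1).2.2 (σ e.2).2.2 with h4 | h4 <;>
      rw [h1, h2, h3, h4] <;> ring
    have := Cone.prod _ _ this
    convert this using 2 with σ
    simp only [bw, Finset.prod_mul_distrib]
  have hc := Cone.mul hw (Cone.mul (Cone.mul (st a 1) (st b 2)) (st y 3))
  have := Cone.nonneg (fun u z => if u = x then (if z = ((true, true), (true, true)) then 1 else 0) else 1) ?_ hc
  · convert this using 3 with σ
    rw [Finset.prod_eq_single x] <;> simp +contextual
  · intro u k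
    by_cases h : u = x
    · simp only [h, if_true]
      simp [phi4, spinVal, Fin.prod_univ_four]
      norm_num
      positivity
    · simpa [h] using phi4_moment k
end corr3

section corr4
variable {U : Type*} [Fintype U] [DecidableEq U]

lemma ghs_step {Y : Type*} [Fintype Y] (w a b y : Y → ℝ) (Z P Q G C Py Qy f : ℝ)
    (hZ : ∑ σ, w σ = Z) (hP : ∑ σ, w σ * a σ = P) (hQ : ∑ σ, w σ * b σ = Q)
    (hG : ∑ σ, w σ * y σ = G) (hC : ∑ σ, w σ * (a σ * b σ) = C) (hPy : ∑ σ, w σ * (a σ * y σ) = Py)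
    (hQy : ∑ σ, w σ * (b σ * y σ) = Qy) (hf : ∑ σ, w σ * (a σ * b σ * y σ) = f)
    (q0 q1 q2 q3 q4 q5 q6 q7 e1 e2 e3 A B D : ℝ) :
    ∑ σ, w σ * (q0 + q1 * (A + e1 * a σ) + q2 * (B + e2 * b σ) + q3 * (D + e3 * y σ)
      + q4 * ((A + e1 * a σ) * (B + e2 * b σ)) + q5 * ((A + e1 * a σ) * (D + e3 * y σ))
      + q6 * ((B + e2 * b σ) * (D + e3 * y σ)) + q7 * ((A + e1 * a σ) * (B + e2 * b σ) * (D + e3 * y σ)))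
    = (q0 * Z + q1 * e1 * P + q2 * e2 * Q + q3 * e3 * G + q4 * e1 * e2 * C + q5 * e1 * e3 * Py + q6 * e2 * e3 * Qy
        + q7 * e1 * e2 * e3 * f)
      + (q1 * Z + q4 * e2 * Q + q5 * e3 * G + q7 * e2 * e3 * Qy) * A
      + (q2 * Z + q4 * e1 * P + q6 * e3 * G + q7 * e1 * e3 * Py) * B
      + (q3 * Z + q5 * e1 * P + q6 * e2 * Q + q7 * e1 * e2 * C) * D
      + (q4 * Z + q7 * e3 * G) * (A * B) + (q5 * Z + q7 * e2 * Q) * (A * D) + (q6 * Z + q7 * e1 * P) * (B * D)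
      + (q7 * Z) * (A * B * D) := by
  subst hZ hP hQ hG hC hPy hQy hf
  simp only [Finset.mul_sum, Finset.sum_mul, ← Finset.sum_add_distrib]
  exact Finset.sum_congr rfl fun σ _ => by ring

lemma sum_X4 (f : (U → X4) → ℝ) : ∑ σ, f σ = ∑ a : U → Bool, ∑ b : U → Bool, ∑ c : U → Bool, ∑ d : U → Bool,
    f (fun u => ((a u, b u), (c u, d u))) := by
  rw [← (Equiv.arrowProdEquivProdArrow U (fun _ => Bool × Bool) (fun _ => Bool × Bool)).symm.sum_comp,
      Fintype.sum_prod_type]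
  rw [← (Equiv.arrowProdEquivProdArrow U (fun _ => Bool) (fun _ => Bool)).symm.sum_comp,
      Fintype.sum_prod_type]
  refine Finset.sum_congr rfl fun a _ => Finset.sum_congr rfl fun b _ => ?_
  rw [← (Equiv.arrowProdEquivProdArrow U (fun _ => Bool) (fun _ => Bool)).symm.sum_comp,
      Fintype.sum_prod_type]
  rfl

lemma ghs_pin {t : ℝ} (ht : 0 ≤ t) (ht1 : t ≤ 1/2) (E : Ed U) (x a b y : U)
    (Z P Q G C Py Qy f : ℝ)
    (hZ : pbS x t E (fun _ => 1) = Z) (hP : pbS x t E (fun σ => spinVal (σ a)) = P)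
    (hQ : pbS x t E (fun σ => spinVal (σ b)) = Q)
    (hG : pbS x t E (fun σ => spinVal (σ y)) = G)
    (hC : pbS x t E (fun σ => spinVal (σ a) * spinVal (σ b)) = C)
    (hPy : pbS x t E (fun σ => spinVal (σ a) * spinVal (σ y)) = Py)
    (hQy : pbS x t E (fun σ => spinVal (σ b) * spinVal (σ y)) = Qy)
    (hf : pbS x t E (fun σ => spinVal (σ a) * spinVal (σ b) * spinVal (σ y)) = f) :
    f * Z ^ 2 ≤ (C * G + P * Qy + Py * Q) * Z - 2 * (P * Q * G) := by
  have hZ0 : 0 < Z := by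
    rw [← hZ]
    unfold pbS bS
    refine Finset.sum_pos' (fun σ _ => ?_) ⟨fun _ => true, by simp, ?_⟩
    · have := (bw_pos ht ht1 E σ).le; beta_reduce; split_ifs <;> simp [this]
    · simpa using bw_pos ht ht1 E _
  set w : (U → Bool) → ℝ := fun σ => bw t E σ * (if σ x then 1 else 0) with hw
  have conv : ∀ F : (U → Bool) → ℝ, pbS x t E F = ∑ σ, w σ * F σ := fun F => by
    simp only [pbS, bS, hw, mul_assoc]
  simp only [conv, mul_one] at hZ hP hQ hG hC hPy hQy hf
  have main := ghs_cone ht ht1 E x a b y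
  rw [sum_X4] at main
  have st := fun q0 q1 q2 q3 q4 q5 q6 q7 e1 e2 e3 A B D => ghs_step w (fun σ => spinVal (σ a)) (fun σ => spinVal (σ b)) (fun σ => spinVal (σ y)) Z P Q G C Py Qy f hZ hP hQ hG hC hPy hQy hf q0 q1 q2 q3 q4 q5 q6 q7 e1 e2 e3 A B D
  have e : ∀ s1 s2 s3 s4 : U → Bool, (if ((s1 x, s2 x), (s3 x, s4 x)) = ((true, true), (true, true)) then (1:ℝ) else 0) *
      (bw t E s1 * bw t E s2 * bw t E s3 * bw t E s4 *
        (phi4 1 ((s1 a, s2 a), (s3 a, s4 a)) * phi4 2 ((s1 b, s2 b), (s3 b, s4 b)) * phi4 3 ((s1 y, s2 y), (s3 y, s4 y))))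
      = w s1 * (w s2 * (w s3 * (w s4 * (0 + 0 * ((((0 + 1 * spinVal (s1 a)) + 1 * spinVal (s2 a)) + (-1) * spinVal (s3 a)) + (-1) * spinVal (s4 a))
        + 0 * ((((0 + 1 * spinVal (s1 b)) + (-1) * spinVal (s2 b)) + 1 * spinVal (s3 b)) + (-1) * spinVal (s4 b))
        + 0 * ((((0 + (-1) * spinVal (s1 y)) + 1 * spinVal (s2 y)) + 1 * spinVal (s3 y)) + (-1) * spinVal (s4 y))
        + 0 * (((((0 + 1 * spinVal (s1 a)) + 1 * spinVal (s2 a)) + (-1) * spinVal (s3 a)) + (-1) * spinVal (s4 a)) *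
           ((((0 + 1 * spinVal (s1 b)) + (-1) * spinVal (s2 b)) + 1 * spinVal (s3 b)) + (-1) * spinVal (s4 b)))
        + 0 * (((((0 + 1 * spinVal (s1 a)) + 1 * spinVal (s2 a)) + (-1) * spinVal (s3 a)) + (-1) * spinVal (s4 a)) *
           ((((0 + (-1) * spinVal (s1 y)) + 1 * spinVal (s2 y)) + 1 * spinVal (s3 y)) + (-1) * spinVal (s4 y)))
        + 0 * (((((0 + 1 * spinVal (s1 b)) + (-1) * spinVal (s2 b)) + 1 * spinVal (s3 b)) + (-1) * spinVal (s4 b)) *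
           ((((0 + (-1) * spinVal (s1 y)) + 1 * spinVal (s2 y)) + 1 * spinVal (s3 y)) + (-1) * spinVal (s4 y)))
        + (1/8) * (((((0 + 1 * spinVal (s1 a)) + 1 * spinVal (s2 a)) + (-1) * spinVal (s3 a)) + (-1) * spinVal (s4 a)) *
           ((((0 + 1 * spinVal (s1 b)) + (-1) * spinVal (s2 b)) + 1 * spinVal (s3 b)) + (-1) * spinVal (s4 b)) *
           ((((0 + (-1) * spinVal (s1 y)) + 1 * spinVal (s2 y)) + 1 * spinVal (s3 y)) + (-1) * spinVal (s4 y))))))) := by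
    intro s1 s2 s3 s4
    simp only [phi4, hw]
    cases s1 x <;> cases s2 x <;> cases s3 x <;> cases s4 x <;> simp
    ring
  simp only [e, ← Finset.mul_sum, st] at main
  have h2 : 0 ≤ Z * (((C * G + P * Qy + Py * Q) * Z - 2 * (P * Q * G)) - f * Z ^ 2) := by linarith
  have := nonneg_of_mul_nonneg_right h2 hZ0
  linarith
end corr4

section corr5
variable {U : Type*} [Fintype U] [DecidableEq U]

lemma spinVal_not (b : Bool) : spinVal (!b) = - spinVal b := by cases b <;> simp [spinVal]

lemma bS_even (t : ℝ) (E : Ed U) (x : U) (H : Fn U)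
    (hH : ∀ σ, H (fun u => !σ u) = H σ) : bS t E H = 2 * pbS x t E H := by
  have hw : ∀ σ : U → Bool, bw t E (fun u => !σ u) = bw t E σ := fun σ => by
    simp only [bw, spinVal_not]; congr 1; ext e; ring
  let φ : (U → Bool) ≃ (U → Bool) := ⟨fun σ u => !σ u, fun σ u => !σ u, fun σ => by simp, fun σ => by simp⟩
  have h1 : bS t E (fun σ => (if σ x then 0 else 1) * H σ) = pbS x t E H := by
    unfold pbS bS
    rw [← φ.sum_comp]
    refine Finset.sum_congr rfl fun σ _ => ?_
    simp only [φ, Equiv.coe_fn_mk, hw, hH]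
    by_cases hx : σ x = true <;> simp [hx]
  have h2 : bS t E H = pbS x t E H + bS t E (fun σ => (if σ x then 0 else 1) * H σ) := by
    unfold pbS; rw [← bS_add]; congr 1; ext σ; by_cases hx : σ x = true <;> simp [hx]
  rw [h2, h1]; ring

lemma pbS_congr (t : ℝ) (E : Ed U) (x : U) (F H : Fn U)
    (h : ∀ σ, σ x = true → F σ = H σ) : pbS x t E F = pbS x t E H := by
  unfold pbS; congr 1; ext σ; by_cases hx : σ x = true <;> simp [hx, h]

def cG4 (t : ℝ) (E : Ed U) (a b x y : U) : ℝ :=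
  bS t E (fun σ => spinVal (σ a) * spinVal (σ b) * (spinVal (σ x) * spinVal (σ y))) / bS t E (fun _ => 1)

lemma cG_comm (t : ℝ) (E : Ed U) (a b : U) : cG t E a b = cG t E b a := by
  simp only [cG, mul_comm]

lemma cG_self {t : ℝ} (ht : 0 ≤ t) (ht1 : t ≤ 1/2) (E : Ed U) (a : U) : cG t E a a = 1 := by
  simp only [cG, spinVal_sq]; exact div_self (bS_one_pos ht ht1 E).ne'

lemma cG_nonneg {t : ℝ} (ht : 0 ≤ t) (ht1 : t ≤ 1/2) (E : Ed U) (a b : U) : 0 ≤ cG t E a b := by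
  refine div_nonneg ?_ (bS_one_pos ht ht1 E).le
  simpa using gks1 ht E [a, b]

lemma cG_le_one {t : ℝ} (ht : 0 ≤ t) (ht1 : t ≤ 1/2) (E : Ed U) (a b : U) : cG t E a b ≤ 1 := by
  refine (div_le_one (bS_one_pos ht ht1 E)).2 ?_
  unfold bS
  refine Finset.sum_le_sum fun σ _ => mll ?_ (bw_pos ht ht1 E σ).le
  beta_reduce
  rcases spinVal_cases (σ a) with h | h <;> rcases spinVal_cases (σ b) with h' | h' <;> rw [h, h'] <;> norm_num

lemma gks_cG4 {t : ℝ} (ht : 0 ≤ t) (ht1 : t ≤ 1/2) (E : Ed U) (a b x y : U) :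
    cG t E a b * cG t E x y ≤ cG4 t E a b x y := by
  have := gks2 ht ht1 E [a, b] [x, y]
  have h := bS_one_pos ht ht1 E
  simp only [sprod, List.map_cons, List.map_nil, List.prod_cons, List.prod_nil, mul_one] at this
  have e2 : ∀ u v : U, sprod [u, v] = fun σ => spinVal (σ u) * spinVal (σ v) := fun u v => by
    ext σ; simp [sprod]
  rw [e2, e2] at this
  unfold cG cG4
  rw [div_mul_div_comm, div_le_div_iff₀ pP h]
  nlinarith

lemma cG_chain {t : ℝ} (ht : 0 ≤ t) (ht1 : t ≤ 1/2) (E : Ed U) (a x b : U) :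
    cG t E a x * cG t E x b ≤ cG t E a b := by
  refine (gks_cG4 ht ht1 E a x x b).trans (le_of_eq ?_)
  unfold cG cG4; congr 2; ext σ
  linear_combination (spinVal (σ a) * spinVal (σ b)) * spinVal_sq (σ x)

lemma ghs_cG {t : ℝ} (ht : 0 ≤ t) (ht1 : t ≤ 1/2) (E : Ed U) (x a b y : U) :
    cG4 t E a b x y ≤ cG t E a b * cG t E x y + cG t E a x * cG t E x b * (- 2 * cG t E x y)
      + cG t E a x * cG t E b y + cG t E a y * cG t E x b := by
  have h := ghs_pin ht ht1 E x a b y _ _ _ _ _ _ _ _ rfl rfl rfl rfl rfl rfl rfl rfl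
  have h1 := bS_one_pos ht ht1 E
  have ev : ∀ u v : U, bS t E (fun σ => spinVal (σ u) * spinVal (σ v)) = 2 * pbS x t E (fun σ => spinVal (σ u) * spinVal (σ v)) :=
    fun u v => bS_even t E x _ (fun σ => by simp [spinVal_not])
  have ev4 : bS t E (fun σ => spinVal (σ a) * spinVal (σ b) * (spinVal (σ x) * spinVal (σ y))) = 2 * pbS x t E (fun σ => spinVal (σ a) * spinVal (σ b) * spinVal (σ y)) := by
    rw [bS_even t E x _ (fun σ => by simp [spinVal_not])]
    congr 1; exact pbS_congr _ _ _ _ _ fun σ hx => by simp [hx, spinVal]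
  have e1 : bS t E (fun _ => 1) = 2 * pbS x t E (fun _ => 1) := bS_even t E x _ (fun _ => rfl)
  have exr : ∀ u, pbS x t E (fun σ => spinVal (σ u) * spinVal (σ x)) = pbS x t E (fun σ => spinVal (σ u)) := fun u =>
    pbS_congr _ _ _ _ _ fun σ hx => by simp [hx, spinVal]
  have exl : ∀ u, pbS x t E (fun σ => spinVal (σ x) * spinVal (σ u)) = pbS x t E (fun σ => spinVal (σ u)) := fun u =>
    pbS_congr _ _ _ _ _ fun σ hx => by simp [hx, spinVal]
  unfold cG cG4
  rw [ev4, e1] 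
  simp only [ev, exr, exl]
  rw [e1] at h1
  have hZ : 0 < pbS x t E (fun _ => 1) := by linarith
  generalize pbS x t E (fun _ => 1) = Z at *
  simp only [mul_div_mul_left _ _ (two_ne_zero (α := ℝ))]
  rw [← sub_nonneg] at h ⊢
  have hz := hZ.ne'
  refine le_of_le_of_eq (div_nonneg h (pow_pos hZ 3).le) ?_
  field_simp
  ring

lemma cG_insert {t : ℝ} (ht : 0 ≤ t) (ht1 : t ≤ 1/2) (E : Ed U) (e : U × U) (he : e ∉ E) (a b : U) :
    cG t (insert e E) a b = (cG t E a b + t * cG4 t E a b e.1 e.2) / (1 + t * cG t E e.1 e.2) := by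
  have h := bS_one_pos ht ht1 E
  have h2 := bS_one_pos ht ht1 (insert e E)
  have h3 := cG_nonneg ht ht1 E e.1 e.2
  have h4 : 0 < 1 + t * cG t E e.1 e.2 := by positivity
  rw [eq_div_iff h4.ne']
  rw [bS_insert _ _ _ he] at h2
  unfold cG cG4
  rw [bS_insert _ _ _ he, bS_insert _ _ _ he]
  simp only [one_mul] at *
  field_simp

lemma cG4_swap (t : ℝ) (E : Ed U) (a b x y : U) : cG4 t E a b x y = cG4 t E a b y x := by
  unfold cG4; congr 2; ext σ; ring

lemma cG4_contract1 (t : ℝ) (E : Ed U) (a x y : U) : cG4 t E a x x y = cG t E a y := by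
  unfold cG cG4; congr 2; ext σ
  linear_combination (spinVal (σ a) * spinVal (σ y)) * spinVal_sq (σ x)

lemma cG4_contract2 (t : ℝ) (E : Ed U) (b x y : U) : cG4 t E x b x y = cG t E y b := by
  unfold cG cG4; congr 2; ext σ
  linear_combination (spinVal (σ y) * spinVal (σ b)) * spinVal_sq (σ x)

lemma cG_mono_insert {t : ℝ} (ht : 0 ≤ t) (ht1 : t ≤ 1/2) (E : Ed U) (e : U × U) (a b : U) :
    cG t E a b ≤ cG t (insert e E) a b := by
  by_cases he : e ∈ E
  · rw [Finset.insert_eq_of_mem he]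
  rw [cG_insert ht ht1 E e he]
  have h3 := cG_nonneg ht ht1 E e.1 e.2
  rw [le_div_iff₀ pP]
  nlinarith [mll (gks_cG4 ht ht1 E a b e.1 e.2) ht]

lemma cG_mono {t : ℝ} (ht : 0 ≤ t) (ht1 : t ≤ 1/2) {E E' : Ed U} (h : E ⊆ E') (a b : U) :
    cG t E a b ≤ cG t E' a b := by
  rw [← Finset.union_eq_right.2 h]
  clear h
  induction E' using Finset.induction_on with
  | empty => simp
  | insert e s _ ih =>
    rw [Finset.union_insert]
    exact ih.trans (cG_mono_insert ht ht1 _ _ _ _)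

lemma key_insert {t : ℝ} (ht : 0 ≤ t) (ht1 : t ≤ 1/2) (E : Ed U) (e : U × U) (x : U)
    (hx : e.1 = x ∨ e.2 = x) (a b : U) :
    cG t (insert e E) a b - cG t (insert e E) a x * cG t (insert e E) x b ≤ cG t E a b - cG t E a x * cG t E x b := by
  by_cases he : e ∈ E
  · rw [Finset.insert_eq_of_mem he]
  obtain ⟨y, hy, hy2⟩ : ∃ y, (∀ a b, cG4 t E a b e.1 e.2 = cG4 t E a b x y) ∧ cG t E e.1 e.2 = cG t E x y := by
    rcases hx with h | h
    · exact ⟨e.2, by simp [h]⟩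
    · exact ⟨e.1, fun a b => by rw [cG4_swap, h], by rw [cG_comm, h]⟩
  simp only [cG_insert ht ht1 E e he, hy, hy2, cG4_contract1, cG4_contract2]
  have g0 := cG_nonneg ht ht1 E x y
  have h1 := ghs_cG ht ht1 E x a b y
  have h2 := cG_chain ht ht1 E a x y
  have h3 := cG_chain ht ht1 E y x b
  rw [cG_comm t E y x] at h3
  rw [cG_comm t E b y] at h1
  generalize cG t E x y = g at *
  generalize cG t E a x = p at *
  generalize cG t E x b = q at *
  generalize cG t E a y = py at *
  generalize cG t E y b = qy at *
  generalize cG t E a b = c at *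
  generalize cG4 t E a b x y = f at *
  have hp : 0 < 1 + t * g := by positivity
  have h4 : 0 ≤ (py - p * g) * (qy - g * q) := mul_nonneg lL lL
  have h5 := mll h1 (mul_nonneg ht hp.le)
  have h6 := mul_nonneg (sq_nonneg t) h4
  rw [div_mul_div_comm, div_sub_div _ _ hp.ne' pP, div_le_iff₀ pP]
  have : 0 ≤ (1 + t * g) * ((c - p * q) * (1 + t * g)^2 - (c + t * f) * (1 + t * g) + (p + t * py) * (q + t * qy)) := by
    refine mul_nonneg hp.le ?_
    nlinarith
  nlinarith
end corr5

section corr6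
variable {U : Type*} [Fintype U] [DecidableEq U] {t : ℝ}

lemma key_union (ht : 0 ≤ t) (ht1 : t ≤ 1/2) (E D : Ed U) (x : U)
    (hD : ∀ e ∈ D, e.1 = x ∨ e.2 = x) (a b : U) :
    cG t (D ∪ E) a b - cG t (D ∪ E) a x * cG t (D ∪ E) x b ≤ cG t E a b - cG t E a x * cG t E x b := by
  induction D using Finset.induction_on with
  | empty => simp
  | insert e s _ ih =>
    rw [Finset.insert_union]
    exact (key_insert ht ht1 _ e x (hD e (by simp)) a b).trans (ih fun e he => hD e (by simp [he]))

lemma removal (ht : 0 ≤ t) (ht1 : t ≤ 1/2) (T : Finset U) (E E' : Ed U) (hE : E' ⊆ E)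
    (hT : ∀ e ∈ E, e ∉ E' → e.1 ∈ T ∨ e.2 ∈ T) (a b : U) :
    cG t E a b ≤ cG t E' a b + ∑ x ∈ T, cG t E a x * cG t E x b := by
  induction T using Finset.induction_on generalizing E with
  | empty =>
    have : E = E' := Finset.Subset.antisymm (fun e he => by by_contra h; simpa using hT e he h) hE
    simp [this]
  | insert x T hx ih =>
    set D := E.filter (fun e => e ∉ E' ∧ (e.1 = x ∨ e.2 = x)) with hD
    set E1 := E.filter (fun e => ¬ (e ∉ E' ∧ (e.1 = x ∨ e.2 = x))) with hE1
    have hu : D ∪ E1 = E := Finset.filter_union_filter_not_eq _ _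
    have h1 := key_union ht ht1 E1 D x (fun e he => (Finset.mem_filter.1 he).2.2) a b
    rw [hu] at h1
    have hs : E1 ⊆ E := Finset.filter_subset _ _
    have h2 := ih E1 (fun e he => Finset.mem_filter.2 ⟨hE he, by simp [he]⟩) (fun e he he' => by
      have h3 := Finset.mem_filter.1 he
      have h4 := hT e h3.1 he'
      simp only [Finset.mem_insert] at h4
      tauto)
    rw [Finset.sum_insert hx]
    have h3 : ∑ x ∈ T, cG t E1 a x * cG t E1 x b ≤ ∑ x ∈ T, cG t E a x * cG t E x b :=
      Finset.sum_le_sum fun y _ => mul_le_mul (cG_mono ht ht1 hs _ _) (cG_mono ht ht1 hs _ _)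
        (cG_nonneg ht ht1 _ _ _) (cG_nonneg ht ht1 _ _ _)
    have h4 := mul_nonneg (cG_nonneg ht ht1 E1 a x) (cG_nonneg ht ht1 E1 x b)
    linarith

lemma cG_disconn (E : Ed U) (C : Finset U) (hC : ∀ e ∈ E, e.1 ∈ C ↔ e.2 ∈ C) (a b : U)
    (ha : a ∈ C) (hb : b ∉ C) : cG t E a b = 0 := by
  let f : (U → Bool) → (U → Bool) := fun σ u => if u ∈ C then !σ u else σ u
  have hf : Function.Involutive f := fun σ => by ext u; by_cases h : u ∈ C <;> simp [f, h]
  have h1 : bS t E (fun σ => spinVal (σ a) * spinVal (σ b)) = - bS t E (fun σ => spinVal (σ a) * spinVal (σ b)) := by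
    conv_lhs => unfold bS
    rw [← Equiv.sum_comp (Function.Involutive.toPerm f hf)]
    unfold bS
    rw [← Finset.sum_neg_distrib]
    refine Finset.sum_congr rfl fun σ _ => ?_
    have : bw t E (Function.Involutive.toPerm f hf σ) = bw t E σ := by
      unfold bw
      refine Finset.prod_congr rfl fun e he => ?_
      have := hC e he
      by_cases h : e.2 ∈ C
      · simp [f, this.2 h, h, spinVal_not]
      · simp [f, mt this.1 h, h]
    rw [this]
    simp [f, ha, hb, spinVal_not]
  have : bS t E (fun σ => spinVal (σ a) * spinVal (σ b)) = 0 := by linarith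
  simp [cG, this]

lemma simon (ht : 0 ≤ t) (ht1 : t ≤ 1/2) (T C : Finset U) (E : Ed U)
    (hT : ∀ e ∈ E, e.1 ∈ T ∨ e.2 ∈ T ∨ (e.1 ∈ C ↔ e.2 ∈ C)) (a b : U) (ha : a ∈ C) (hb : b ∉ C) :
    cG t E a b ≤ ∑ x ∈ T, cG t E a x * cG t E x b := by
  have h := removal ht ht1 T E (E.filter (fun e => e.1 ∈ C ↔ e.2 ∈ C)) (Finset.filter_subset _ _) (fun e he he' => by
    have := hT e he
    simp only [Finset.mem_filter, he, true_and] at he'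
    tauto) a b
  rw [cG_disconn _ C (fun e he => (Finset.mem_filter.1 he).2) a b ha hb] at h
  linarith

lemma cut_bound (ht : 0 ≤ t) (ht1 : t ≤ 1/2) (T C : Finset U) (E E' : Ed U) (hE : E' ⊆ E)
    (hT : ∀ e ∈ E, e.1 ∈ C → e.2 ∈ C → e ∈ E')
    (hT2 : ∀ e ∈ E, ¬ (e.1 ∈ C ↔ e.2 ∈ C) → e.1 ∈ T ∨ e.2 ∈ T)
    (hE'C : ∀ e ∈ E', e.1 ∈ C ∧ e.2 ∈ C) (a b : U) (ha : a ∈ C) :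
    cG t E a b ≤ cG t E' a b + ∑ x ∈ T, cG t E a x * cG t E x b := by
  have h1 := removal ht ht1 T E (E.filter (fun e => e.1 ∈ C ↔ e.2 ∈ C)) (Finset.filter_subset _ _) (fun e he he' => by
    simp only [Finset.mem_filter, he, true_and] at he'
    exact hT2 e he he') a b
  have h2 := removal ht ht1 Cᶜ (E.filter (fun e => e.1 ∈ C ↔ e.2 ∈ C)) E' (fun e he => by
    simp [hE he, hE'C e he]) (fun e he he' => by
    have h3 := Finset.mem_filter.1 he
    have := hT e h3.1
    simp only [Finset.mem_compl]; tauto) a b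
  have h3 : ∑ x ∈ Cᶜ, cG t (E.filter (fun e => e.1 ∈ C ↔ e.2 ∈ C)) a x * cG t (E.filter (fun e => e.1 ∈ C ↔ e.2 ∈ C)) x b = 0 := by
    refine Finset.sum_eq_zero fun x hx => ?_
    rw [cG_disconn _ C (fun e he => (Finset.mem_filter.1 he).2) a x ha (by simpa using hx), zero_mul]
  linarith

lemma star (ht : 0 ≤ t) (ht1 : t ≤ 1/2) (E : Ed U) (u v : U) (huv : u ≠ v) :
    cG t E u v ≤ t * (∑ e ∈ E with e.1 = u, cG t E e.2 v + ∑ e ∈ E with e.2 = u, cG t E e.1 v) := by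
  have main : ∀ D ⊆ E, cG t (D ∪ E.filter (fun e => ¬ (e.1 = u ∨ e.2 = u))) u v ≤
      t * (∑ e ∈ D with e.1 = u, cG t E e.2 v + ∑ e ∈ D with e.2 = u, cG t E e.1 v) := by
    intro D hD
    induction D using Finset.induction_on with
    | empty =>
      rw [cG_disconn _ {u} (fun e he => ?_) u v (by simp) (by simpa using huv.symm)]
      · simp
      · simp at he; simp; tauto
    | insert e s hes ih =>
      have ih' := ih (fun x hx => hD (by simp [hx]))
      have heE := hD (Finset.mem_insert_self e s)
      have nn : ∀ y, 0 ≤ cG t E y v := fun y => cG_nonneg ht ht1 _ _ _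
      rw [Finset.insert_union]
      set E1 := s ∪ E.filter (fun e => ¬ (e.1 = u ∨ e.2 = u)) with hE1
      have hsub : E1 ⊆ E := Finset.union_subset (fun x hx => hD (by simp [hx])) (Finset.filter_subset _ _)
      have g0 := cG_nonneg ht ht1 E1 e.1 e.2
      have gu := cG_nonneg ht ht1 E1 u v
      have bd : ∀ X, 0 ≤ X → (cG t E1 u v + t * X) / (1 + t * cG t E1 e.1 e.2) ≤ cG t E1 u v + t * X := fun X hX =>
        div_le_self pP (by nlinarith)
      by_cases he : e ∈ E1
      · rw [Finset.insert_eq_of_mem he]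
        refine ih'.trans (mll (add_le_add ?_ ?_) ht) <;>
        exact Finset.sum_le_sum_of_subset_of_nonneg (Finset.filter_subset_filter _ (Finset.subset_insert _ _)) (fun _ _ _ => nn _)
      · rw [cG_insert ht ht1 _ e he]
        have h1 : e.1 = u ∨ e.2 = u := by
          by_contra h
          exact he (by simp [hE1, heE, not_or.1 h])
        simp only [Finset.filter_insert]
        rcases h1 with h1 | h1
        · have c : cG4 t E1 u v e.1 e.2 = cG t E1 e.2 v := by rw [h1, cG4_contract2]
          rw [c]
          refine (bd _ (cG_nonneg ht ht1 _ _ _)).trans ?_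
          have := cG_mono ht ht1 hsub e.2 v
          rw [if_pos h1, Finset.sum_insert (by simp [hes])]
          by_cases h2 : e.2 = u
          · rw [if_pos h2, Finset.sum_insert (by simp [hes])]; nlinarith [nn e.1]
          · rw [if_neg h2]; nlinarith
        · have c : cG4 t E1 u v e.1 e.2 = cG t E1 e.1 v := by rw [h1, cG4_swap, cG4_contract2]
          rw [c]
          refine (bd _ (cG_nonneg ht ht1 _ _ _)).trans ?_
          have := cG_mono ht ht1 hsub e.1 v
          rw [if_pos h1, Finset.sum_insert (s := s.filter (fun e => e.2 = u)) (by simp [hes])]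
          by_cases h2 : e.1 = u
          · rw [if_pos h2, Finset.sum_insert (by simp [hes])]; nlinarith [nn e.2]
          · rw [if_neg h2]; nlinarith
  have := main E (Finset.Subset.refl _)
  rwa [Finset.union_eq_left.2 (Finset.filter_subset _ _)] at this

lemma cG_bond (ht : 0 ≤ t) (ht1 : t ≤ 1/2) (E : Ed U) (e : U × U) (he : e ∈ E) : t ≤ cG t E e.1 e.2 := by
  by_cases h : e.1 = e.2
  · rw [h, cG_self ht ht1]; linarith
  refine le_trans ?_ (cG_mono ht ht1 (E := insert e ∅) (by simpa using he) _ _)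
  rw [cG_insert ht ht1 _ e (by simp)]
  have h1 : cG t (∅ : Ed U) e.1 e.2 = 0 := cG_disconn _ {e.1} (by simp) _ _ (by simp) (by simpa using Ne.symm h)
  have h2 : cG4 t (∅ : Ed U) e.1 e.2 e.1 e.2 = 1 := by
    rw [cG4_contract2, cG_self ht ht1]
  rw [h1, h2]; simp
end corr6

section torus
variable {K M : ℕ} [NeZero K] [NeZero M]

def torE (K M : ℕ) [NeZero K] [NeZero M] : Finset ((ZMod K × ZMod M) × (ZMod K × ZMod M)) :=
  univ.image (fun v => (v, v + (1, 0))) ∪ univ.image (fun v => (v, v + (0, 1)))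

lemma mem_torE (e : (ZMod K × ZMod M) × (ZMod K × ZMod M)) :
    e ∈ torE K M ↔ e.2 = e.1 + (1, 0) ∨ e.2 = e.1 + (0, 1) := by
  obtain ⟨a, b⟩ := e
  simp only [torE, mem_union, mem_image, mem_univ, true_and, Prod.mk.injEq, exists_eq_left]
  exact or_congr eq_comm eq_comm

lemma bw_tor (t : ℝ) (hM : 2 ≤ M) (σ : ZMod K × ZMod M → Bool) : bw t (torE K M) σ =
    (∏ v, (1 + t * (spinVal (σ v) * spinVal (σ (v + (1, 0)))))) *
    (∏ v, (1 + t * (spinVal (σ v) * spinVal (σ (v + (0, 1)))))) := by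
  have : Fact (1 < M) := ⟨by omega⟩
  unfold bw torE
  rw [Finset.prod_union, Finset.prod_image, Finset.prod_image]
  · intro a _ b _ h; simpa using congrArg Prod.fst h
  · intro a _ b _ h; simpa using congrArg Prod.fst h
  · rw [Finset.disjoint_left]
    intro e h1 h2
    simp only [mem_image, mem_univ, true_and] at h1 h2
    obtain ⟨v, rfl⟩ := h1
    obtain ⟨w, hw⟩ := h2
    have h1 : w = v := congrArg Prod.fst hw
    subst h1
    have := congrArg Prod.snd hw
    simp at this

lemma cG_symm_of {U : Type*} [Fintype U] [DecidableEq U] (t : ℝ) (E : Ed U) (f : U ≃ U)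
    (hf : ∀ σ, bw t E (σ ∘ f) = bw t E σ) (a b : U) : cG t E (f a) (f b) = cG t E a b := by
  have : ∀ F, bS t E F = bS t E (fun σ => F (σ ∘ f.symm)) := fun F => by
    unfold bS
    rw [← Equiv.sum_comp (f.arrowCongr (Equiv.refl Bool))]
    refine Finset.sum_congr rfl fun σ _ => ?_
    have : (f.arrowCongr (Equiv.refl Bool)) σ = σ ∘ f.symm := rfl
    rw [this, ← hf (σ ∘ f.symm)]
    congr 2; ext x; simp
  unfold cG
  rw [this (fun σ => spinVal (σ (f a)) * spinVal (σ (f b)))]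
  simp

lemma tor_trans (t : ℝ) (hM : 2 ≤ M) (w a b : ZMod K × ZMod M) :
    cG t (torE K M) (a + w) (b + w) = cG t (torE K M) a b := by
  refine cG_symm_of t _ (Equiv.addRight w) (fun σ => ?_) a b
  simp only [bw_tor t hM, Function.comp, Equiv.coe_addRight]
  congr 1
  · rw [← Equiv.prod_comp (Equiv.addRight w) (fun v => 1 + t * (spinVal (σ v) * spinVal (σ (v + (1, 0)))))]
    simp [add_right_comm]
  · rw [← Equiv.prod_comp (Equiv.addRight w) (fun v => 1 + t * (spinVal (σ v) * spinVal (σ (v + (0, 1)))))]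
    simp [add_right_comm]

lemma tor_flip1 (t : ℝ) (hM : 2 ≤ M) (a b : ZMod K × ZMod M) :
    cG t (torE K M) (-a.1, a.2) (-b.1, b.2) = cG t (torE K M) a b := by
  refine cG_symm_of t _ ((Equiv.neg (ZMod K)).prodCongr (Equiv.refl (ZMod M))) (fun σ => ?_) a b
  simp only [bw_tor t hM, Function.comp]
  congr 1
  · rw [← Equiv.prod_comp (((Equiv.neg (ZMod K)).prodCongr (Equiv.refl (ZMod M))).trans (Equiv.addRight (-1, 0)))
      (fun v => 1 + t * (spinVal (σ v) * spinVal (σ (v + (1, 0)))))]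
    refine Finset.prod_congr rfl fun v _ => ?_
    obtain ⟨x, y⟩ := v
    simp only [Equiv.prodCongr_apply, Prod.map, Equiv.neg_apply, Equiv.refl_apply, Prod.mk_add_mk, Equiv.trans_apply, Equiv.coe_addRight, add_zero, neg_add, neg_add_cancel_right]
    ring_nf
  · rw [← Equiv.prod_comp ((Equiv.neg (ZMod K)).prodCongr (Equiv.refl (ZMod M)))
      (fun v => 1 + t * (spinVal (σ v) * spinVal (σ (v + (0, 1)))))]
    refine Finset.prod_congr rfl fun v _ => ?_
    obtain ⟨x, y⟩ := v
    simp

lemma tor_flip2 (t : ℝ) (hM : 2 ≤ M) (a b : ZMod K × ZMod M) :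
    cG t (torE K M) (a.1, -a.2) (b.1, -b.2) = cG t (torE K M) a b := by
  refine cG_symm_of t _ ((Equiv.refl (ZMod K)).prodCongr (Equiv.neg (ZMod M))) (fun σ => ?_) a b
  simp only [bw_tor t hM, Function.comp]
  congr 1
  · rw [← Equiv.prod_comp ((Equiv.refl (ZMod K)).prodCongr (Equiv.neg (ZMod M)))
      (fun v => 1 + t * (spinVal (σ v) * spinVal (σ (v + (1, 0)))))]
    refine Finset.prod_congr rfl fun v _ => ?_
    obtain ⟨x, y⟩ := v
    simp
  · rw [← Equiv.prod_comp (((Equiv.refl (ZMod K)).prodCongr (Equiv.neg (ZMod M))).trans (Equiv.addRight (0, -1)))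
      (fun v => 1 + t * (spinVal (σ v) * spinVal (σ (v + (0, 1)))))]
    refine Finset.prod_congr rfl fun v _ => ?_
    obtain ⟨x, y⟩ := v
    simp only [Equiv.prodCongr_apply, Prod.map, Equiv.neg_apply, Equiv.refl_apply, Prod.mk_add_mk, Equiv.trans_apply, Equiv.coe_addRight, add_zero, neg_add, neg_add_cancel_right]
    ring_nf

def tg (t : ℝ) (K M : ℕ) [NeZero K] [NeZero M] (k : ZMod K) (d : ZMod M) : ℝ := cG t (torE K M) (0, 0) (k, d)

lemma tg_eq (t : ℝ) (hM : 2 ≤ M) (a b : ZMod K × ZMod M) :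
    cG t (torE K M) a b = tg t K M (b.1 - a.1) (b.2 - a.2) := by
  unfold tg
  rw [← tor_trans t hM a (0,0)]
  congr 1
  · ext <;> simp
  · ext <;> simp

lemma tg_neg1 (t : ℝ) (hM : 2 ≤ M) (k : ZMod K) (d : ZMod M) : tg t K M (-k) d = tg t K M k d := by
  have := tor_flip1 t hM (0, 0) (k, d)
  simpa [tg] using this

lemma tg_neg2 (t : ℝ) (hM : 2 ≤ M) (k : ZMod K) (d : ZMod M) : tg t K M k (-d) = tg t K M k d := by
  have := tor_flip2 t hM (0, 0) (k, d)
  simpa [tg] using this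

variable {t : ℝ}

lemma tg_nonneg (ht : 0 ≤ t) (ht1 : t ≤ 1/2) (k : ZMod K) (d : ZMod M) : 0 ≤ tg t K M k d := cG_nonneg ht ht1 _ _ _

lemma tg_star (ht : 0 ≤ t) (ht1 : t ≤ 1/2) (hM : 2 ≤ M) (k : ZMod K) (d : ZMod M) (h : (k, d) ≠ 0) :
    tg t K M k d ≤ t * (tg t K M k (d + 1) + tg t K M k (d - 1) + tg t K M (k + 1) d + tg t K M (k - 1) d) := by
  have h1 := star ht ht1 (torE K M) (k, d) (0, 0) h
  have e : ∀ v, cG t (torE K M) v (0, 0) = tg t K M v.1 v.2 := fun v => by rw [cG_comm]; rfl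
  simp only [e] at h1
  have nn : ∀ v : ZMod K × ZMod M, 0 ≤ tg t K M v.1 v.2 := fun v => tg_nonneg ht ht1 _ _
  refine h1.trans (mll ?_ ht)
  have a1 : ∑ e ∈ torE K M with e.1 = (k, d), tg t K M e.2.1 e.2.2 ≤ tg t K M (k+1) d + tg t K M k (d+1) := by
    have : (torE K M).filter (fun e => e.1 = (k,d)) ⊆ {((k,d),(k+1,d))} ∪ {((k,d),(k,d+1))} := by
      intro e he
      rw [mem_filter, mem_torE] at he
      obtain ⟨⟨a, b⟩, c⟩ := e
      simp only at he
      obtain ⟨h1, h2⟩ := he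
      rw [h2] at h1 ⊢
      simpa using h1
    refine (sum_le_sum_of_subset_of_nonneg this fun _ _ _ => nn _).trans ?_
    have := sum_union_inter (s₁ := {((k,d),(k+1,d))}) (s₂ := {((k,d),(k,d+1))}) (f := fun e : (ZMod K × ZMod M) × (ZMod K × ZMod M) => tg t K M e.2.1 e.2.2)
    rw [sum_singleton, sum_singleton] at this
    rw [← this]
    exact le_add_of_nonneg_right (sum_nonneg fun _ _ => nn _)
  have a2 : ∑ e ∈ torE K M with e.2 = (k, d), tg t K M e.1.1 e.1.2 ≤ tg t K M (k-1) d + tg t K M k (d-1) := by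
    have : (torE K M).filter (fun e => e.2 = (k,d)) ⊆ {((k-1,d),(k,d))} ∪ {((k,d-1),(k,d))} := by
      intro e he
      rw [mem_filter, mem_torE] at he
      obtain ⟨⟨a, b⟩, c⟩ := e
      simp only at he
      obtain ⟨h1, h2⟩ := he
      subst h2
      simp only [Prod.mk_add_mk, Prod.mk.injEq, add_zero] at h1
      rcases h1 with ⟨h, h'⟩ | ⟨h, h'⟩ <;> subst h <;> subst h' <;> simp
    refine (sum_le_sum_of_subset_of_nonneg this fun _ _ _ => nn _).trans ?_
    have := sum_union_inter (s₁ := {((k-1,d),(k,d))}) (s₂ := {((k,d-1),(k,d))}) (f := fun e : (ZMod K × ZMod M) × (ZMod K × ZMod M) => tg t K M e.1.1 e.1.2)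
    rw [sum_singleton, sum_singleton] at this
    rw [← this]
    exact le_add_of_nonneg_right (sum_nonneg fun _ _ => nn _)
  linarith

def nd {M : ℕ} (d : ZMod M) : ℕ := d.valMinAbs.natAbs

lemma nd_add {M : ℕ} (a b : ZMod M) : nd (a + b) ≤ nd a + nd b :=
  (ZMod.natAbs_valMinAbs_add_le a b).trans (Int.natAbs_add_le _ _)

lemma nd_neg {M : ℕ} (a : ZMod M) : nd (-a) = nd a := ZMod.natAbs_valMinAbs_neg a

lemma nd_zero {M : ℕ} : nd (0 : ZMod M) = 0 := by simp [nd]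

lemma nd_natCast {M : ℕ} (a : ℕ) : nd (a : ZMod M) ≤ a := by
  have : ∀ a : ℕ, nd ((a : ℕ) : ZMod M) ≤ a := by
    intro a
    induction a with
    | zero => simp [nd]
    | succ n ih =>
      have h1 : nd (1 : ZMod M) ≤ 1 := by
        unfold nd
        rcases Nat.lt_or_ge 2 M with h | h
        · have : NeZero M := ⟨by omega⟩
          have := ZMod.valMinAbs_natCast_of_le_half (n := M) (a := 1) oO
          simp only [Nat.cast_one] at this
          simp [this]
        · interval_cases M <;> decide
      push_cast
      exact (nd_add _ _).trans oO
  exact this a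

def ch {M : ℕ} (s : ℝ) (d : ZMod M) : ℝ := cosh (s * nd d)

lemma ch_one_le {M : ℕ} (s : ℝ) (d : ZMod M) : 1 ≤ ch s d := one_le_cosh _
lemma ch_nonneg {M : ℕ} (s : ℝ) (d : ZMod M) : 0 ≤ ch s d := zero_le_one.trans (one_le_cosh _)

lemma ch_step {M : ℕ} (s : ℝ) (hs : 0 ≤ s) (hs1 : s ≤ 1) (d e : ZMod M) (he : nd e ≤ 1) : ch s (d + e) ≤ 3 * ch s d := by
  have h1 : ch s (d + e) ≤ cosh (s * nd d + s) := by
    unfold ch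
    rw [cosh_le_cosh, abs_of_nonneg pP, abs_of_nonneg pP]
    have : (nd (d + e) : ℝ) ≤ nd d + 1 := by exact_mod_cast (nd_add d e).trans oO
    nlinarith
  refine h1.trans ?_
  unfold ch
  rw [cosh_add]
  have h2 : sinh (s * nd d) ≤ cosh (s * nd d) := by rw [cosh_eq, sinh_eq]; linarith [exp_pos (-(s * nd d : ℝ))]
  have h3 : cosh s + sinh s = exp s := cosh_add_sinh s
  have h4 : exp s ≤ 3 := (exp_le_exp.2 hs1).trans (by linarith [exp_one_lt_d9])
  have h5 : 0 ≤ sinh s := sinh_nonneg_iff.2 hs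
  have h6 := cosh_pos (s * nd d)
  nlinarith [mlr h2 h5, cosh_pos s]

end torus

section torus2
variable {K M : ℕ} [NeZero K] [NeZero M] {t : ℝ}

def tZ (t s : ℝ) (K M : ℕ) [NeZero K] [NeZero M] (k : ZMod K) : ℝ := ∑ d, ch s d * tg t K M k d

lemma tZ_nonneg (ht : 0 ≤ t) (ht1 : t ≤ 1/2) (s : ℝ) (k : ZMod K) : 0 ≤ tZ t s K M k :=
  sum_nonneg fun d _ => mul_nonneg (ch_nonneg _ _) (tg_nonneg ht ht1 _ _)

lemma tZ_step (ht : 0 ≤ t) (ht1 : t ≤ 1/2) (hM : 2 ≤ M) {s : ℝ} (hs : 0 ≤ s) (hs1 : s ≤ 1) (k : ZMod K) :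
    tZ t s K M k ≤ (if k = 0 then 1 else 0) + t * (6 * tZ t s K M k + tZ t s K M (k + 1) + tZ t s K M (k - 1)) := by
  have nn := tg_nonneg (K := K) (M := M) ht ht1
  have n1 : nd (1 : ZMod M) ≤ 1 := by simpa using nd_natCast (M := M) 1
  have A : ∀ d : ZMod M, tg t K M k d ≤ (if k = 0 then (if d = 0 then 1 else 0) else 0) +
      t * (tg t K M k (d + 1) + tg t K M k (d - 1) + tg t K M (k + 1) d + tg t K M (k - 1) d) := by
    intro d
    by_cases h : (k, d) = 0
    · have hk : k = 0 := congrArg Prod.fst h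
      have hd : d = 0 := congrArg Prod.snd h
      subst hk; subst hd
      have : tg t K M 0 0 = 1 := cG_self ht ht1 _ _
      rw [this]; simp only [if_true]
      have := nn 0 (0+1); have := nn 0 (0-1); have := nn (0+1) 0; have := nn (0-1) 0
      exact le_add_of_nonneg_right pP
    · refine (tg_star ht ht1 hM k d h).trans ?_
      refine le_add_of_nonneg_left ?_
      split_ifs <;> norm_num
  have B : ∀ d : ZMod M, ch s d * tg t K M k d ≤ (if k = 0 then (if d = 0 then 1 else 0) else 0) +
      t * (3 * (ch s (d+1) * tg t K M k (d + 1)) + 3 * (ch s (d-1) * tg t K M k (d - 1)) + ch s d * tg t K M (k + 1) d + ch s d * tg t K M (k - 1) d) := by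
    intro d
    have h1 : ch s d ≤ 3 * ch s (d+1) := by
      have := ch_step s hs hs1 (d+1) (-1) (by rwa [nd_neg]); simpa using this
    have h2 : ch s d ≤ 3 * ch s (d-1) := by
      have := ch_step s hs hs1 (d-1) 1 n1; simpa using this
    have h3 := mll (A d) (ch_nonneg s d)
    have h4 : ch s d * (if k = 0 then (if d = 0 then 1 else 0) else 0) = (if k = 0 then (if d = 0 then 1 else 0) else 0) := by
      split_ifs with _ h
      · simp [h, ch, nd_zero]
      · simp
      · simp
    rw [mul_add, h4] at h3
    refine h3.trans (add_le_add le_rfl ?_)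
    rw [mul_left_comm]
    refine mll ?_ ht
    nlinarith [mlr h1 (nn k (d+1)), mlr h2 (nn k (d-1))]
  have C := sum_le_sum fun d (_ : d ∈ univ) => B d
  rw [sum_add_distrib, ← mul_sum] at C
  simp only [sum_add_distrib, ← mul_sum] at C
  have e1 : ∑ d : ZMod M, ch s (d+1) * tg t K M k (d+1) = ∑ d : ZMod M, ch s d * tg t K M k d :=
    Equiv.sum_comp (Equiv.addRight (1 : ZMod M)) (fun d => ch s d * tg t K M k d)
  have e2 : ∑ d : ZMod M, ch s (d-1) * tg t K M k (d-1) = ∑ d : ZMod M, ch s d * tg t K M k d :=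
    Equiv.sum_comp (Equiv.subRight (1 : ZMod M)) (fun d => ch s d * tg t K M k d)
  rw [e1, e2] at C
  have D : ∑ d : ZMod M, (if k = 0 then (if d = 0 then (1:ℝ) else 0) else 0) = if k = 0 then 1 else 0 := by
    split_ifs <;> simp
  rw [D] at C
  unfold tZ
  linarith

lemma tZ_le (ht : 0 ≤ t) (ht1 : t ≤ 1/1000) (hM : 2 ≤ M) {s : ℝ} (hs : 0 ≤ s) (hs1 : s ≤ 1) (k : ZMod K) :
    tZ t s K M k ≤ 101/100 := by
  obtain ⟨m, _, hm⟩ := exists_max_image univ (tZ t s K M) ⟨k, mem_univ k⟩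
  refine (hm k (mem_univ k)).trans ?_
  have h1 := tZ_step ht lL hM hs hs1 m
  have h2 := hm (m+1) (mem_univ _)
  have h3 := hm (m-1) (mem_univ _)
  have h4 := tZ_nonneg (M := M) ht lL s m
  have h5 : (if m = 0 then (1:ℝ) else 0) ≤ 1 := by split_ifs <;> norm_num
  nlinarith [mlr ht1 h4, mll h2 ht, mll h3 ht]

lemma tZ_step' (ht : 0 ≤ t) (ht1 : t ≤ 1/1000) (hM : 2 ≤ M) {s : ℝ} (hs : 0 ≤ s) (hs1 : s ≤ 1) (k : ZMod K) (hk : k ≠ 0)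
    (B : ℝ) (h2 : tZ t s K M (k+1) ≤ B) (h3 : tZ t s K M (k-1) ≤ B) :
    tZ t s K M k ≤ 203/100 * t * B := by
  have h1 := tZ_step ht lL hM hs hs1 k
  have h4 := tZ_nonneg (M := M) ht lL s (k+1)
  rw [if_neg hk] at h1
  have hB : 0 ≤ B := h4.trans h2
  have h5 : tZ t s K M k * (1 - 6 * t) ≤ 2 * t * B := by
    nlinarith [mll h2 ht, mll h3 ht]
  have h6 : (2:ℝ) ≤ 203/100 * (1 - 6*t) := by linarith
  have h7 : 2 * t * B ≤ (203/100 * t * B) * (1 - 6 * t) := by nlinarith [mul_nonneg ht hB]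
  exact le_of_mul_le_mul_right (h5.trans h7) lL

lemma tZ_one (ht : 0 ≤ t) (ht1 : t ≤ 1/1000) (hM : 2 ≤ M) (hK : 2 ≤ K) {s : ℝ} (hs : 0 ≤ s) (hs1 : s ≤ 1) :
    tZ t s K M 1 ≤ 3 * t := by
  have : Fact (1 < K) := ⟨by omega⟩
  have := tZ_step' ht ht1 hM hs hs1 (1 : ZMod K) one_ne_zero _ (tZ_le ht ht1 hM hs hs1 _) (tZ_le ht ht1 hM hs hs1 _)
  linarith

lemma tZ_decay (ht : 0 ≤ t) (ht1 : t ≤ 1/1000) (hM : 2 ≤ M) {s : ℝ} (hs : 0 ≤ s) (hs1 : s ≤ 1) (j : ℕ) (k : ZMod K)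
    (hk : j ≤ nd k) : tZ t s K M k ≤ 2 * (3 * t) ^ j := by
  induction j generalizing k with
  | zero => have := tZ_le (M := M) ht ht1 hM hs hs1 k; simp; linarith
  | succ j ih =>
    have h0 : k ≠ 0 := by rintro rfl; rw [nd_zero] at hk; omega
    have n1 : nd (1 : ZMod K) ≤ 1 := by simpa using nd_natCast (M := K) 1
    have h1 : nd k ≤ nd (k+1) + 1 := by
      have := nd_add (k+1) (-1); rw [nd_neg] at this; simp at this; omega
    have h2 : nd k ≤ nd (k-1) + 1 := by
      have := nd_add (k-1) (1);  simp at this; omega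
    have := tZ_step' ht ht1 hM hs hs1 k h0 _ (ih (k+1) oO) (ih (k-1) oO)
    have h3 : 0 ≤ (3*t)^j := by positivity
    rw [pow_succ]
    nlinarith [mul_nonneg ht h3]

lemma tg_lower (ht : 0 ≤ t) (ht1 : t ≤ 1/2) (hM : 2 ≤ M) (k : ℕ) (d : ZMod M) :
    t ^ (k + nd d) ≤ tg t K M k d := by
  have s1 : ∀ (k : ZMod K) (d : ZMod M), t * tg t K M k d ≤ tg t K M (k + 1) d := fun k d => by
    have h1 := cG_chain ht ht1 (torE K M) (0,0) (k,d) (k+1,d)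
    have h2 := cG_bond ht ht1 (torE K M) ((k,d),(k+1,d)) (by rw [mem_torE]; simp)
    unfold tg
    nlinarith [cG_nonneg ht ht1 (torE K M) (0,0) (k,d)]
  have s2 : ∀ (k : ZMod K) (d : ZMod M), t * tg t K M k d ≤ tg t K M k (d+1) := fun k d => by
    have h1 := cG_chain ht ht1 (torE K M) (0,0) (k,d) (k,d+1)
    have h2 := cG_bond ht ht1 (torE K M) ((k,d),(k,d+1)) (by rw [mem_torE]; simp)
    unfold tg
    nlinarith [cG_nonneg ht ht1 (torE K M) (0,0) (k,d)]
  have s3 : ∀ j : ℕ, t ^ j ≤ tg t K M 0 (j : ZMod M) := by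
    intro j
    induction j with
    | zero => have : tg t K M 0 0 = 1 := cG_self ht ht1 _ _
              simp [this]
    | succ j ih =>
      have := s2 0 j
      push_cast; rw [pow_succ]; nlinarith
  have s4 : t ^ nd d ≤ tg t K M 0 d := by
    have h := s3 (nd d)
    have hd : ((d.valMinAbs : ℤ) : ZMod M) = d := ZMod.coe_valMinAbs d
    rcases Int.natAbs_eq d.valMinAbs with h1 | h1
    · have : ((nd d : ℕ) : ZMod M) = d := by
        refine Eq.trans ?_ hd
        conv_rhs => rw [h1]
        rw [Int.cast_natCast]; rfl
      rwa [this] at h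
    · have : ((nd d : ℕ) : ZMod M) = -d := by
        refine Eq.trans ?_ (congrArg (fun x => -x) hd)
        conv_rhs => rw [h1]
        rw [Int.cast_neg, Int.cast_natCast, neg_neg]; rfl
      rwa [this, tg_neg2 t hM] at h
  induction k with
  | zero => simpa using s4
  | succ k ih =>
    have := s1 k d
    push_cast; rw [add_right_comm, pow_succ]; nlinarith

lemma tg_simon (ht : 0 < t) (ht1 : t ≤ 1/1000) (hM : 2 ≤ M) (h L : ℕ) (hK : K = 2 * h) (hh : 2 * (L + M + 1) ≤ h)
    (k l : ℕ) (hkl : k + l ≤ L) (d : ZMod M) :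
    tg t K M ((k + l : ℕ) : ZMod K) d ≤ (1 + t) * ∑ x, tg t K M k x * tg t K M l (d - x) := by
  have nn := tg_nonneg (K := K) (M := M) ht.le lL
  rcases Nat.eq_zero_or_pos k with rfl | hk
  · have h1 : tg t K M ((0 : ℕ) : ZMod K) 0 * tg t K M l (d - 0) ≤ ∑ x, tg t K M ((0:ℕ) : ZMod K) x * tg t K M l (d - x) :=
      single_le_sum (f := fun x => tg t K M ((0:ℕ) : ZMod K) x * tg t K M l (d - x)) (fun x _ => mul_nonneg (nn _ _) (nn _ _)) (mem_univ 0)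
    have : tg t K M ((0:ℕ) : ZMod K) 0 = 1 := by rw [Nat.cast_zero]; exact cG_self ht.le lL _ _
    rw [this] at h1
    simp only [sub_zero, one_mul, zero_add] at h1 ⊢
    nlinarith [nn l d]
  have vK : ∀ j : ℕ, j < K → ((j : ZMod K)).val = j := fun j hj => ZMod.val_cast_of_lt hj
  have hv1 : ∀ a : ZMod K, (a + 1).val = if a.val + 1 = K then 0 else a.val + 1 := by
    intro a
    have : Fact (1 < K) := ⟨by omega⟩
    have ha := ZMod.val_lt a
    rw [ZMod.val_add, ZMod.val_one]
    split_ifs with h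
    · rw [h, Nat.mod_self]
    · exact Nat.mod_eq_of_lt oO
  have S := simon ht.le lL (univ.filter (fun v : ZMod K × ZMod M => v.1 = k) ∪ univ.filter (fun v : ZMod K × ZMod M => v.1 = h))
    (univ.filter (fun v : ZMod K × ZMod M => v.1.val < k ∨ h < v.1.val)) (torE K M) (by
      rintro ⟨⟨a, b⟩, ⟨c, e⟩⟩ he
      rw [mem_torE] at he
      simp only [Prod.mk_add_mk, Prod.mk.injEq, add_zero] at he
      simp only [mem_union, mem_filter, mem_univ, true_and]
      rcases he with ⟨rfl, rfl⟩ | ⟨rfl, rfl⟩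
      · by_cases hk1 : a = k
        · simp [hk1]
        by_cases hk2 : a = h
        · simp [hk2]
        by_cases hk3 : a + 1 = k
        · simp [hk3]
        by_cases hk4 : a + 1 = h
        · simp [hk4]
        right; right
        have ha := ZMod.val_lt a
        have e1 : a.val ≠ k := fun h' => hk1 (by rw [← h', ZMod.natCast_zmod_val])
        have e2 : a.val ≠ h := fun h' => hk2 (by rw [← h', ZMod.natCast_zmod_val])
        have e3 : (a+1).val ≠ k := fun h' => hk3 (by rw [← h', ZMod.natCast_zmod_val])
        have e4 : (a+1).val ≠ h := fun h' => hk4 (by rw [← h', ZMod.natCast_zmod_val])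
        rw [hv1] at e3 e4 ⊢
        split_ifs at * with hif <;> omega
      · right; right; rfl)
    (0,0) (((k + l : ℕ) : ZMod K), d) (by simp; omega) (by simp only [mem_filter, mem_univ, true_and]; rw [vK _ oO]; omega)
  have hne : (k : ZMod K) ≠ h := fun h' => by
    have := congrArg ZMod.val h'
    rw [vK _ oO, vK _ oO] at this; omega
  rw [sum_union (by
    rw [disjoint_left]; intro v h1 h2
    simp only [mem_filter, mem_univ, true_and] at h1 h2
    exact hne (h1 ▸ h2))] at S
  have sumcol : ∀ (j : ZMod K) (F : ZMod K × ZMod M → ℝ), ∑ v ∈ univ.filter (fun v : ZMod K × ZMod M => v.1 = j), F v = ∑ x, F (j, x) := by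
    intro j F
    rw [sum_filter, Fintype.sum_prod_type, Finset.sum_comm]
    simp
  rw [sumcol, sumcol] at S
  have e1 : ∀ x, cG t (torE K M) ((k : ZMod K), x) (((k + l : ℕ) : ZMod K), d) = tg t K M l (d - x) := fun x => by
    rw [tg_eq t hM]; simp
  have far : ∑ x, cG t (torE K M) (0, 0) ((h : ZMod K), x) * cG t (torE K M) ((h : ZMod K), x) (((k + l : ℕ) : ZMod K), d) ≤ 2 * (3 * t) ^ h := by
    have hn : nd (h : ZMod K) = h := by
      unfold nd; rw [ZMod.valMinAbs_natCast_of_le_half oO]; simp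
    refine le_trans ?_ (tZ_decay (M := M) ht.le ht1 hM (s := 0) le_rfl zero_le_one h (h : ZMod K) hn.ge)
    unfold tZ
    refine sum_le_sum fun x _ => ?_
    simp only [ch, zero_mul, cosh_zero, one_mul]
    exact mul_le_of_le_one_right (nn _ _) (cG_le_one ht.le lL _ _ _)
  have low : t ^ (L + M) ≤ ∑ x, tg t K M k x * tg t K M l (d - x) := by
    refine le_trans ?_ (single_le_sum (f := fun x => tg t K M k x * tg t K M l (d - x)) (fun x _ => mul_nonneg (nn _ _) (nn _ _)) (mem_univ 0))
    have a1 := tg_lower (K := K) ht.le lL hM k (0 : ZMod M)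
    have a2 := tg_lower (K := K) ht.le lL hM l d
    rw [nd_zero, add_zero] at a1
    have hnd : nd d ≤ M := (ZMod.natAbs_valMinAbs_le d).trans oO
    simp only [sub_zero]
    calc t ^ (L + M) ≤ t ^ (k + (l + nd d)) := pow_le_pow_of_le_one ht.le lL oO
      _ = t ^ k * t ^ (l + nd d) := pow_add _ _ _
      _ ≤ _ := mul_le_mul a1 a2 pP (nn _ _)
  have small : 2 * (3 * t) ^ h ≤ t * t ^ (L + M) := by
    calc 2 * (3 * t) ^ h ≤ 2 * (3 * t) ^ (2 * (L + M + 1)) :=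
          mll (pow_le_pow_of_le_one pP lL hh) nN
      _ = 2 * ((3 * t) ^ 2) ^ (L + M + 1) := by rw [pow_mul]
      _ ≤ 2 * (t / 2) ^ (L + M + 1) := by gcongr; nlinarith
      _ = 2 * (1/2) ^ (L + M + 1) * t ^ (L + M + 1) := by rw [div_eq_mul_one_div, mul_pow]; ring
      _ ≤ 1 * t ^ (L + M + 1) := by
          refine mlr ?_ pP
          rw [pow_succ]
          have : (1/2:ℝ) ^ (L+M) ≤ 1 := pow_le_one₀ nN nN
          linarith
      _ = t * t ^ (L + M) := by rw [pow_succ]; ring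
  simp only [e1] at S
  have hS : ∑ x, cG t (torE K M) (0, 0) ((k : ZMod K), x) * tg t K M l (d - x) = ∑ x, tg t K M k x * tg t K M l (d - x) := rfl
  rw [hS] at S
  have : tg t K M ((k + l : ℕ) : ZMod K) d = cG t (torE K M) (0,0) (((k + l : ℕ) : ZMod K), d) := rfl
  rw [this]
  nlinarith
end torus2

lemma rp_abs {U C L : Type*} [Fintype U] [DecidableEq U] [Fintype C] [Fintype L] (e : C ⊕ (L ⊕ L) ≃ U) (θ : U → U)
    (h0 : ∀ c, θ (e (.inl c)) = e (.inl c)) (h1 : ∀ x, θ (e (.inr (.inl x))) = e (.inr (.inr x)))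
    (Φ B : Fn U)
    (hΦ : ∀ σ σ', (∀ c, σ (e (.inl c)) = σ' (e (.inl c))) → (∀ x, σ (e (.inr (.inl x))) = σ' (e (.inr (.inl x)))) → Φ σ = Φ σ')
    (hB : ∀ σ, 0 ≤ B σ) (hB' : ∀ σ σ', (∀ c, σ (e (.inl c)) = σ' (e (.inl c))) → B σ = B σ') :
    0 ≤ ∑ σ, B σ * (Φ σ * Φ (σ ∘ θ)) := by
  set m : (C → Bool) → (L → Bool) → (L → Bool) → (U → Bool) := fun c x y u => Sum.elim c (Sum.elim x y) (e.symm u) with hm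
  set x0 : L → Bool := fun _ => false
  have hs : ∀ F : (U → Bool) → ℝ, ∑ σ, F σ = ∑ c, ∑ x, ∑ y, F (m c x y) := by
    intro F
    rw [← Equiv.sum_comp (e.arrowCongr (Equiv.refl Bool)), ← Equiv.sum_comp (Equiv.sumArrowEquivProdArrow C (L ⊕ L) Bool).symm, Fintype.sum_prod_type]
    refine sum_congr rfl fun c _ => ?_
    rw [← Equiv.sum_comp (Equiv.sumArrowEquivProdArrow L L Bool).symm, Fintype.sum_prod_type]
    rfl
  rw [hs]
  refine sum_nonneg fun c _ => ?_
  have : ∑ x, ∑ y, B (m c x y) * (Φ (m c x y) * Φ (m c x y ∘ θ)) = B (m c x0 x0) * (∑ x, Φ (m c x x0)) ^ 2 := by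
    rw [sq, sum_mul_sum, mul_sum]
    refine sum_congr rfl fun x _ => ?_
    rw [mul_sum]
    refine sum_congr rfl fun y _ => ?_
    rw [hB' (m c x y) (m c x0 x0) (by simp [hm]), hΦ (m c x y) (m c x x0) (by simp [hm]) (by simp [hm]),
      hΦ (m c x y ∘ θ) (m c y x0) (by simp [hm, h0]) (by simp [hm, h1])]
  rw [this]
  exact mul_nonneg (hB _) (sq_nonneg _)

section rp
variable {K M : ℕ} [NeZero K] [NeZero M] {t : ℝ}

lemma val_neg' (h : ℕ) (hK : K = 2 * h) (hh : 2 ≤ h) (a : ZMod K) : (-a).val = if a.val = 0 then 0 else K - a.val := by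
  rw [ZMod.neg_val]
  simp [ZMod.val_eq_zero]

lemma val_neg_sub_one (h : ℕ) (hK : K = 2 * h) (hh : 2 ≤ h) (a : ZMod K) : (-a - 1).val = K - 1 - a.val := by
  have ha := ZMod.val_lt a
  have h1 : ((K - 1 - a.val : ℕ) : ZMod K) = -a - 1 := by
    have : (((K - 1 - a.val) + (a.val + 1) : ℕ) : ZMod K) = 0 := by
      rw [show (K - 1 - a.val) + (a.val + 1) = K by omega]; simp
    push_cast at this
    rw [ZMod.natCast_zmod_val] at this
    linear_combination this
  rw [← h1, ZMod.val_cast_of_lt oO]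

lemma val_add_one' (hK : 2 ≤ K) (a : ZMod K) : (a + 1).val = if a.val + 1 = K then 0 else a.val + 1 := by
  have : Fact (1 < K) := ⟨by omega⟩
  have ha := ZMod.val_lt a
  rw [ZMod.val_add, ZMod.val_one]
  split_ifs with h
  · rw [h, Nat.mod_self]
  · exact Nat.mod_eq_of_lt oO

def thF (v : ZMod K × ZMod M) : ZMod K × ZMod M := (-v.1, v.2)

lemma rp_tor (ht : 0 ≤ t) (ht1 : t ≤ 1/2) (hM : 2 ≤ M) (h : ℕ) (hK : K = 2 * h) (hh : 2 ≤ h)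
    (f : (ZMod K × ZMod M → Bool) → ℝ) (hf : ∀ σ σ' : ZMod K × ZMod M → Bool, (∀ v, v.1.val ≤ h → σ v = σ' v) → f σ = f σ') :
    0 ≤ bS t (torE K M) (fun σ => f σ * f (σ ∘ thF)) := by
  set H : (ZMod K × ZMod M → Bool) → ZMod K × ZMod M → ℝ := fun σ v => 1 + t * (spinVal (σ v) * spinVal (σ (v + (1, 0)))) with hH
  set Vt : (ZMod K × ZMod M → Bool) → ZMod K × ZMod M → ℝ := fun σ v => 1 + t * (spinVal (σ v) * spinVal (σ (v + (0, 1)))) with hVt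
  set A : (ZMod K × ZMod M → Bool) → ℝ := fun σ => (∏ v, if v.1.val < h then H σ v else 1) *
    (∏ v, if 0 < v.1.val ∧ v.1.val < h then Vt σ v else 1) with hA
  set B : (ZMod K × ZMod M → Bool) → ℝ := fun σ => (∏ v, if v.1.val = 0 ∨ v.1.val = h then Vt σ v else 1) with hB
  have A2 : ∀ σ, A (σ ∘ thF) = (∏ v, if v.1.val < h then 1 else H σ v) * (∏ v, if h < v.1.val then Vt σ v else 1) := by
    intro σ
    simp only [hA]
    congr 1
    · rw [← Equiv.prod_comp (((Equiv.neg (ZMod K)).prodCongr (Equiv.refl (ZMod M))).trans (Equiv.addRight (-1, 0)))]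
      refine Finset.prod_congr rfl fun v _ => ?_
      obtain ⟨x, y⟩ := v
      simp only [Equiv.prodCongr_apply, Prod.map, Equiv.neg_apply, Equiv.refl_apply, Prod.mk_add_mk, Equiv.trans_apply, Equiv.coe_addRight, add_zero, hH, Function.comp, thF]
      rw [← sub_eq_add_neg, val_neg_sub_one h hK hh]
      have hx := ZMod.val_lt x
      by_cases hc : x.val < h
      · rw [if_neg oO, if_pos hc]
      · rw [if_pos oO, if_neg hc]
        ring_nf
    · rw [← Equiv.prod_comp ((Equiv.neg (ZMod K)).prodCongr (Equiv.refl (ZMod M)))]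
      refine Finset.prod_congr rfl fun v _ => ?_
      obtain ⟨x, y⟩ := v
      simp only [Equiv.prodCongr_apply, Prod.map, Equiv.neg_apply, Equiv.refl_apply, Prod.mk_add_mk, hVt, Function.comp, thF, add_zero, neg_neg]
      have hx := ZMod.val_lt x
      refine if_congr ?_ rfl rfl
      rw [val_neg' h hK hh]
      split_ifs <;> omega
  have hW : ∀ σ, bw t (torE K M) σ = B σ * (A σ * A (σ ∘ thF)) := by
    intro σ
    rw [bw_tor t hM, A2]
    have e1 : (∏ v, H σ v) = (∏ v, if v.1.val < h then H σ v else 1) * (∏ v, if v.1.val < h then 1 else H σ v) := by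
      rw [← prod_mul_distrib]
      refine prod_congr rfl fun v _ => ?_
      split_ifs <;> simp
    have e2 : (∏ v, Vt σ v) = (∏ v, if v.1.val = 0 ∨ v.1.val = h then Vt σ v else 1) *
       (∏ v, if 0 < v.1.val ∧ v.1.val < h then Vt σ v else 1) * (∏ v, if h < v.1.val then Vt σ v else 1) := by
      rw [← prod_mul_distrib, ← prod_mul_distrib]
      refine prod_congr rfl fun v _ => ?_
      split_ifs <;> first | omega | simp
    simp only [hH, hVt] at e1 e2
    rw [e1, e2]
    simp only [hA, hB]
    ring
  have hle : ∀ a b : Bool, 0 ≤ 1 + t * (spinVal a * spinVal b) := by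
    intro a b; cases a <;> cases b <;> simp [spinVal] <;> linarith
  set e0 : {v : ZMod K × ZMod M // v.1.val = 0 ∨ v.1.val = h} ⊕ ({v : ZMod K × ZMod M // 0 < v.1.val ∧ v.1.val < h} ⊕ {v : ZMod K × ZMod M // 0 < v.1.val ∧ v.1.val < h}) → ZMod K × ZMod M :=
    Sum.elim (fun c => c.1) (Sum.elim (fun x => x.1) (fun x => thF x.1)) with he0
  have thth : ∀ v : ZMod K × ZMod M, thF (thF v) = v := fun v => by simp [thF]
  have thv : ∀ v : ZMod K × ZMod M, (thF v).1.val = if v.1.val = 0 then 0 else K - v.1.val := fun v => val_neg' h hK hh v.1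
  have lt : ∀ v : ZMod K × ZMod M, v.1.val < K := fun v => ZMod.val_lt v.1
  have bij : Function.Bijective e0 := by
    constructor
    · rintro (⟨c, hc⟩ | ⟨c, hc⟩ | ⟨c, hc⟩) (⟨d, hd⟩ | ⟨d, hd⟩ | ⟨d, hd⟩) hcd <;> simp only [he0, Sum.elim_inl, Sum.elim_inr] at hcd
      · subst hcd; rfl
      · subst hcd; omega
      · subst hcd; rw [thv] at hc; split_ifs at hc <;> omega
      · subst hcd; omega
      · subst hcd; rfl
      · subst hcd; rw [thv] at hc; split_ifs at hc <;> omega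
      · subst hcd; rw [thv] at hd; split_ifs at hd <;> omega
      · subst hcd; rw [thv] at hd; split_ifs at hd <;> omega
      · have := congrArg thF hcd
        rw [thth, thth] at this
        subst this; rfl
    · intro v
      by_cases h1 : v.1.val = 0 ∨ v.1.val = h
      · exact ⟨.inl ⟨v, h1⟩, rfl⟩
      by_cases h2 : 0 < v.1.val ∧ v.1.val < h
      · exact ⟨.inr (.inl ⟨v, h2⟩), rfl⟩
      · refine ⟨.inr (.inr ⟨thF v, ?_⟩), thth v⟩
        rw [thv]; have := lt v
        split_ifs <;> omega
  have key := rp_abs (Equiv.ofBijective e0 bij) thF (by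
      rintro ⟨⟨x, y⟩, hc⟩
      simp only [Equiv.ofBijective_apply, he0, Sum.elim_inl, thF, Prod.mk.injEq, and_true]
      apply ZMod.val_injective K
      rw [val_neg' h hK hh]
      simp only at hc
      split_ifs <;> omega) (fun x => rfl) (fun σ => A σ * f σ) B (by
      intro σ σ' h1 h2
      have h3 : ∀ v : ZMod K × ZMod M, v.1.val ≤ h → σ v = σ' v := by
        intro v hv
        by_cases hc : v.1.val = 0 ∨ v.1.val = h
        · exact h1 ⟨v, hc⟩
        · exact h2 ⟨v, by omega⟩
      simp only [hf σ σ' h3, hA]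
      congr 2
      · refine prod_congr rfl fun v _ => ?_
        by_cases hv : v.1.val < h
        · rw [if_pos hv, if_pos hv]
          simp only [hH]
          rw [h3 v hv.le, h3 (v + (1,0))]
          show (v.1 + 1).val ≤ h
          rw [val_add_one' oO]
          split_ifs <;> omega
        · rw [if_neg hv, if_neg hv]
      · refine prod_congr rfl fun v _ => ?_
        by_cases hv : 0 < v.1.val ∧ v.1.val < h
        · rw [if_pos hv, if_pos hv]
          simp only [hVt]
          rw [h3 v hv.2.le, h3 (v + (0,1))]
          show (v.1 + 0).val ≤ h
          rw [add_zero]; omega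
        · rw [if_neg hv, if_neg hv]) (by
      intro σ
      refine prod_nonneg fun v _ => ?_
      split_ifs
      · exact hle _ _
      · norm_num) (by
      intro σ σ' h1
      have h3 : ∀ v : ZMod K × ZMod M, v.1.val = 0 ∨ v.1.val = h → σ v = σ' v := fun v hv => h1 ⟨v, hv⟩
      refine prod_congr rfl fun v _ => ?_
      by_cases hv : v.1.val = 0 ∨ v.1.val = h
      · rw [if_pos hv, if_pos hv]
        simp only [hVt]
        rw [h3 v hv, h3 (v + (0,1))]
        show (v.1 + 0).val = 0 ∨ (v.1 + 0).val = h
        rwa [add_zero]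
      · rw [if_neg hv, if_neg hv])
  refine key.trans_eq ?_
  unfold bS
  refine sum_congr rfl fun σ _ => ?_
  rw [hW]; ring

lemma rp_form (ht : 0 ≤ t) (ht1 : t ≤ 1/2) (hM : 2 ≤ M) (h : ℕ) (hK : K = 2 * h) (hh : 2 ≤ h) (k : ℕ) (hk : k ≤ h)
    (a b : ZMod M → ℝ) :
    0 ≤ ∑ y, ∑ y', b y * b y' * tg t K M 0 (y' - y) + 2 * (∑ y, ∑ x, b y * a x * tg t K M k (x - y)) +
      ∑ x, ∑ x', a x * a x' * tg t K M ((2 * k : ℕ)) (x' - x) := by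
  have R := rp_tor ht ht1 hM h hK hh
    (fun σ => ∑ y, b y * spinVal (σ (0, y)) + ∑ x, a x * spinVal (σ (k, x))) (by
      intro σ σ' hσ
      have h1 : ∀ y, σ (0, y) = σ' (0, y) := fun y => hσ _ (by simp)
      have h2 : ∀ y, σ (k, y) = σ' (k, y) := fun y => hσ _ (by rw [ZMod.val_cast_of_lt oO]; exact hk)
      simp only [h1, h2])
  have p0 : 0 < bS t (torE K M) (fun _ => 1) := bS_one_pos ht ht1 _
  have L : ∀ (c d : ZMod M → ℝ) (p q : ZMod M → ZMod K × ZMod M),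
      bS t (torE K M) (fun σ => (∑ y, c y * spinVal (σ (p y))) * (∑ x, d x * spinVal (σ (q x)))) =
      bS t (torE K M) (fun _ => 1) * ∑ y, ∑ x, c y * d x * cG t (torE K M) (p y) (q x) := by
    intro c d p q
    have : ∀ y x, bS t (torE K M) (fun _ => 1) * (c y * d x * cG t (torE K M) (p y) (q x)) =
      c y * d x * bS t (torE K M) (fun σ => spinVal (σ (p y)) * spinVal (σ (q x))) := by
      intro y x; unfold cG; field_simp
    simp only [mul_sum, this]
    simp only [← mul_sum]
    unfold bS
    simp only [sum_mul_sum]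
    simp only [mul_sum]
    rw [sum_comm]
    refine sum_congr rfl fun y _ => ?_
    rw [sum_comm]
    refine sum_congr rfl fun y _ => sum_congr rfl fun y _ => ?_
    ring
  have e : ∀ σ : ZMod K × ZMod M → Bool, (∑ y, b y * spinVal (σ (0, y)) + ∑ x, a x * spinVal (σ (k, x))) *
     (∑ y, b y * spinVal ((σ ∘ thF) (0, y)) + ∑ x, a x * spinVal ((σ ∘ thF) (k, x))) =
     (∑ y, b y * spinVal (σ (0, y))) * (∑ y, b y * spinVal (σ (0, y))) +
     (∑ y, b y * spinVal (σ (0, y))) * (∑ x, a x * spinVal (σ (-k, x))) +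
     ((∑ y, b y * spinVal (σ (0, y))) * (∑ x, a x * spinVal (σ (k, x))) +
     (∑ x, a x * spinVal (σ (-k, x))) * (∑ x, a x * spinVal (σ (k, x)))) := by
    intro σ
    simp only [Function.comp, thF, neg_zero]
    ring
  simp only [e] at R
  rw [bS_add, bS_add, bS_add, L, L, L, L, ← mul_add, ← mul_add, ← mul_add] at R
  have R' := nonneg_of_mul_nonneg_right R p0
  refine R'.trans_eq ?_
  simp only [tg_eq t hM]
  have z : ∀ d, tg t K M (-(k : ZMod K)) d = tg t K M k d := fun d => by rw [tg_neg1 t hM]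
  have z2 : ((k : ZMod K) - -(k : ZMod K)) = ((2 * k : ℕ) : ZMod K) := by push_cast; ring
  simp only [sub_zero, z2]
  simp only [z]
  ring

end rp

section conv
variable {M : ℕ} [NeZero M]

def gZ (s : ℝ) (f : ZMod M → ℝ) : ℝ := ∑ d, ch s d * f d

lemma gZ_zero (f : ZMod M → ℝ) : gZ 0 f = ∑ d, f d := by simp [gZ, ch]

lemma cosh_abs_le {x y : ℝ} (h : |x| ≤ |y|) : cosh x ≤ cosh y := cosh_le_cosh.mpr h

lemma ch_conv (s : ℝ) (x y : ZMod M) : ch s (x + y) + ch s (x - y) ≤ 2 * (ch s x * ch s y) := by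
  have h1 : ∀ x y : ZMod M, ch s (x + y) ≤ cosh (s * x.valMinAbs + s * y.valMinAbs) := by
    intro x y
    unfold ch
    apply cosh_abs_le
    rw [← mul_add, abs_mul, abs_mul]
    refine mll ?_ (abs_nonneg s)
    have := ZMod.natAbs_valMinAbs_add_le x y
    rw [Nat.abs_cast]
    have h2 : |((x.valMinAbs : ℝ) + y.valMinAbs)| = (((x.valMinAbs + y.valMinAbs).natAbs : ℕ) : ℝ) := by
      rw [Nat.cast_natAbs]; push_cast; rfl
    rw [h2]
    exact_mod_cast this
  have h0 : ∀ x : ZMod M, ch s x = cosh (s * x.valMinAbs) := by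
    intro x
    unfold ch nd
    rw [← cosh_abs, ← cosh_abs (s * x.valMinAbs), abs_mul, abs_mul, Nat.abs_cast, Nat.cast_natAbs]
    push_cast; rfl
  have h3 : ∀ x y : ZMod M, ch s (x - y) ≤ cosh (s * x.valMinAbs - s * y.valMinAbs) := by
    intro x y
    unfold ch
    apply cosh_abs_le
    rw [← mul_sub, abs_mul, abs_mul]
    refine mll ?_ (abs_nonneg s)
    rw [Nat.abs_cast]
    have h2 : |((x.valMinAbs : ℝ) - y.valMinAbs)| = (((x.valMinAbs - y.valMinAbs).natAbs : ℕ) : ℝ) := by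
      rw [Nat.cast_natAbs]; push_cast; rfl
    rw [h2]
    have : nd (x - y) ≤ (x.valMinAbs - y.valMinAbs).natAbs := by
      unfold nd
      have e : x - y = ((x.valMinAbs - y.valMinAbs : ℤ) : ZMod M) := by
        simp
      exact ZMod.natAbs_min_of_le_div_two M _ _ (by rw [ZMod.coe_valMinAbs, e]) (ZMod.natAbs_valMinAbs_le _)
    exact_mod_cast this
  have := h1 x y
  have := h3 x y
  rw [h0 x, h0 y]
  have := cosh_add (s * x.valMinAbs) (s * y.valMinAbs)
  have := cosh_sub (s * x.valMinAbs) (s * y.valMinAbs)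
  linarith

def cv (f g : ZMod M → ℝ) (d : ZMod M) : ℝ := ∑ x, f x * g (d - x)

lemma sum_cv (c f g : ZMod M → ℝ) : ∑ d, c d * cv f g d = ∑ x, ∑ y, c (x + y) * (f x * g y) := by
  unfold cv
  simp only [mul_sum]
  rw [sum_comm]
  refine sum_congr rfl fun x _ => ?_
  rw [← Equiv.sum_comp (Equiv.addLeft x)]
  simp

lemma gZ_cv_le (s : ℝ) (f g : ZMod M → ℝ) (hf : ∀ d, 0 ≤ f d) (hg : ∀ d, 0 ≤ g d) (he : ∀ d, g (-d) = g d) :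
    gZ s (cv f g) ≤ gZ s f * gZ s g := by
  unfold gZ
  rw [sum_cv (ch s) f g]
  have e1 : ∑ x, ∑ y, ch s (x + y) * (f x * g y) = ∑ x, ∑ y, ch s (x - y) * (f x * g y) := by
    refine sum_congr rfl fun x _ => ?_
    rw [← Equiv.sum_comp (Equiv.neg (ZMod M))]
    simp [he, sub_eq_add_neg]
  have e2 : ∑ x, ∑ y, ch s (x + y) * (f x * g y) + ∑ x, ∑ y, ch s (x - y) * (f x * g y) ≤ 2 * ((∑ d, ch s d * f d) * (∑ d, ch s d * g d)) := by
    rw [sum_mul_sum, ← sum_add_distrib, mul_sum]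
    refine sum_le_sum fun x _ => ?_
    rw [← sum_add_distrib, mul_sum]
    refine sum_le_sum fun y _ => ?_
    have := mlr (ch_conv s x y) (mul_nonneg (hf x) (hg y))
    linarith
  linarith

lemma gZ0_cv (f g : ZMod M → ℝ) : gZ 0 (cv f g) = gZ 0 f * gZ 0 g := by
  have := sum_cv (fun _ => 1) f g
  simp only [one_mul] at this
  rw [gZ_zero, gZ_zero, gZ_zero, this, sum_mul_sum]

lemma cosh_scale {s : ℝ} (hs : 0 ≤ s) (hs1 : s ≤ 1) (x : ℝ) : cosh (s * x) - 1 ≤ s ^ 2 * (cosh x - 1) := by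
  have h1 := hasSum_cosh (s * x)
  have h2 := ((hasSum_cosh x).mul_left (s ^ 2)).add (hasSum_ite_eq (0 : ℕ) (1 - s ^ 2))
  have := hasSum_le (fun n => ?_) h1 h2
  · linarith
  · rcases Nat.eq_zero_or_pos n with rfl | hn
    · simp
    · rw [if_neg oO, add_zero, mul_pow, mul_div_assoc]
      refine mlr (pow_le_pow_of_le_one hs hs1 oO) ?_
      rw [pow_mul]; positivity

structure GP (t : ℝ) (I : ℕ) (g : ℕ → ZMod M → ℝ) : Prop where
  t0 : 0 < t
  t1 : t ≤ 1/1000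
  nn : ∀ k d, 0 ≤ g k d
  even : ∀ k d, g k (-d) = g k d
  sim : ∀ k l, k + l ≤ 2 ^ I → ∀ d, g (k + l) d ≤ (1 + t) * cv (g k) (g l) d
  rp1 : ∀ k, 2 * k ≤ 2 ^ I → (gZ 0 (g k)) ^ 2 ≤ 101/100 * gZ 0 (g (2 * k))
  rp2 : ∀ k, 2 * k ≤ 2 ^ I → (gZ 0 (g k)) ^ 2 ≤ 101/100 * M * g (2 * k) 0
  zle : ∀ s, 0 ≤ s → s ≤ 1 → ∀ k, gZ s (g k) ≤ 101/100
  z1 : gZ 1 (g 1) ≤ 3 * t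
  tz : t ≤ gZ 0 (g 1)
  zdec : gZ 0 (g (2 ^ I)) ≤ 2 * (3 * t) ^ (2 ^ I)

variable {t : ℝ} {I : ℕ} {g : ℕ → ZMod M → ℝ}

lemma GP.gnn (G : GP t I g) (s : ℝ) (k : ℕ) : 0 ≤ gZ s (g k) := sum_nonneg fun d _ => mul_nonneg (ch_nonneg _ _) (G.nn _ _)

lemma GP.sub (G : GP t I g) (s : ℝ) (k l : ℕ) (h : k + l ≤ 2 ^ I) : gZ s (g (k + l)) ≤ (1 + t) * (gZ s (g k) * gZ s (g l)) := by
  have h1 : gZ s (g (k + l)) ≤ (1 + t) * gZ s (cv (g k) (g l)) := by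
    unfold gZ
    rw [mul_sum]
    refine sum_le_sum fun d _ => ?_
    have := mll (G.sim k l h d) (ch_nonneg s d)
    linarith
  exact h1.trans (mll (gZ_cv_le s _ _ (G.nn k) (G.nn l) (G.even l)) (by linarith [G.t0]))

lemma GP.defect (G : GP t I g) (s : ℝ) (k l : ℕ) (h : k + l ≤ 2 ^ I) : gZ s (g (k + l)) - gZ 0 (g (k + l)) ≤
    (1 + t) * (gZ s (g k) * gZ s (g l) - gZ 0 (g k) * gZ 0 (g l)) := by
  have h1 : gZ s (g (k + l)) - gZ 0 (g (k+l)) ≤ (1 + t) * (gZ s (cv (g k) (g l)) - gZ 0 (cv (g k) (g l))) := by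
    rw [gZ_zero, gZ_zero]
    unfold gZ
    rw [← sum_sub_distrib, ← sum_sub_distrib, mul_sum]
    refine sum_le_sum fun d _ => ?_
    have := mll (G.sim k l h d) (sub_nonneg.2 (ch_one_le s d))
    linarith
  rw [gZ0_cv] at h1
  refine h1.trans (mll ?_ (by linarith [G.t0]))
  have := gZ_cv_le s _ _ (G.nn k) (G.nn l) (G.even l)
  linarith

lemma GP.psi (G : GP t I g) (i0 : ℕ) (h0 : i0 ≤ I) (s : ℝ) (hs : s = 1/10 * (2/3) ^ i0) (i : ℕ) (hi : i ≤ i0) :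
    gZ s (g (2 ^ i)) - gZ 0 (g (2 ^ i)) ≤ 3 * s ^ 2 * (9/4) ^ i * gZ 0 (g (2 ^ i)) := by
  have hs0 : 0 ≤ s := by rw [hs]; positivity
  have hs1 : s ≤ 1 := by
    rw [hs]; have : (2/3:ℝ) ^ i0 ≤ 1 := pow_le_one₀ nN nN
    linarith
  have ht := G.t0
  have ht1 := G.t1
  induction i with
  | zero =>
    have : gZ s (g (2 ^ 0)) - gZ 0 (g (2 ^ 0)) ≤ s ^ 2 * gZ 1 (g 1) := by
      rw [gZ_zero]
      unfold gZ
      rw [← sum_sub_distrib, mul_sum, pow_zero]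
      refine sum_le_sum fun d _ => ?_
      have h1 := cosh_scale hs0 hs1 (nd d)
      have h2 : ch s d - 1 ≤ s ^ 2 * ch 1 d := by
        unfold ch; rw [one_mul]; nlinarith [sq_nonneg s]
      have := mlr h2 (G.nn 1 d)
      linarith
    refine this.trans ?_
    have h3 := mll G.z1 (sq_nonneg s)
    have h4 := mll G.tz (sq_nonneg s)
    simp only [pow_zero]
    linarith
  | succ i ih =>
    have ih := ih oO
    have hb : 3 * s ^ 2 * (9/4) ^ i ≤ 1/10 := by
      rw [hs, mul_pow, ← pow_mul, mul_comm i0 2, pow_mul]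
      have h1 : (9/4 : ℝ) ^ i ≤ (9/4) ^ i0 := pow_le_pow_right₀ nN oO
      have h2 : ((2/3 : ℝ)^2) ^ i0 * (9/4) ^ i0 = 1 := by rw [← mul_pow]; norm_num
      have h3 : 0 ≤ ((2/3 : ℝ)^2) ^ i0 := by positivity
      nlinarith
    set ψ := 3 * s ^ 2 * (9/4) ^ i with hψ
    have ψ0 : 0 ≤ ψ := by positivity
    have hpow : (2:ℕ) ^ (i + 1) ≤ 2 ^ I := Nat.pow_le_pow_right nN oO
    have e : (2:ℕ) ^ (i+1) = 2 ^ i + 2 ^ i := by ring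
    have d := G.defect s (2 ^ i) (2 ^ i) oO
    have r := G.rp1 (2 ^ i) oO
    rw [← e] at d
    rw [← pow_succ'] at r
    have n0 := G.gnn 0 (2 ^ i)
    have n1 := G.gnn 0 (2 ^ (i+1))
    have ns := G.gnn s (2 ^ i)
    set Z := gZ 0 (g (2 ^ i))
    set Zh := gZ s (g (2 ^ i))
    set Z2 := gZ 0 (g (2 ^ (i+1)))
    have q1 : Zh * Zh - Z * Z ≤ ψ * (2 + ψ) * Z ^ 2 := by
      have : Zh ≤ (1 + ψ) * Z := by linarith
      nlinarith [mul_self_le_mul_self ns this]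
    have q2 : ψ * (2 + ψ) * Z ^ 2 ≤ ψ * (21/10) * (101/100 * Z2) := by
      refine mul_le_mul ?_ r (sq_nonneg _) pP
      exact mll lL ψ0
    have q3 : 3 * s ^ 2 * (9/4) ^ (i+1) * Z2 = 9/4 * (ψ * Z2) := by rw [pow_succ, hψ]; ring
    rw [q3]
    have q4 : 0 ≤ ψ * Z2 := by positivity
    nlinarith

lemma GP.zh (G : GP t I g) (i0 : ℕ) (h0 : i0 ≤ I) (s : ℝ) (hs : s = 1/10 * (2/3) ^ i0) (i : ℕ) (hi : i ≤ i0) :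
    gZ s (g (2 ^ i)) ≤ 11/10 * gZ 0 (g (2 ^ i)) := by
  have h1 := G.psi i0 h0 s hs i hi
  have hb : 3 * s ^ 2 * (9/4) ^ i ≤ 1/10 := by
    rw [hs, mul_pow, ← pow_mul, mul_comm i0 2, pow_mul]
    have h1 : (9/4 : ℝ) ^ i ≤ (9/4) ^ i0 := pow_le_pow_right₀ nN oO
    have h2 : ((2/3 : ℝ)^2) ^ i0 * (9/4) ^ i0 = 1 := by rw [← mul_pow]; norm_num
    have h3 : 0 ≤ ((2/3 : ℝ)^2) ^ i0 := by positivity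
    nlinarith
  have := mlr hb (G.gnn 0 (2 ^ i))
  linarith

lemma GP.pos (G : GP t I g) (i : ℕ) (hi : i ≤ I) : 0 < gZ 0 (g (2 ^ i)) := by
  induction i with
  | zero => exact lt_of_lt_of_le G.t0 (by simpa using G.tz)
  | succ i ih =>
    have ih := ih oO
    have hpow : (2:ℕ) ^ (i + 1) ≤ 2 ^ I := Nat.pow_le_pow_right nN oO
    have := G.rp1 (2 ^ i) (by rw [← pow_succ']; exact hpow)
    rw [← pow_succ'] at this
    nlinarith [pow_pos ih 2]

theorem GP.bounds (G : GP t I g) : ∃ ρ : ℝ, 0 < ρ ∧ ρ ≤ 1/10 ∧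
    (∀ i0 ≤ I, ∀ k ≤ 2 ^ I, ∀ d, g k d ≤ exp (-(1/10 * (2/3) ^ i0 * nd d)) * 2 ^ (i0 + 2 + k / 2 ^ i0) * ρ ^ k) ∧
    (∀ k, 2 * k ≤ 2 ^ I → ρ ^ (2 * k) ≤ 2 * M * 4 ^ (I + 3) * g (2 * k) 0) := by
  have ht := G.t0
  have ht1 := G.t1
  have hZ := G.pos I le_rfl
  have p2 : (2:ℕ) ^ I ≠ 0 := by positivity
  obtain ⟨ρ, hρ0, hρ⟩ : ∃ ρ : ℝ, 0 < ρ ∧ ρ ^ (2 ^ I) = gZ 0 (g (2 ^ I)) :=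
    ⟨gZ 0 (g (2 ^ I)) ^ (((2 ^ I : ℕ) : ℝ)⁻¹), rpow_pos_of_pos hZ _, rpow_inv_natCast_pow hZ.le p2⟩
  have hρ1 : ρ ≤ 1/10 := by
    refine le_trans ?_ (show 6 * t ≤ 1/10 by linarith)
    refine le_of_pow_le_pow_left₀ p2 pP ?_
    rw [hρ]
    refine G.zdec.trans ?_
    rw [show 6 * t = 2 * (3 * t) by ring, mul_pow 2]
    refine mlr ?_ pP
    have : (2:ℝ) ^ 1 ≤ 2 ^ (2 ^ I) := pow_le_pow_right₀ nN (Nat.one_le_two_pow)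
    simpa using this
  have up2 : ∀ j ≤ I, gZ 0 (g (2 ^ (I - j))) ≤ 101/100 * ρ ^ (2 ^ (I - j)) := by
    intro j
    induction j with
    | zero => intro _; rw [Nat.sub_zero, hρ]; linarith
    | succ j ih =>
      intro hj
      have ih := ih oO
      obtain ⟨i, hi⟩ : ∃ i, I - j = i + 1 := ⟨I - j - 1, by omega⟩
      have hi' : I - (j + 1) = i := by omega
      rw [hi] at ih; rw [hi']
      have hpow : (2:ℕ) ^ (i + 1) ≤ 2 ^ I := Nat.pow_le_pow_right nN oO
      have := G.rp1 (2 ^ i) (by rw [← pow_succ']; exact hpow)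
      rw [← pow_succ'] at this
      refine le_of_pow_le_pow_left₀ two_ne_zero pP ?_
      rw [mul_pow, ← pow_mul, ← pow_succ]
      linarith
  have up2' : ∀ i ≤ I, gZ 0 (g (2 ^ i)) ≤ 101/100 * ρ ^ (2 ^ i) := by
    intro i hi
    have := up2 (I - i) oO
    rwa [Nat.sub_sub_self hi] at this
  have zhat : ∀ i0 ≤ I, ∀ k ≤ 2 ^ I, gZ (1/10 * (2/3) ^ i0) (g k) ≤ 2 ^ (i0 + 1 + k / 2 ^ i0) * ρ ^ k := by
    intro i0 hi0
    set s : ℝ := 1/10 * (2/3) ^ i0 with hs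
    have hs0 : 0 ≤ s := by positivity
    have hs1 : s ≤ 1 := by
      have : (2/3:ℝ) ^ i0 ≤ 1 := pow_le_one₀ nN nN
      rw [hs]; linarith
    have step : ∀ i ≤ i0, ∀ j, 2 ^ i + j ≤ 2 ^ I → ∀ C : ℝ, gZ s (g j) ≤ C * ρ ^ j → gZ s (g (2 ^ i + j)) ≤ 2 * C * ρ ^ (2 ^ i + j) := by
      intro i hi j hij C hC
      have h1 := G.sub s (2 ^ i) j hij
      have h2 := G.zh i0 hi0 s hs i hi
      have h3 := up2' i oO
      have h4 : gZ s (g (2 ^ i)) ≤ 19/10 * ρ ^ (2 ^ i) := by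
        have : 0 ≤ ρ ^ (2 ^ i) := by positivity
        linarith
      have h5 := mul_le_mul h4 hC (G.gnn s j) pP
      have h6 : 0 ≤ (19/10 * ρ ^ (2 ^ i)) * (C * ρ ^ j) := (mul_nonneg (G.gnn s _) (G.gnn s j)).trans h5
      rw [pow_add]
      nlinarith
    have small : ∀ i ≤ i0, ∀ j < 2 ^ i, gZ s (g j) ≤ 2 ^ (i + 1) * ρ ^ j := by
      intro i
      induction i with
      | zero =>
        intro _ j hj
        have : j = 0 := by simpa using hj
        subst this
        have := G.zle s hs0 hs1 0
        simp; linarith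
      | succ i ih =>
        intro hi j hj
        have ih := ih oO
        by_cases hji : j < 2 ^ i
        · refine (ih j hji).trans (mlr (pow_le_pow_right₀ nN oO) pP)
        · obtain ⟨j', rfl⟩ : ∃ j', j = 2 ^ i + j' := ⟨j - 2 ^ i, by omega⟩
          have hpow : (2:ℕ) ^ (i + 1) ≤ 2 ^ I := Nat.pow_le_pow_right nN oO
          have := step i oO j' oO _ (ih j' (by rw [pow_succ] at hj; omega))
          rw [pow_succ 2 (i+1)]
          linarith
    intro k
    induction k using Nat.strong_induction_on with
    | _ k ih =>
      intro hk
      by_cases hk0 : k < 2 ^ i0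
      · have := small i0 le_rfl k hk0
        rwa [Nat.div_eq_of_lt hk0, add_zero]
      · obtain ⟨j, rfl⟩ : ∃ j', k = 2 ^ i0 + j' := ⟨k - 2 ^ i0, by omega⟩
        have pp : 0 < 2 ^ i0 := by positivity
        have := step i0 le_rfl j hk _ (ih j oO oO)
        rw [Nat.add_div_left _ pp]
        refine this.trans_eq ?_
        rw [← add_assoc, pow_succ 2]
        ring
  refine ⟨ρ, hρ0, hρ1, ?_, ?_⟩
  · intro i0 hi0 k hk d
    have h1 := zhat i0 hi0 k hk
    set s : ℝ := 1/10 * (2/3) ^ i0 with hs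
    have h2 : ch s d * g k d ≤ gZ s (g k) := single_le_sum (f := fun d => ch s d * g k d) (fun d _ => mul_nonneg (ch_nonneg _ _) (G.nn _ _)) (mem_univ d)
    have h3 : exp (s * nd d) / 2 ≤ ch s d := by
      unfold ch; rw [cosh_eq]; linarith [exp_pos (-(s * nd d))]
    have h4 : exp (s * nd d) / 2 * g k d ≤ 2 ^ (i0 + 1 + k / 2 ^ i0) * ρ ^ k :=
      (mlr h3 (G.nn k d)).trans (h2.trans h1)
    have h5 := mll h4 (by positivity : 0 ≤ 2 * exp (-(s * nd d)))
    have h6 : exp (-(s * nd d)) * exp (s * nd d) = 1 := by rw [← exp_add]; simp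
    have h7 : 2 * exp (-(s * nd d)) * (exp (s * nd d) / 2 * g k d) = g k d := by
      linear_combination (g k d) * h6
    rw [h7] at h5
    refine h5.trans_eq ?_
    rw [show i0 + 2 + k / 2 ^ i0 = (i0 + 1 + k / 2 ^ i0) + 1 by ring, pow_succ 2]
    ring
  · intro k hk
    have hk' : k ≤ 2 ^ I := by omega
    have upk : ∀ j ≤ 2 ^ I, gZ 0 (g j) ≤ 2 ^ (I + 2) * ρ ^ j := by
      intro j hj
      have h1 := zhat I le_rfl j hj
      have h2 : gZ 0 (g j) ≤ gZ (1/10 * (2/3) ^ I) (g j) := by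
        rw [gZ_zero]
        refine sum_le_sum fun d _ => ?_
        exact le_mul_of_one_le_left (G.nn _ _) (ch_one_le _ _)
      refine h2.trans (h1.trans ?_)
      refine mlr (pow_le_pow_right₀ nN ?_) pP
      have : j / 2 ^ I ≤ 1 := by
        calc j / 2 ^ I ≤ 2 ^ I / 2 ^ I := Nat.div_le_div_right hj
          _ = 1 := Nat.div_self pP
      omega
    have s1 := G.sub 0 k (2 ^ I - k) oO
    rw [show k + (2 ^ I - k) = 2 ^ I by omega, ← hρ] at s1
    have s2 := upk (2 ^ I - k) oO
    have s3 : ρ ^ (2 ^ I) ≤ (1 + t) * (gZ 0 (g k) * (2 ^ (I + 2) * ρ ^ (2 ^ I - k))) :=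
      s1.trans (mll (mll s2 (G.gnn _ _)) lL)
    have s4 : ρ ^ (2 ^ I) = ρ ^ k * ρ ^ (2 ^ I - k) := by rw [← pow_add]; congr 1; omega
    have pr : 0 < ρ ^ (2 ^ I - k) := by positivity
    have s5 : ρ ^ k ≤ (1 + t) * (gZ 0 (g k) * 2 ^ (I + 2)) := by
      refine le_of_mul_le_mul_right ?_ pr
      rw [← s4]
      refine s3.trans_eq (by ring)
    have s6 : ρ ^ k ≤ 1001/1000 * 2 ^ (I + 2) * gZ 0 (g k) := by
      have : 0 ≤ gZ 0 (g k) * 2 ^ (I + 2) := mul_nonneg (G.gnn _ _) pP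
      nlinarith
    have s7 : (ρ ^ k) ^ 2 ≤ (1001/1000 * 2 ^ (I + 2) * gZ 0 (g k)) ^ 2 := pow_le_pow_left₀ pP s6 2
    have s8 := G.rp2 k hk
    have e7 : ((2:ℝ) ^ (I + 2)) ^ 2 = (2 ^ 2) ^ (I + 2) := by rw [← pow_mul, ← pow_mul, mul_comm]
    rw [← pow_mul, mul_comm k 2, mul_pow, mul_pow, e7] at s7
    have c1 : (0:ℝ) ≤ (2 ^ 2) ^ (I + 2) := by positivity
    have s9 := mll s8 c1
    have e : (4:ℝ) ^ (I + 3) = 4 * (2 ^ 2) ^ (I + 2) := by rw [show (4:ℝ) = 2 ^ 2 by norm_num, pow_succ]; ring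
    rw [e]
    have : 0 ≤ (2 ^ 2 : ℝ) ^ (I + 2) * (M * g (2 * k) 0) := mul_nonneg c1 (mul_nonneg pP (G.nn _ _))
    generalize ((2:ℝ) ^ 2) ^ (I + 2) = c at *
    linarith
end conv

section gpt
variable {K M : ℕ} [NeZero K] [NeZero M] {t : ℝ}

lemma nd_cast_le (j : ℕ) (hj : j ≤ K / 2) : nd (j : ZMod K) = j := by
  unfold nd; rw [ZMod.valMinAbs_natCast_of_le_half hj]; simp

lemma sum_shift (f : ZMod M → ℝ) (y : ZMod M) : ∑ x, f (x - y) = ∑ x, f x := Equiv.sum_comp (Equiv.subRight y) f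
lemma sum_shift' (f : ZMod M → ℝ) (y : ZMod M) : ∑ x, f (y - x) = ∑ x, f x := Equiv.sum_comp (Equiv.subLeft y) f

lemma tor_GP (ht : 0 < t) (ht1 : t ≤ 1/1000) (hM : 2 ≤ M) (h I : ℕ) (hK : K = 2 * h) (hh : 2 * (2 ^ I + M + 1) ≤ h) :
    GP t I (fun (k : ℕ) (d : ZMod M) => tg t K M (k : ZMod K) d) where
  t0 := ht
  t1 := ht1
  nn k d := tg_nonneg ht.le lL _ _
  even k d := tg_neg2 t hM _ _
  sim k l hkl d := tg_simon ht ht1 hM h (2 ^ I) hK hh k l hkl d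
  zle s hs hs1 k := tZ_le ht.le ht1 hM hs hs1 _
  z1 := by
    have := tZ_one (K := K) ht.le ht1 hM (by have := Nat.one_le_two_pow (n := I); omega) (s := 1) zero_le_one le_rfl
    simpa [tZ, gZ] using this
  tz := by
    rw [gZ_zero]
    have := tg_lower (K := K) ht.le lL hM 1 (0 : ZMod M)
    rw [nd_zero, add_zero, pow_one] at this
    exact this.trans (single_le_sum (f := fun d => tg t K M ((1 : ℕ) : ZMod K) d) (fun d _ => tg_nonneg ht.le lL _ _) (mem_univ 0))
  zdec := by
    refine tZ_decay ht.le ht1 hM le_rfl zero_le_one (2 ^ I) _ ?_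
    rw [nd_cast_le _ oO]
  rp1 k hk := by
    set Z0 := gZ 0 (fun d : ZMod M => tg t K M 0 d) with hZ0
    set Zk := gZ 0 (fun d : ZMod M => tg t K M (k : ZMod K) d) with hZk
    set Z2 := gZ 0 (fun d : ZMod M => tg t K M ((2 * k : ℕ) : ZMod K) d) with hZ2
    have z0le : Z0 ≤ 101/100 := by
      have := tZ_le (K := K) (M := M) ht.le ht1 hM (s := 0) le_rfl zero_le_one 0
      exact this
    have z0ge : 1 ≤ Z0 := by
      have h1 : tg t K M 0 0 = 1 := cG_self ht.le lL _ _
      rw [hZ0, gZ_zero, ← h1]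
      exact single_le_sum (f := fun d => tg t K M (0 : ZMod K) d) (fun d _ => tg_nonneg ht.le lL _ _) (mem_univ 0)
    have z2 : 0 ≤ Z2 := sum_nonneg fun d _ => mul_nonneg (ch_nonneg _ _) (tg_nonneg ht.le lL _ _)
    have R := rp_form ht.le lL hM h hK oO k oO (fun _ => 1) (fun _ => -(Zk / Z0))
    have e : ∀ j : ZMod K, ∀ y : ZMod M, ∑ x, tg t K M j (x - y) = gZ 0 (fun d : ZMod M => tg t K M j d) := by
      intro j y; rw [gZ_zero]; exact sum_shift (fun d => tg t K M j d) y
    simp only [mul_one, one_mul, ← mul_sum, e] at R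
    simp only [sum_const, card_univ, ZMod.card, nsmul_eq_mul] at R
    rw [← hZ0, ← hZk, ← hZ2] at R
    have hMp : (0:ℝ) < M := by have : 0 < M := by omega
                               exact_mod_cast this
    have R2 : 0 ≤ (M : ℝ) * (Z2 - Zk ^ 2 / Z0) := by
      refine R.trans_eq ?_
      field_simp
      ring
    have R3 := nonneg_of_mul_nonneg_right R2 hMp
    have : Zk ^ 2 / Z0 ≤ Z2 := by linarith
    rw [div_le_iff₀ lL] at this
    nlinarith
  rp2 k hk := by
    set Z0 := gZ 0 (fun d : ZMod M => tg t K M 0 d) with hZ0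
    set G : ZMod M → ℝ := fun d => tg t K M (k : ZMod K) d with hG
    have z0le : Z0 ≤ 101/100 := by
      have := tZ_le (K := K) (M := M) ht.le ht1 hM (s := 0) le_rfl zero_le_one 0
      exact this
    have R := rp_form ht.le lL hM h hK oO k oO (fun x => if x = 0 then 1 else 0) (fun y => -(100/101 * G y))
    set S := ∑ y, G y ^ 2 with hS
    have S0 : 0 ≤ S := sum_nonneg fun _ _ => sq_nonneg _
    have g0 : ∀ d, 0 ≤ tg t K M 0 d := fun d => tg_nonneg ht.le lL _ _
    have e : ∀ y : ZMod M, ∑ x, tg t K M 0 (x - y) = Z0 := by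
      intro y; rw [hZ0, gZ_zero]; exact sum_shift (fun d => tg t K M 0 d) y
    have e' : ∀ y : ZMod M, ∑ x, tg t K M 0 (y - x) = Z0 := by
      intro y; rw [hZ0, gZ_zero]; exact sum_shift' (fun d => tg t K M 0 d) y
    have t1 : ∑ y, ∑ y', (-(100/101 * G y)) * (-(100/101 * G y')) * tg t K M 0 (y' - y) ≤ (100/101)^2 * (Z0 * S) := by
      have : ∀ y y', (-(100/101 * G y)) * (-(100/101 * G y')) * tg t K M 0 (y' - y) ≤
          (100/101)^2/2 * (G y ^ 2 * tg t K M 0 (y' - y)) + (100/101)^2/2 * (G y' ^ 2 * tg t K M 0 (y' - y)) := by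
        intro y y'
        have := mul_nonneg (sq_nonneg (G y - G y')) (g0 (y' - y))
        nlinarith
      refine (sum_le_sum fun y _ => sum_le_sum fun y' _ => this y y').trans ?_
      simp only [sum_add_distrib, ← mul_sum, e]
      rw [sum_comm]
      simp only [← mul_sum, e']
      rw [← sum_mul, ← hS]
      linarith
    have t2 : ∑ y, ∑ x, -(100/101 * G y) * (if x = 0 then 1 else 0) * tg t K M (k : ZMod K) (x - y) = -(100/101 * S) := by
      rw [hS, mul_sum, ← sum_neg_distrib]
      refine sum_congr rfl fun y _ => ?_
      simp only [mul_ite, mul_one, mul_zero, ite_mul, zero_mul, sum_ite_eq', mem_univ, if_true, zero_sub]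
      rw [tg_neg2 t hM]; ring
    have t3 : ∑ x : ZMod M, ∑ x', (if x = 0 then (1:ℝ) else 0) * (if x' = 0 then 1 else 0) * tg t K M ((2 * k : ℕ) : ZMod K) (x' - x) = tg t K M ((2 * k : ℕ) : ZMod K) 0 := by
      simp
    rw [t2, t3] at R
    have cs : (gZ 0 G) ^ 2 ≤ M * S := by
      rw [gZ_zero]
      have := sq_sum_le_card_mul_sum_sq (s := (univ : Finset (ZMod M))) (f := G)
      simpa [ZMod.card] using this
    have fin : S ≤ 101/100 * tg t K M ((2 * k : ℕ) : ZMod K) 0 := by nlinarith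
    have hMp : (0:ℝ) ≤ M := by positivity
    nlinarith [mll fin hMp]
end gpt

section geo
variable {K M : ℕ} [NeZero K] [NeZero M] {t : ℝ}

def pt (K M : ℕ) (i j : ℕ) : ZMod K × ZMod M := ((i : ZMod K), (j : ZMod M))

def rc (K M : ℕ) [NeZero K] [NeZero M] (m R : ℕ) : Finset (ZMod K × ZMod M) := univ.filter (fun v => v.1.val ≤ m ∧ v.2.val ≤ R)

def rE (K M : ℕ) [NeZero K] [NeZero M] (m R : ℕ) : Finset ((ZMod K × ZMod M) × (ZMod K × ZMod M)) :=
  (torE K M).filter (fun e => e.1 ∈ rc K M m R ∧ e.2 ∈ rc K M m R)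

lemma mem_rc (m R : ℕ) (v : ZMod K × ZMod M) : v ∈ rc K M m R ↔ v.1.val ≤ m ∧ v.2.val ≤ R := by simp [rc]

lemma pt_mem_rc (m R i j : ℕ) (hi : i ≤ m) (hj : j ≤ R) (hm : m < K) (hR : R < M) : pt K M i j ∈ rc K M m R := by
  rw [mem_rc]; simp only [pt]
  rw [ZMod.val_cast_of_lt oO, ZMod.val_cast_of_lt oO]; exact ⟨hi, hj⟩

lemma eq_pt (v : ZMod K × ZMod M) : v = pt K M v.1.val v.2.val := by
  simp [pt]

def dd (a b : ℕ) : ℕ := (b - a) + (a - b)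

lemma tor_pt (hM : 2 ≤ M) (i j i' j' : ℕ) : cG t (torE K M) (pt K M i j) (pt K M i' j') =
    tg t K M ((dd i i' : ℕ) : ZMod K) ((j' : ZMod M) - (j : ZMod M)) := by
  rw [tg_eq t hM]
  simp only [pt]
  rcases le_total i i' with h | h
  · rw [show dd i i' = i' - i by unfold dd; omega, Nat.cast_sub h]
  · rw [show dd i i' = i - i' by unfold dd; omega, Nat.cast_sub h, ← tg_neg1 t hM, neg_sub]

lemma nd_pt (j j' : ℕ) (h : dd j j' ≤ M / 2) : nd ((j' : ZMod M) - (j : ZMod M)) = dd j j' := by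
  rcases le_total j j' with h' | h'
  · have e : dd j j' = j' - j := by unfold dd; omega
    rw [e] at h ⊢
    rw [← Nat.cast_sub h', nd_cast_le _ h]
  · have e : dd j j' = j - j' := by unfold dd; omega
    rw [e] at h ⊢
    rw [← nd_neg, neg_sub, ← Nat.cast_sub h', nd_cast_le _ h]

lemma rE_hor (ht : 0 ≤ t) (ht1 : t ≤ 1/2) (m R i j k : ℕ) (hi : i + k ≤ m) (hj : j ≤ R) (hm : m < K) (hR : R < M) :
    t ^ k ≤ cG t (rE K M m R) (pt K M i j) (pt K M (i + k) j) := by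
  induction k with
  | zero => simp [cG_self ht ht1]
  | succ k ih =>
    have ih := ih oO
    have h1 := cG_chain ht ht1 (rE K M m R) (pt K M i j) (pt K M (i+k) j) (pt K M (i + (k+1)) j)
    have h2 := cG_bond ht ht1 (rE K M m R) (pt K M (i+k) j, pt K M (i+(k+1)) j) (by
      rw [rE, mem_filter, mem_torE]
      refine ⟨Or.inl ?_, pt_mem_rc _ _ _ _ oO hj hm hR, pt_mem_rc _ _ _ _ oO hj hm hR⟩
      simp [pt, add_assoc])
    rw [pow_succ]
    exact (mul_le_mul ih h2 ht (cG_nonneg ht ht1 _ _ _)).trans h1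

lemma rE_ver (ht : 0 ≤ t) (ht1 : t ≤ 1/2) (m R i j k : ℕ) (hi : i ≤ m) (hj : j + k ≤ R) (hm : m < K) (hR : R < M) :
    t ^ k ≤ cG t (rE K M m R) (pt K M i j) (pt K M i (j + k)) := by
  induction k with
  | zero => simp [cG_self ht ht1]
  | succ k ih =>
    have ih := ih oO
    have h1 := cG_chain ht ht1 (rE K M m R) (pt K M i j) (pt K M i (j+k)) (pt K M i (j + (k+1)))
    have h2 := cG_bond ht ht1 (rE K M m R) (pt K M i (j+k), pt K M i (j+(k+1))) (by
      rw [rE, mem_filter, mem_torE]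
      refine ⟨Or.inr ?_, pt_mem_rc _ _ _ _ hi oO hm hR, pt_mem_rc _ _ _ _ hi oO hm hR⟩
      simp [pt, add_assoc])
    rw [pow_succ]
    exact (mul_le_mul ih h2 ht (cG_nonneg ht ht1 _ _ _)).trans h1

set_option maxHeartbeats 1600000 in
theorem geo (ht : 0 < t) (ht1 : t ≤ 1/1000) (I h m R L l i0 : ℕ) (hMI : M = 4 * 2 ^ I) (hK : K = 2 * h)
    (hh : 2 * (2 ^ I + M + 1) ≤ h) (hm : m ≤ 2 ^ I) (hR : R ≤ 2 ^ I) (hL : L ≤ R) (hl : 2 * l ≤ L) (hlm : 2 * l ≤ m) (hi0 : i0 ≤ I)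
    (H : (K * M * 4 ^ (I + 3) * exp (-(2 * (1/10 * (2/3) ^ I * l)))) * (4 * M * 4 ^ (I + 3)) ≤ 1) :
    (cG t (rE K M m R) (pt K M 0 0) (pt K M m 0) - cG t (rE K M m L) (pt K M 0 0) (pt K M m 0)) * t ^ (4 * l + 1) ≤
      (K * M * exp (-(2 * (1/10 * (2/3) ^ i0 * L))) * 2 ^ (2 * i0 + 4 + m / 2 ^ i0) * (4 * M * 4 ^ (I + 3))) *
        cG t (rE K M m L) (pt K M 0 0) (pt K M m 0) := by
  have p2 : 1 ≤ 2 ^ I := Nat.one_le_two_pow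
  have hM : 2 ≤ M := by omega
  have ht2 : t ≤ 1/2 := by linarith
  obtain ⟨ρ, hρ0, hρ1, up, lo⟩ := (tor_GP (K := K) ht ht1 hM h I hK hh).bounds
  have UP : ∀ i1 ≤ I, ∀ i j i' j', i ≤ 2 ^ I → i' ≤ 2 ^ I → j ≤ 2 ^ I → j' ≤ 2 ^ I →
      cG t (torE K M) (pt K M i j) (pt K M i' j') ≤ exp (-(1/10 * (2/3) ^ i1 * dd j j')) * 2 ^ (i1 + 2 + dd i i' / 2 ^ i1) * ρ ^ (dd i i') := by
    intro i1 hi1 i j i' j' h1 h2 h3 h4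
    rw [tor_pt hM]
    have := up i1 hi1 (dd i i') (by unfold dd; omega) ((j' : ZMod M) - (j : ZMod M))
    rwa [nd_pt _ _ (by unfold dd; omega)] at this
  have nnT : ∀ a b, 0 ≤ cG t (torE K M) a b := cG_nonneg ht.le ht2 _
  have hρ1' : ρ ≤ 1 := by linarith
  have cardle : ∀ T : Finset (ZMod K × ZMod M), ((#T : ℕ) : ℝ) ≤ K * M := by
    intro T
    have := card_le_univ T
    rw [Fintype.card_prod, ZMod.card, ZMod.card] at this
    exact_mod_cast this
  obtain ⟨k, hk1, hk2⟩ : ∃ k, 2 * l + 2 * k ≤ m ∧ m ≤ 2 * l + 2 * k + 1 := ⟨(m - 2 * l) / 2, by omega, by omega⟩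
  set N := 2 * k with hN
  set a' := pt K M l l with ha'
  set b' := pt K M (l + N) l with hb'
  have vK := val_add_one' (K := K) oO
  have vM := val_add_one' (K := M) oO
  set T := (rc K M m L).filter (fun v => v.1.val = 0 ∨ v.1.val = m ∨ v.2.val = 0 ∨ v.2.val = L) with hT
  have sE : exp (-(2 * (1/10 * (2/3) ^ I * l))) = exp (-(1/10 * (2/3) ^ I * l)) * exp (-(1/10 * (2/3) ^ I * l)) := by
    rw [← exp_add]; ring_nf
  set s : ℝ := 1/10 * (2/3) ^ I with hs
  have s0 : 0 ≤ s := by positivity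
  have s1 : s ≤ 1 := by
    have : (2/3:ℝ) ^ I ≤ 1 := pow_le_one₀ nN nN
    rw [hs]; linarith
  have rl : ρ ^ l ≤ exp (-(s * l)) := by
    have h1 : ρ ≤ exp (-1) := by
      have := exp_one_lt_d9
      rw [exp_neg]
      refine hρ1.trans ?_
      rw [one_div]
      exact inv_anti₀ (exp_pos 1) lL
    calc ρ ^ l ≤ exp (-1) ^ l := pow_le_pow_left₀ hρ0.le h1 l
      _ = exp (-l) := by rw [← exp_nat_mul]; ring_nf
      _ ≤ exp (-(s * l)) := by
        apply exp_le_exp.2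
        have : (0:ℝ) ≤ l := by positivity
        exact neg_le_neg (mul_le_of_le_one_left this s1)
  have lowT : ∀ x ∈ T, cG t (torE K M) a' x * cG t (torE K M) x b' ≤ 4 ^ (I + 3) * ρ ^ N * exp (-(2 * (s * l))) := by
    intro x hx
    rw [hT, mem_filter, mem_rc] at hx
    obtain ⟨⟨h1, h2⟩, h3⟩ := hx
    rw [eq_pt x]
    set i := x.1.val
    set j := x.2.val
    have u1 := UP I le_rfl l l i j oO oO oO oO
    have u2 := UP I le_rfl i j (l + N) l oO oO oO oO
    have e1 : ∀ q, q ≤ 2 ^ I → (2:ℝ) ^ (I + 2 + q / 2 ^ I) ≤ 2 ^ (I + 3) := by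
      intro q hq
      refine pow_le_pow_right₀ nN ?_
      have : q / 2 ^ I ≤ 1 := by
        calc q / 2 ^ I ≤ 2 ^ I / 2 ^ I := Nat.div_le_div_right hq
          _ = 1 := Nat.div_self pP
      omega
    have e2 : (2:ℝ) ^ (I + 3) * 2 ^ (I + 3) = 4 ^ (I + 3) := by rw [← mul_pow]; norm_num
    have d1 : dd l i ≤ 2 ^ I := by unfold dd; omega
    have d2 : dd i (l + N) ≤ 2 ^ I := by unfold dd; omega
    have u1' : cG t (torE K M) (pt K M l l) (pt K M i j) ≤ exp (-(s * dd l j)) * 2 ^ (I + 3) * ρ ^ (dd l i) :=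
      u1.trans (mlr (mll (e1 _ d1) (exp_pos _).le) pP)
    have u2' : cG t (torE K M) (pt K M i j) (pt K M (l+N) l) ≤ exp (-(s * dd j l)) * 2 ^ (I + 3) * ρ ^ (dd i (l+N)) :=
      u2.trans (mlr (mll (e1 _ d2) (exp_pos _).le) pP)
    refine (mul_le_mul u1' u2' (nnT _ _) pP).trans ?_
    have key : exp (-(s * dd l j)) * exp (-(s * dd j l)) * ρ ^ (dd l i + dd i (l + N)) ≤ ρ ^ N * exp (-(2 * (s * l))) := by
      by_cases hc : i = 0 ∨ i = m
      · have q1 : N + (l + l) ≤ dd l i + dd i (l + N) := by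
          unfold dd; rcases hc with hc | hc <;> omega
        have q2 : ρ ^ (dd l i + dd i (l + N)) ≤ ρ ^ N * exp (-(2 * (s * l))) := by
          refine (pow_le_pow_of_le_one hρ0.le hρ1' q1).trans ?_
          rw [pow_add, pow_add, sE]
          refine mll (mul_le_mul rl rl pP (exp_pos _).le) pP
        have q3 : ∀ z : ℕ, exp (-(s * z)) ≤ 1 := by
          intro z; rw [exp_le_one_iff]
          have : (0:ℝ) ≤ s * z := by positivity
          linarith
        have q4 : exp (-(s * dd l j)) * exp (-(s * dd j l)) ≤ 1 := mul_le_one₀ (q3 _) (exp_pos _).le (q3 _)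
        exact (mul_le_of_le_one_left pP q4).trans q2
      · have hj : j = 0 ∨ j = L := by omega
        have q1 : N ≤ dd l i + dd i (l + N) := by unfold dd; omega
        have q2 : ρ ^ (dd l i + dd i (l + N)) ≤ ρ ^ N := pow_le_pow_of_le_one hρ0.le hρ1' q1
        have q5 : ∀ z : ℕ, l ≤ z → exp (-(s * z)) ≤ exp (-(s * l)) := by
          intro z hz; apply exp_le_exp.2
          have : (l:ℝ) ≤ z := by exact_mod_cast hz
          exact neg_le_neg (mll this s0)
        have q3 : l ≤ dd l j := by unfold dd; omega
        have q4 : l ≤ dd j l := by unfold dd; omega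
        rw [sE, mul_comm (ρ ^ N)]
        exact mul_le_mul (mul_le_mul (q5 _ q3) (q5 _ q4) (exp_pos _).le (exp_pos _).le) q2 pP pP
    calc _ = (2:ℝ) ^ (I + 3) * 2 ^ (I + 3) * (exp (-(s * dd l j)) * exp (-(s * dd j l)) * ρ ^ (dd l i + dd i (l + N))) := by rw [pow_add ρ]; ring
      _ ≤ _ := by
        rw [e2]
        exact (mll key (by positivity : (0:ℝ) ≤ 4 ^ (I + 3))).trans_eq (by ring)
  have cut := cut_bound ht.le ht2 T (rc K M m L) (torE K M) (rE K M m L) (filter_subset _ _)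
    (fun e he h1 h2 => by rw [rE, mem_filter]; exact ⟨he, h1, h2⟩) (by
      rintro ⟨⟨x, y⟩, ⟨x', y'⟩⟩ he
      rw [mem_torE] at he
      simp only [Prod.mk_add_mk, Prod.mk.injEq, add_zero] at he
      simp only [hT, mem_filter, mem_rc]
      have lx := ZMod.val_lt x
      have ly := ZMod.val_lt y
      rcases he with ⟨rfl, rfl⟩ | ⟨rfl, rfl⟩
      · rw [vK]; split_ifs <;> omega
      · rw [vM]; split_ifs <;> omega)
    (fun e he => by rw [rE, mem_filter] at he; exact he.2) a' b' (pt_mem_rc _ _ _ _ oO oO oO oO)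
  have lo1 := lo k oO
  have tor0 : cG t (torE K M) a' b' = tg t K M ((2 * k : ℕ) : ZMod K) 0 := by
    rw [ha', hb', tor_pt hM, sub_self]; congr 2; unfold dd; omega
  rw [← tor0, ← hN] at lo1
  have sumT : ∑ x ∈ T, cG t (torE K M) a' x * cG t (torE K M) x b' ≤ (K * M) * (4 ^ (I + 3) * ρ ^ N * exp (-(2 * (s * l)))) := by
    refine (sum_le_card_nsmul T _ _ lowT).trans ?_
    rw [nsmul_eq_mul]
    exact mlr (cardle T) pP
  have C0 : (0:ℝ) < M * 4 ^ (I + 3) := by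
    have : (0:ℝ) < M := by exact_mod_cast (by omega : 0 < M)
    positivity
  have rN : 0 < ρ ^ N := by positivity
  have low1 : ρ ^ N ≤ 4 * (M * 4 ^ (I + 3)) * cG t (rE K M m L) a' b' := by
    have h1 : ((K * M) * (4 ^ (I + 3) * ρ ^ N * exp (-(2 * (s * l))))) * (4 * (M * 4 ^ (I + 3))) ≤ ρ ^ N := by
      have := mlr H rN.le
      rw [one_mul] at this
      exact le_trans (le_of_eq (by ring)) this
    have h2 := mll (cut.trans (add_le_add le_rfl sumT)) (by positivity : 0 ≤ 4 * (M * 4 ^ (I + 3) : ℝ))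
    rw [mul_add, mul_comm _ ((K * M : ℝ) * _)] at h2
    have h3 : (2:ℝ) * ρ ^ N ≤ 4 * (M * 4 ^ (I + 3)) * cG t (torE K M) a' b' :=
      (mll lo1 (by norm_num : (0:ℝ) ≤ 2)).trans_eq (by ring)
    linarith only [h1, h2, h3]
  have c1 : t ^ l ≤ cG t (rE K M m L) (pt K M 0 0) (pt K M l 0) := by
    have := rE_hor (K := K) (M := M) ht.le ht2 m L 0 0 l oO oO oO oO
    simpa using this
  have c2 : t ^ l ≤ cG t (rE K M m L) (pt K M l 0) a' := by
    have := rE_ver (K := K) (M := M) ht.le ht2 m L l 0 l oO oO oO oO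
    simpa using this
  have c3 : t ^ (l + 1) ≤ cG t (rE K M m L) b' (pt K M m l) := by
    have := rE_hor (K := K) (M := M) ht.le ht2 m L (l + N) l (m - (l + N)) oO oO oO oO
    rw [show l + N + (m - (l + N)) = m by omega] at this
    exact (pow_le_pow_of_le_one ht.le lL oO).trans this
  have c4 : t ^ l ≤ cG t (rE K M m L) (pt K M m l) (pt K M m 0) := by
    have := rE_ver (K := K) (M := M) ht.le ht2 m L m 0 l oO oO oO oO
    rw [cG_comm]
    simpa using this
  have nnS : ∀ a b, 0 ≤ cG t (rE K M m L) a b := cG_nonneg ht.le ht2 _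
  have chain : ∀ a x b (p q : ℝ), 0 ≤ p → 0 ≤ q → p ≤ cG t (rE K M m L) a x → q ≤ cG t (rE K M m L) x b → p * q ≤ cG t (rE K M m L) a b :=
    fun a x b p q hp hq h1 h2 => (mul_le_mul h1 h2 hq (nnS _ _)).trans (cG_chain ht.le ht2 _ _ _ _)
  have tl : 0 ≤ t ^ l := by positivity
  have tl1 : 0 ≤ t ^ (l+1) := by positivity
  have c5 := chain _ _ _ _ _ tl tl c1 c2
  have c6 := chain _ _ _ _ _ tl1 tl c3 c4
  have c7 := chain _ _ _ _ _ pP (nnS a' b') c5 le_rfl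
  have c8 := chain _ _ _ _ _ (mul_nonneg pP (nnS a' b')) pP c7 c6
  have low2 : t ^ (4 * l + 1) * ρ ^ m ≤ 4 * (M * 4 ^ (I + 3)) * cG t (rE K M m L) (pt K M 0 0) (pt K M m 0) := by
    have h1 : t ^ (4 * l + 1) * ρ ^ m ≤ t ^ (4 * l + 1) * ρ ^ N :=
      mll (pow_le_pow_of_le_one hρ0.le hρ1' oO) pP
    have h2 := mll low1 (by positivity : 0 ≤ t ^ (4 * l + 1))
    have h3 := mll c8 (by positivity : 0 ≤ 4 * (M * 4 ^ (I + 3) : ℝ))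
    have h4 : t ^ (4 * l + 1) = t ^ l * t ^ l * (t ^ (l + 1) * t ^ l) := by rw [← pow_add, ← pow_add, ← pow_add]; congr 1; ring
    refine h1.trans (h2.trans (le_trans (le_of_eq ?_) h3))
    rw [h4]; ring
  set T' := (rc K M m R).filter (fun v => L < v.2.val) with hT'
  have rem := removal ht.le ht2 T' (rE K M m R) (rE K M m L) (by
      intro e he
      rw [rE, mem_filter, mem_rc, mem_rc] at he ⊢
      exact ⟨he.1, ⟨he.2.1.1, by omega⟩, ⟨he.2.2.1, by omega⟩⟩) (by
      intro e he he'
      simp only [rE, mem_filter, mem_rc, hT'] at he he' ⊢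
      by_contra hcon
      apply he'
      refine ⟨he.1, ⟨he.2.1.1, ?_⟩, ⟨he.2.2.1, ?_⟩⟩
      · by_contra hc; exact hcon (Or.inl ⟨he.2.1, by omega⟩)
      · by_contra hc; exact hcon (Or.inr ⟨he.2.2, by omega⟩)) (pt K M 0 0) (pt K M m 0)
  set s' : ℝ := 1/10 * (2/3) ^ i0 with hs'
  have s'0 : 0 ≤ s' := by positivity
  have upT : ∀ x ∈ T', cG t (rE K M m R) (pt K M 0 0) x * cG t (rE K M m R) x (pt K M m 0) ≤
      exp (-(2 * (s' * L))) * 2 ^ (2 * i0 + 4 + m / 2 ^ i0) * ρ ^ m := by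
    intro x hx
    rw [hT', mem_filter, mem_rc] at hx
    obtain ⟨⟨h1, h2⟩, h3⟩ := hx
    have m1 : ∀ a b, cG t (rE K M m R) a b ≤ cG t (torE K M) a b := cG_mono ht.le ht2 (filter_subset _ _)
    refine (mul_le_mul (m1 _ _) (m1 _ _) (cG_nonneg ht.le ht2 _ _ _) (nnT _ _)).trans ?_
    rw [eq_pt x]
    set i := x.1.val
    set j := x.2.val
    have u1 := UP i0 hi0 0 0 i j oO oO oO oO
    have u2 := UP i0 hi0 i j m 0 oO oO oO oO
    rw [show dd 0 i = i by unfold dd; omega, show dd 0 j = j by unfold dd; omega] at u1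
    rw [show dd i m = m - i by unfold dd; omega, show dd j 0 = j by unfold dd; omega] at u2
    refine (mul_le_mul u1 u2 (nnT _ _) pP).trans ?_
    have q1 : exp (-(s' * j)) ≤ exp (-(s' * L)) := by
      apply exp_le_exp.2
      have : (L:ℝ) ≤ j := by exact_mod_cast h3.le
      exact neg_le_neg (mll this s'0)
    have q2 : exp (-(2 * (s' * L))) = exp (-(s' * L)) * exp (-(s' * L)) := by rw [← exp_add]; ring_nf
    have q3 : ρ ^ m = ρ ^ i * ρ ^ (m - i) := by rw [← pow_add]; congr 1; omega
    have q4 : (2:ℝ) ^ (i0 + 2 + i / 2 ^ i0) * 2 ^ (i0 + 2 + (m - i) / 2 ^ i0) ≤ 2 ^ (2 * i0 + 4 + m / 2 ^ i0) := by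
      rw [← pow_add]
      refine pow_le_pow_right₀ nN ?_
      have := @Nat.div_add_div_le_add_div i (m - i) (2 ^ i0)
      rw [show i + (m - i) = m by omega] at this
      omega
    calc _ = exp (-(s' * j)) * exp (-(s' * j)) * ((2:ℝ) ^ (i0 + 2 + i / 2 ^ i0) * 2 ^ (i0 + 2 + (m - i) / 2 ^ i0)) * (ρ ^ i * ρ ^ (m - i)) := by ring
      _ ≤ _ := by
        rw [q2, q3]
        refine mlr ?_ pP
        exact mul_le_mul (mul_le_mul q1 q1 (exp_pos _).le (exp_pos _).le) q4 pP pP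
  have sumT' : ∑ x ∈ T', cG t (rE K M m R) (pt K M 0 0) x * cG t (rE K M m R) x (pt K M m 0) ≤
      (K * M) * (exp (-(2 * (s' * L))) * 2 ^ (2 * i0 + 4 + m / 2 ^ i0) * ρ ^ m) := by
    refine (sum_le_card_nsmul T' _ _ upT).trans ?_
    rw [nsmul_eq_mul]
    exact mlr (cardle T') pP
  have f1 : cG t (rE K M m R) (pt K M 0 0) (pt K M m 0) - cG t (rE K M m L) (pt K M 0 0) (pt K M m 0) ≤
    (K * M) * (exp (-(2 * (s' * L))) * 2 ^ (2 * i0 + 4 + m / 2 ^ i0) * ρ ^ m) := by linarith only [rem, sumT']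
  have f2 := mlr f1 (by positivity : 0 ≤ t ^ (4 * l + 1))
  refine f2.trans ?_
  have f3 := mll low2 (by positivity : (0:ℝ) ≤ (K * M) * (exp (-(2 * (s' * L))) * 2 ^ (2 * i0 + 4 + m / 2 ^ i0)))
  exact le_trans (le_of_eq (by ring)) (f3.trans_eq (by ring))
end geo

section hightemp
variable {U : Type*} [Fintype U] [DecidableEq U]

def dg (F : Ed U) (v : U) : ℕ := #(F.filter (fun e => e.1 = v)) + #(F.filter (fun e => e.2 = v))

lemma ht_exp (t : ℝ) (E : Ed U) (d : U → ℕ) :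
    bS t E (fun η => ∏ v, spinVal (η v) ^ d v) =
      2 ^ (Fintype.card U) * ∑ F ∈ E.powerset.filter (fun F => ∀ v, Even (dg F v + d v)), t ^ #F := by
  have h1 : ∀ η : U → Bool, bw t E η * ∏ v, spinVal (η v) ^ d v =
      ∑ F ∈ E.powerset, t ^ #F * ∏ v, spinVal (η v) ^ (dg F v + d v) := by
    intro η
    unfold bw
    rw [Finset.prod_one_add, Finset.sum_mul]
    refine sum_congr rfl fun F _ => ?_
    rw [prod_mul_distrib, prod_const, prod_mul_distrib, mul_assoc]
    congr 1
    simp only [pow_add, dg, prod_mul_distrib]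
    congr 2
    · rw [← prod_fiberwise F (fun e => e.1)]
      refine prod_congr rfl fun v _ => ?_
      rw [prod_congr rfl (g := fun _ => spinVal (η v)) (by intro e he; rw [(mem_filter.1 he).2]), prod_const]
    · rw [← prod_fiberwise F (fun e => e.2)]
      refine prod_congr rfl fun v _ => ?_
      rw [prod_congr rfl (g := fun _ => spinVal (η v)) (by intro e he; rw [(mem_filter.1 he).2]), prod_const]
  have h2 : ∀ k : U → ℕ, ∑ η : U → Bool, ∏ v, spinVal (η v) ^ k v = if ∀ v, Even (k v) then (2:ℝ) ^ (Fintype.card U) else 0 := by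
    intro k
    have : ∑ η : U → Bool, ∏ v, spinVal (η v) ^ k v = ∏ v : U, ∑ b : Bool, spinVal b ^ k v := by
      rw [Finset.prod_univ_sum, Fintype.piFinset_univ]
    rw [this]
    have h3 : ∀ v, ∑ b : Bool, spinVal b ^ k v = if Even (k v) then 2 else 0 := by
      intro v
      by_cases h : Even (k v)
      · simp [spinVal, h, h.neg_one_pow, one_add_one_eq_two]
      · simp [spinVal, h, (Nat.not_even_iff_odd.1 h).neg_one_pow]
    simp only [h3]
    split_ifs with h
    · simp [h]
    · push Not at h
      obtain ⟨v, hv⟩ := h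
      exact prod_eq_zero (mem_univ v) (by simp [hv])
  unfold bS
  simp only [h1]
  rw [sum_comm]
  simp only [← mul_sum, h2]
  rw [sum_filter, mul_sum]
  refine sum_congr rfl fun F _ => ?_
  split_ifs <;> ring

end hightemp

section deg
variable {K M : ℕ} [NeZero K] [NeZero M]

lemma dg_tor (hK : 2 ≤ K) (F : Finset ((ZMod K × ZMod M) × (ZMod K × ZMod M))) (hF : F ⊆ torE K M) (v : ZMod K × ZMod M) :
    dg F v = ((if (v, v + (1,0)) ∈ F then 1 else 0) + (if (v, v + (0,1)) ∈ F then 1 else 0)) +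
      ((if (v - (1,0), v) ∈ F then 1 else 0) + (if (v - (0,1), v) ∈ F then 1 else 0)) := by
  have one : (1 : ZMod K) ≠ 0 := by
    haveI : Fact (1 < K) := ⟨hK⟩
    exact one_ne_zero
  unfold dg
  congr 1
  · have : F.filter (fun e => e.1 = v) = (({(v, v+(1,0)), (v, v+(0,1))} : Finset _).filter (· ∈ F)) := by
      ext ⟨x, y⟩
      simp only [mem_filter, mem_insert, mem_singleton, Prod.mk.injEq]
      constructor
      · rintro ⟨h1, rfl⟩
        have := hF h1
        rw [mem_torE] at this
        refine ⟨?_, h1⟩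
        simpa using this
      · rintro ⟨⟨rfl, rfl⟩ | ⟨rfl, rfl⟩, h2⟩ <;> exact ⟨h2, rfl⟩
    rw [this, card_filter, sum_pair]
    simp [Prod.ext_iff, one]
  · have : F.filter (fun e => e.2 = v) = (({(v - (1,0), v), (v - (0,1), v)} : Finset _).filter (· ∈ F)) := by
      ext ⟨x, y⟩
      simp only [mem_filter, mem_insert, mem_singleton, Prod.mk.injEq]
      constructor
      · rintro ⟨h1, rfl⟩
        have := hF h1
        rw [mem_torE] at this
        refine ⟨?_, h1⟩
        rcases this with h | h <;> simp at h <;> rw [h] <;> simp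
      · rintro ⟨⟨rfl, rfl⟩ | ⟨rfl, rfl⟩, h2⟩ <;> exact ⟨h2, rfl⟩
    rw [this, card_filter, sum_pair]
    simp [Prod.ext_iff, sub_eq_add_neg, one]
end deg

section recon
def zb (b : Bool) : ZMod 2 := if b then 1 else 0

lemma zb_dec (x : ZMod 2) : zb (decide (x = 1)) = x := by
  revert x; decide

lemma z2two (x : ZMod 2) : x + x = 0 := by revert x; decide

lemma recon (m R : ℕ) (hm : 1 ≤ m) (s : ZMod 2) (H W : ℕ → ℕ → ZMod 2)
    (hH : ∀ j ≤ R, H m j = 0) (hW : ∀ i ≤ m, W i R = 0)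
    (hp : ∀ i ≤ m, ∀ j ≤ R, (H i j + W i j) + ((if i = 0 then 0 else H (i-1) j) + (if j = 0 then 0 else W i (j-1)))
      + (if j = 0 then (if i = 0 then s else 0) + (if i = m then s else 0) else 0) = 0) :
    ∃ c : ℕ → ℕ → ZMod 2, (∀ i ≤ m + 1, c 0 i = if 1 ≤ i ∧ i ≤ m then s else 0) ∧ (∀ i, c (R+1) i = 0) ∧ (∀ j, c j 0 = 0) ∧
      (∀ j ≤ R + 1, c j (m+1) = 0) ∧ (∀ i ≤ m, ∀ j ≤ R, H i j = c j (i+1) + c (j+1) (i+1)) ∧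
      (∀ i ≤ m, ∀ j < R, W i j = c (j+1) i + c (j+1) (i+1)) := by
  set c : ℕ → ℕ → ZMod 2 := fun j i => if j = 0 then (if 1 ≤ i ∧ i ≤ m then s else 0) else
    if j ≤ R then ∑ k ∈ range i, W k (j-1) else 0 with hc
  have c0 : ∀ j, c j 0 = 0 := by intro j; simp [hc]
  have cs : ∀ i ≤ m, ∀ j ≤ R, c (j+1) (i+1) = c (j+1) i + W i j := by
    intro i hi j hj
    rcases Nat.lt_or_ge j R with h | h
    · have h' : j + 1 ≤ R := h
      simp only [hc, Nat.add_one_ne_zero, if_false, h', if_true, sum_range_succ, Nat.add_sub_cancel]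
    · have : j = R := by omega
      subst this
      simp [hc, hW i hi]
  have cs' : ∀ i ≤ m, ∀ j ≤ R, c j (i+1) = c j i + (if j = 0 then (if i = 0 then s else 0) + (if i = m then s else 0) else W i (j-1)) := by
    intro i hi j hj
    rcases Nat.eq_zero_or_pos j with rfl | h
    · simp only [hc, if_true]
      by_cases h0 : i = 0
      · subst h0
        simp [hm, show ¬ 0 = m by omega]
      · by_cases h1 : i = m
        · subst h1; simp [h0, show 1 ≤ i by omega, z2two]
        · simp [h0, h1, show 1 ≤ i by omega, hi, show i + 1 ≤ m by omega]
    · obtain ⟨k, rfl⟩ : ∃ k, j = k + 1 := ⟨j - 1, by omega⟩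
      rw [cs i hi k oO]; simp
  have key : ∀ i ≤ m, ∀ j ≤ R, H i j = c j (i+1) + c (j+1) (i+1) := by
    intro i
    induction i with
    | zero =>
      intro hi j hj
      have h1 := hp 0 hi j hj
      rw [cs' 0 hi j hj, cs 0 hi j hj, c0, c0]
      have h2 := z2two (W 0 j)
      by_cases h0 : j = 0
      · simp only [h0, if_true] at h1 h2 ⊢
        have h3 := z2two ((if (0:ℕ) = 0 then s else 0) + (if 0 = m then s else 0))
        simp only [if_true] at h3
        linear_combination h1 - h2 - h3
      · simp only [h0, if_false, if_true] at h1 h2 ⊢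
        linear_combination h1 - h2 - z2two (W 0 (j-1))
    | succ i ih =>
      intro hi j hj
      have h1 := hp (i+1) hi j hj
      have h4 := ih oO j hj
      simp only [Nat.add_one_ne_zero, if_false, Nat.add_sub_cancel] at h1
      rw [cs' (i+1) hi j hj, cs (i+1) hi j hj]
      have h2 := z2two (W (i+1) j)
      have h5 := z2two (c j (i+1) + c (j+1) (i+1))
      by_cases h0 : j = 0
      · simp only [h0, if_true, Nat.add_one_ne_zero, if_false] at h1 h2 h4 h5 ⊢
        have h3 := z2two (if i + 1 = m then s else 0)
        linear_combination h1 - h2 - h3 - h4 - h5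
      · simp only [h0, if_false] at h1 h2 ⊢
        linear_combination h1 - h2 - z2two (W (i+1) (j-1)) - h4 - h5
  refine ⟨c, fun i _ => by simp [hc], fun i => by simp [hc], c0, ?_, key, fun i hi j hj => ?_⟩
  · intro j
    induction j with
    | zero => intro _; simp [hc]
    | succ j ih =>
      intro hj
      have h1 := key m le_rfl j oO
      rw [hH j oO, ih oO] at h1
      simpa using h1.symm
  · rw [cs i hi j hj.le]; linear_combination - z2two (c (j+1) i)
end recon

section primal
variable {n : ℕ} [NeZero n]

def gp (n : ℕ) [NeZero n] (i j : ℕ) : Fin n × Fin n := (Fin.ofNat n i, Fin.ofNat n j)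

lemma gp_v1 {i : ℕ} (j : ℕ) (h : i < n) : (gp n i j).1.val = i := by simp [gp, Nat.mod_eq_of_lt h]
lemma gp_v2 (i : ℕ) {j : ℕ} (h : j < n) : (gp n i j).2.val = j := by simp [gp, Nat.mod_eq_of_lt h]
lemma gp_eq (p : Fin n × Fin n) : gp n p.1.val p.2.val = p := by simp [gp]

def gE (n : ℕ) : Finset ((Fin n × Fin n) × (Fin n × Fin n)) :=
  univ.filter (fun e => (e.1.1 = e.2.1 ∧ e.1.2.val + 1 = e.2.2.val) ∨ (e.1.2 = e.2.2 ∧ e.1.1.val + 1 = e.2.1.val))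

def sB (n r R : ℕ) : Finset (Fin n × Fin n) :=
  univ.filter (fun p => r < p.1.val ∧ p.1.val ≤ r + R ∧ 1 ≤ p.2.val ∧ p.2.val + 1 < n)

def tB (E : Ed V) (B : Finset V) : Finset (V × V) := E.filter (fun e => e.1 ∈ B ∨ e.2 ∈ B)

variable {K M : ℕ} [NeZero K] [NeZero M]

def pe (n : ℕ) [NeZero n] (r : ℕ) (e : (ZMod K × ZMod M) × (ZMod K × ZMod M)) : (Fin n × Fin n) × (Fin n × Fin n) :=
  if e.2.2 = e.1.2 then (gp n (r + e.1.2.val) (e.1.1.val + 1), gp n (r + e.1.2.val + 1) (e.1.1.val + 1))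
  else (gp n (r + e.1.2.val + 1) e.1.1.val, gp n (r + e.1.2.val + 1) (e.1.1.val + 1))

lemma rE_cases {m R : ℕ} (hm : m + 1 < K) (hR : R + 1 < M) {e : (ZMod K × ZMod M) × (ZMod K × ZMod M)} (he : e ∈ rE K M m R) :
    (∃ i j, i + 1 ≤ m ∧ j ≤ R ∧ e = (pt K M i j, pt K M (i+1) j)) ∨ (∃ i j, i ≤ m ∧ j + 1 ≤ R ∧ e = (pt K M i j, pt K M i (j+1))) := by
  obtain ⟨⟨x, y⟩, ⟨x', y'⟩⟩ := e
  rw [rE, mem_filter, mem_torE, mem_rc, mem_rc] at he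
  obtain ⟨he, ⟨h1, h2⟩, h3, h4⟩ := he
  simp only [Prod.mk_add_mk, Prod.mk.injEq, add_zero] at he h1 h2 h3 h4
  rcases he with ⟨rfl, rfl⟩ | ⟨rfl, rfl⟩
  · left
    rw [val_add_one' oO, if_neg oO] at h3
    exact ⟨x.val, y'.val, h3, h2, by simp [pt]⟩
  · right
    rw [val_add_one' oO, if_neg oO] at h4
    exact ⟨x'.val, y.val, h1, h4, by simp [pt]⟩

lemma rE_hmem {m R i j : ℕ} (hm : m + 1 < K) (hR : R + 1 < M) (hi : i ≤ m) (hj : j ≤ R) :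
    (pt K M i j, pt K M (i+1) j) ∈ rE K M m R ↔ i + 1 ≤ m := by
  rw [rE, mem_filter, mem_torE, mem_rc, mem_rc]
  simp only [pt]
  rw [ZMod.val_cast_of_lt oO, ZMod.val_cast_of_lt oO, ZMod.val_cast_of_lt oO]
  simp; omega

lemma rE_vmem {m R i j : ℕ} (hm : m + 1 < K) (hR : R + 1 < M) (hi : i ≤ m) (hj : j ≤ R) :
    (pt K M i j, pt K M i (j+1)) ∈ rE K M m R ↔ j + 1 ≤ R := by
  rw [rE, mem_filter, mem_torE, mem_rc, mem_rc]
  simp only [pt]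
  rw [ZMod.val_cast_of_lt oO, ZMod.val_cast_of_lt oO, ZMod.val_cast_of_lt oO]
  simp; omega

lemma pe_h (r : ℕ) {m R i j : ℕ} (hm : m + 1 < K) (hR : R + 1 < M) (hi : i ≤ m) (hj : j ≤ R) :
    pe n r (pt K M i j, pt K M (i+1) j) = (gp n (r + j) (i + 1), gp n (r + j + 1) (i + 1)) := by
  simp only [pe, pt]
  rw [ZMod.val_cast_of_lt oO, ZMod.val_cast_of_lt oO]; simp

lemma pe_v (r : ℕ) {m R i j : ℕ} (hm : m + 1 < K) (hR : R + 1 < M) (hi : i ≤ m) (hj : j ≤ R) :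
    pe n r (pt K M i j, pt K M i (j+1)) = (gp n (r + j + 1) i, gp n (r + j + 1) (i + 1)) := by
  haveI : Fact (1 < M) := ⟨by omega⟩
  simp only [pe, pt]
  rw [ZMod.val_cast_of_lt oO, ZMod.val_cast_of_lt oO]; simp

lemma gp_inj {i j i' j' : ℕ} (hi : i < n) (hj : j < n) (hi' : i' < n) (hj' : j' < n) (h : gp n i j = gp n i' j') : i = i' ∧ j = j' := by
  have h1 := congrArg (fun p => p.1.val) h
  have h2 := congrArg (fun p => p.2.val) h
  simp only [gp_v1 _ hi, gp_v1 _ hi', gp_v2 _ hj, gp_v2 _ hj'] at h1 h2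
  exact ⟨h1, h2⟩

lemma mem_sB (r R : ℕ) {i j : ℕ} (hi : i < n) (hj : j < n) : gp n i j ∈ sB n r R ↔ r < i ∧ i ≤ r + R ∧ 1 ≤ j ∧ j + 1 < n := by
  simp only [sB, mem_filter, mem_univ, true_and, gp_v1 _ hi, gp_v2 _ hj]

lemma prod_tB {m R r : ℕ} (hm : m + 1 < K) (hR : R + 1 < M) (hn : n = m + 2) (hr : r + R + 1 < n) (hR1 : 1 ≤ R)
    (f : (Fin n × Fin n) × (Fin n × Fin n) → ℝ) :
    ∏ e ∈ tB (gE n) (sB n r R), f e = ∏ e ∈ rE K M m R, f (pe n r e) := by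
  symm
  refine prod_bij (fun e _ => pe n r e) ?_ ?_ ?_ (fun _ _ => rfl)
  · intro e he
    rcases rE_cases hm hR he with ⟨i, j, hi, hj, rfl⟩ | ⟨i, j, hi, hj, rfl⟩
    · rw [pe_h r hm hR oO hj]
      simp only [tB, gE, mem_filter, mem_univ, true_and, Fin.ext_iff]
      rw [mem_sB _ _ oO oO, mem_sB _ _ oO oO, gp_v1 _ oO, gp_v1 _ oO, gp_v2 _ oO, gp_v2 _ oO]
      omega
    · rw [pe_v r hm hR hi oO]
      simp only [tB, gE, mem_filter, mem_univ, true_and, Fin.ext_iff]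
      rw [mem_sB _ _ oO oO, mem_sB _ _ oO oO, gp_v1 _ oO, gp_v1 _ oO, gp_v2 _ oO, gp_v2 _ oO]
      omega
  · intro e he e' he' h
    rcases rE_cases hm hR he with ⟨i, j, hi, hj, rfl⟩ | ⟨i, j, hi, hj, rfl⟩ <;>
    rcases rE_cases hm hR he' with ⟨i', j', hi', hj', rfl⟩ | ⟨i', j', hi', hj', rfl⟩
    · rw [pe_h r hm hR oO hj, pe_h r hm hR oO hj', Prod.mk.injEq] at h
      have h1 := gp_inj oO oO oO oO h.1
      rw [show i = i' by omega, show j = j' by omega]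
    · rw [pe_h r hm hR oO hj, pe_v r hm hR oO oO, Prod.mk.injEq] at h
      have h1 := gp_inj oO oO oO oO h.1
      have h2 := gp_inj oO oO oO oO h.2
      omega
    · rw [pe_v r hm hR oO oO, pe_h r hm hR oO oO, Prod.mk.injEq] at h
      have h1 := gp_inj oO oO oO oO h.1
      have h2 := gp_inj oO oO oO oO h.2
      omega
    · rw [pe_v r hm hR oO oO, pe_v r hm hR oO oO, Prod.mk.injEq] at h
      have h1 := gp_inj oO oO oO oO h.1
      rw [show i = i' by omega, show j = j' by omega]
  · rintro ⟨p, q⟩ he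
    obtain ⟨a, ha, b, hb⟩ : ∃ a, a < n ∧ ∃ b, b < n ∧ gp n a b = p := ⟨_, p.1.2, _, p.2.2, gp_eq p⟩
    obtain ⟨a', ha', b', hb'⟩ : ∃ a, a < n ∧ ∃ b, b < n ∧ gp n a b = q := ⟨_, q.1.2, _, q.2.2, gp_eq q⟩
    obtain ⟨hb, rfl⟩ := hb
    obtain ⟨hb', rfl⟩ := hb'
    simp only [tB, gE, mem_filter, mem_univ, true_and, Fin.ext_iff] at he
    rw [mem_sB _ _ ha hb, mem_sB _ _ ha' hb', gp_v1 _ ha, gp_v1 _ ha', gp_v2 _ hb, gp_v2 _ hb'] at he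
    obtain ⟨⟨h1, h2⟩ | ⟨h1, h2⟩, h3⟩ := he
    · refine ⟨(pt K M b (a - r - 1), pt K M b ((a - r - 1) + 1)), ?_, ?_⟩
      · rw [rE_vmem hm hR oO oO]; omega
      · rw [pe_v r hm hR oO oO, show r + (a - r - 1) + 1 = a by omega, h2, h1]
    · refine ⟨(pt K M (b - 1) (a - r), pt K M ((b - 1) + 1) (a - r)), ?_, ?_⟩
      · rw [rE_hmem hm hR oO oO]; omega
      · rw [pe_h r hm hR oO oO, show r + (a - r) = a by omega, show b - 1 + 1 = b by omega, h2, h1]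
end primal

section dual
variable {n : ℕ} [NeZero n] {K M : ℕ} [NeZero K] [NeZero M]

lemma val_neg1 (hK : 2 ≤ K) : (-1 : ZMod K).val = K - 1 := by
  obtain ⟨k, rfl⟩ : ∃ k, K = k + 1 := ⟨K - 1, by omega⟩
  exact ZMod.val_neg_one k

lemma pt_sub1 (i j : ℕ) : pt K M (i+1) j - (1,0) = pt K M i j := by simp [pt]
lemma pt_sub2 (i j : ℕ) : pt K M i (j+1) - (0,1) = pt K M i j := by simp [pt]
lemma pt_add1 (i j : ℕ) : pt K M i j + (1,0) = pt K M (i+1) j := by simp [pt]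
lemma pt_add2 (i j : ℕ) : pt K M i j + (0,1) = pt K M i (j+1) := by simp [pt]

lemma dg_pt {m R i j : ℕ} (hm : m + 1 < K) (hR : R + 1 < M) (hi : i ≤ m) (hj : j ≤ R)
    (F : Finset ((ZMod K × ZMod M) × (ZMod K × ZMod M))) (hF : F ⊆ rE K M m R) :
    dg F (pt K M i j) = ((if (pt K M i j, pt K M (i+1) j) ∈ F then 1 else 0) + (if (pt K M i j, pt K M i (j+1)) ∈ F then 1 else 0)) +
      ((if i = 0 then 0 else if (pt K M (i-1) j, pt K M (i-1+1) j) ∈ F then 1 else 0) +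
       (if j = 0 then 0 else if (pt K M i (j-1), pt K M i (j-1+1)) ∈ F then 1 else 0)) := by
  rw [dg_tor oO F (hF.trans (filter_subset _ _)), pt_add1, pt_add2]
  congr 2
  · rcases Nat.eq_zero_or_pos i with rfl | h
    · rw [if_pos rfl, if_neg]
      intro h
      have h := hF h
      rw [rE, mem_filter, mem_rc] at h
      have h2 := h.2.1.1
      simp only [pt, Nat.cast_zero, Prod.mk_sub_mk, zero_sub] at h2
      rw [val_neg1 oO] at h2
      omega
    · obtain ⟨k, rfl⟩ : ∃ k, i = k + 1 := ⟨i - 1, by omega⟩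
      rw [pt_sub1]; simp
  · rcases Nat.eq_zero_or_pos j with rfl | h
    · rw [if_pos rfl, if_neg]
      intro h
      have h := hF h
      rw [rE, mem_filter, mem_rc] at h
      have h2 := h.2.1.2
      simp only [pt, Nat.cast_zero, Prod.mk_sub_mk, zero_sub] at h2
      rw [val_neg1 oO] at h2
      omega
    · obtain ⟨k, rfl⟩ : ∃ k, j = k + 1 := ⟨j - 1, by omega⟩
      rw [pt_sub2]; simp

lemma dg_out {m R : ℕ} (hK : 2 ≤ K) (F : Finset ((ZMod K × ZMod M) × (ZMod K × ZMod M))) (hF : F ⊆ rE K M m R)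
    (v : ZMod K × ZMod M) (hv : v ∉ rc K M m R) : dg F v = 0 := by
  have h1 : ∀ w, (v, w) ∉ F := fun w h => hv (mem_filter.1 (hF h)).2.1
  have h2 : ∀ w, (w, v) ∉ F := fun w h => hv (mem_filter.1 (hF h)).2.2
  rw [dg_tor hK F (hF.trans (filter_subset _ _))]
  simp [h1, h2]

lemma even_z2 (k : ℕ) : Even k ↔ (k : ZMod 2) = 0 := by
  rw [ZMod.natCast_eq_zero_iff, even_iff_two_dvd]

def zp (P : Prop) : ZMod 2 := if P then 1 else 0

lemma zp_eq (P : Prop) [Decidable P] : (if P then 1 else 0 : ZMod 2) = zp P := by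
  by_cases h : P <;> simp [h, zp]

lemma zp_ne (a b : Bool) : zp (a ≠ b) = zb a + zb b := by
  cases a <;> cases b <;> simp [zp, zb, z2two]

def dv (K M : ℕ) [NeZero K] [NeZero M] (m : ℕ) (s : Bool) (v : ZMod K × ZMod M) : ℕ :=
  if s then (if v = pt K M 0 0 then 1 else 0) + (if v = pt K M m 0 then 1 else 0) else 0

lemma pt_inj {m R i j i' j' : ℕ} (hm : m + 1 < K) (hR : R + 1 < M) (hi : i ≤ m) (hj : j ≤ R) (hi' : i' ≤ m) (hj' : j' ≤ R) :
    pt K M i j = pt K M i' j' ↔ i = i' ∧ j = j' := by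
  constructor
  · intro h
    have h1 := congrArg (fun p => p.1.val) h
    have h2 := congrArg (fun p => p.2.val) h
    simp only [pt] at h1 h2
    rw [ZMod.val_cast_of_lt oO, ZMod.val_cast_of_lt oO] at h1 h2
    exact ⟨h1, h2⟩
  · rintro ⟨rfl, rfl⟩; rfl

lemma dv_pt {m R i j : ℕ} (hm : m + 1 < K) (hR : R + 1 < M) (hi : i ≤ m) (hj : j ≤ R) (s : Bool) :
    ((dv K M m s (pt K M i j) : ℕ) : ZMod 2) = if j = 0 then (if i = 0 then zb s else 0) + (if i = m then zb s else 0) else 0 := by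
  unfold dv
  simp only [pt_inj hm hR hi hj (Nat.zero_le m) (Nat.zero_le R), pt_inj hm hR hi hj le_rfl (Nat.zero_le R)]
  cases s
  · simp [zb]
  · by_cases h0 : j = 0 <;> by_cases h1 : i = 0 <;> by_cases h2 : i = m <;> simp [h0, h1, h2, zb]

lemma par_pt {m R i j : ℕ} (hm : m + 1 < K) (hR : R + 1 < M) (hi : i ≤ m) (hj : j ≤ R)
    (F : Finset ((ZMod K × ZMod M) × (ZMod K × ZMod M))) (hF : F ⊆ rE K M m R) (s : Bool) :
    Even (dg F (pt K M i j) + dv K M m s (pt K M i j)) ↔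
    (zp (((pt K M i j, pt K M (i+1) j) ∈ F)) + zp (((pt K M i j, pt K M i (j+1)) ∈ F))) +
      ((if i = 0 then 0 else zp (((pt K M (i-1) j, pt K M (i-1+1) j) ∈ F))) +
       (if j = 0 then 0 else zp (((pt K M i (j-1), pt K M i (j-1+1)) ∈ F)))) +
      (if j = 0 then (if i = 0 then zb s else 0) + (if i = m then zb s else 0) else 0) = 0 := by
  rw [even_z2, dg_pt hm hR hi hj F hF]
  push_cast
  rw [dv_pt hm hR hi hj]
  simp only [zp_eq]

variable {m R r : ℕ}

lemma dual_bij (hm : m + 1 < K) (hR : R + 1 < M) (hn : n = m + 2) (hr : r + R + 1 < n) (hm1 : 1 ≤ m)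
    (s : Bool) (τ : Fin n × Fin n → Bool)
    (hτ : ∀ j ≤ R + 1, ∀ i ≤ m + 1, (j = 0 ∨ j = R + 1 ∨ i = 0 ∨ i = m + 1) → τ (gp n (r + j) i) = (s && decide (j = 0 ∧ 1 ≤ i ∧ i ≤ m)))
    (g : ℕ → ℝ) :
    ∑ σ ∈ univ.filter (fun σ : Fin n × Fin n → Bool => ∀ p, p ∉ sB n r R → σ p = τ p),
      g #((rE K M m R).filter (fun e => σ (pe n r e).1 ≠ σ (pe n r e).2)) =
    ∑ F ∈ (rE K M m R).powerset.filter (fun F => ∀ v, Even (dg F v + dv K M m s v)), g #F := by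
  have bd : ∀ σ : Fin n × Fin n → Bool, (∀ p, p ∉ sB n r R → σ p = τ p) → ∀ j ≤ R + 1, ∀ i ≤ m + 1, (j = 0 ∨ j = R + 1 ∨ i = 0 ∨ i = m + 1) →
      σ (gp n (r + j) i) = (s && decide (j = 0 ∧ 1 ≤ i ∧ i ≤ m)) := by
    intro σ hσ j hj i hi h
    rw [hσ _ (by rw [mem_sB _ _ oO oO]; omega), hτ j hj i hi h]
  have memH : ∀ σ : Fin n × Fin n → Bool, (∀ p, p ∉ sB n r R → σ p = τ p) → ∀ i ≤ m, ∀ j ≤ R,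
      zp (((pt K M i j, pt K M (i+1) j) ∈ (rE K M m R).filter (fun e => σ (pe n r e).1 ≠ σ (pe n r e).2))) =
        zb (σ (gp n (r + j) (i+1))) + zb (σ (gp n (r + (j+1)) (i+1))) := by
    intro σ hσ i hi j hj
    rw [← zp_ne]
    congr 1
    rw [mem_filter, rE_hmem hm hR hi hj, pe_h r hm hR hi hj, eq_iff_iff]
    constructor
    · exact fun h => h.2
    · intro h
      refine ⟨?_, h⟩
      by_contra hc
      apply h
      rw [show i + 1 = m + 1 by omega, bd σ hσ j oO _ le_rfl oO, bd σ hσ (j+1) oO _ le_rfl oO]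
      simp
  have memV : ∀ σ : Fin n × Fin n → Bool, (∀ p, p ∉ sB n r R → σ p = τ p) → ∀ i ≤ m, ∀ j ≤ R,
      zp (((pt K M i j, pt K M i (j+1)) ∈ (rE K M m R).filter (fun e => σ (pe n r e).1 ≠ σ (pe n r e).2))) =
        zb (σ (gp n (r + (j+1)) i)) + zb (σ (gp n (r + (j+1)) (i+1))) := by
    intro σ hσ i hi j hj
    rw [← zp_ne]
    congr 1
    rw [mem_filter, rE_vmem hm hR hi hj, pe_v r hm hR hi hj, eq_iff_iff]
    constructor
    · exact fun h => h.2
    · intro h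
      refine ⟨?_, h⟩
      by_contra hc
      apply h
      rw [show j + 1 = R + 1 by omega, bd σ hσ _ le_rfl i oO oO, bd σ hσ _ le_rfl (i+1) oO oO]
      simp
  refine sum_bij (fun σ _ => (rE K M m R).filter (fun e => σ (pe n r e).1 ≠ σ (pe n r e).2)) ?_ ?_ ?_ (fun _ _ => rfl)
  · intro σ hσ
    rw [mem_filter] at hσ
    rw [mem_filter, mem_powerset]
    refine ⟨filter_subset _ _, fun v => ?_⟩
    by_cases hv : v ∈ rc K M m R
    · rw [mem_rc] at hv
      rw [eq_pt v, par_pt hm hR hv.1 hv.2 _ (filter_subset _ _)]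
      set i := v.1.val
      set j := v.2.val
      obtain ⟨hi, hj⟩ := hv
      rw [memH σ hσ.2 i hi j hj, memV σ hσ.2 i hi j hj, memH σ hσ.2 (i-1) oO j hj, memV σ hσ.2 i hi (j-1) oO]
      have q1 : (if i = 0 then 0 else zb (σ (gp n (r + j) (i-1+1))) + zb (σ (gp n (r + (j+1)) (i-1+1)))) =
          zb (σ (gp n (r + j) i)) + zb (σ (gp n (r + (j+1)) i)) := by
        split_ifs with h
        · rw [bd σ hσ.2 j oO i oO oO, bd σ hσ.2 (j+1) oO i oO oO]
          simp [h, zb]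
        · rw [show i - 1 + 1 = i by omega]
      have q2 : (if j = 0 then 0 else zb (σ (gp n (r + (j-1+1)) i)) + zb (σ (gp n (r + (j-1+1)) (i+1)))) +
          (if j = 0 then (if i = 0 then zb s else 0) + (if i = m then zb s else 0) else 0) =
          zb (σ (gp n (r + j) i)) + zb (σ (gp n (r + j) (i+1))) := by
        by_cases h : j = 0
        · rw [bd σ hσ.2 j oO i oO oO, bd σ hσ.2 j oO (i+1) oO oO]
          by_cases h1 : i = 0
          · simp [h, h1, hm1, show ¬ 0 = m by omega, zb]
          · by_cases h2 : i = m
            · simp [h, h2, hm1, show ¬ m = 0 by omega, zb]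
            · simp [h, h1, h2, hi, show 1 ≤ i by omega, show i + 1 ≤ m by omega, z2two]
        · simp [h, show j - 1 + 1 = j by omega]
      rw [q1]
      linear_combination q2 + z2two (zb (σ (gp n (r + j) i))) + z2two (zb (σ (gp n (r + j) (i+1)))) + z2two (zb (σ (gp n (r + (j+1)) i)))
        + z2two (zb (σ (gp n (r + (j+1)) (i+1))))
    · rw [dg_out oO _ (filter_subset _ _) v hv]
      have : dv K M m s v = 0 := by
        have v1 : ¬ v = pt K M 0 0 := by rintro rfl; exact hv (pt_mem_rc _ _ _ _ oO oO oO oO)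
        have v2 : ¬ v = pt K M m 0 := by rintro rfl; exact hv (pt_mem_rc _ _ _ _ oO oO oO oO)
        simp [dv, v1, v2]
      rw [this]; exact Even.zero
  · intro σ hσ σ' hσ' h
    rw [mem_filter] at hσ hσ'
    have key : ∀ i ≤ m + 1, ∀ j < R, zb (σ (gp n (r + (j+1)) i)) = zb (σ' (gp n (r + (j+1)) i)) := by
      intro i
      induction i with
      | zero =>
        intro _ j hj
        rw [bd σ hσ.2 (j+1) oO 0 oO oO, bd σ' hσ'.2 (j+1) oO 0 oO oO]
      | succ i ih =>
        intro hi j hj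
        have h1 := memV σ hσ.2 i oO j oO
        have h2 := memV σ' hσ'.2 i oO j oO
        rw [h, h2, ih oO j hj] at h1
        exact (add_left_cancel h1).symm
    have zi : ∀ a b : Bool, zb a = zb b → a = b := by decide
    funext p
    by_cases hp : p ∈ sB n r R
    · have hp' := hp
      simp only [sB, mem_filter, mem_univ, true_and] at hp'
      have h1 := key p.2.val oO (p.1.val - r - 1) oO
      rw [show r + (p.1.val - r - 1 + 1) = p.1.val by omega, gp_eq] at h1
      exact zi _ _ h1
    · rw [hσ.2 p hp, hσ'.2 p hp]
  · intro F hF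
    rw [mem_filter, mem_powerset] at hF
    obtain ⟨hF, hev⟩ := hF
    obtain ⟨c, hc0, hcR, hcl, hcr, hcH, hcV⟩ := recon m R hm1 (zb s) (fun i j => zp (((pt K M i j, pt K M (i+1) j) ∈ F)))
      (fun i j => zp (((pt K M i j, pt K M i (j+1)) ∈ F)))
      (by
        intro j hj
        have : (pt K M m j, pt K M (m+1) j) ∉ F := fun h => by
          have := (rE_hmem hm hR le_rfl hj).1 (hF h); omega
        simp [this, zp])
      (by
        intro i hi
        have : (pt K M i R, pt K M i (R+1)) ∉ F := fun h => by
          have := (rE_vmem hm hR hi le_rfl).1 (hF h); omega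
        simp [this, zp])
      (fun i hi j hj => (par_pt hm hR hi hj F hF s).1 (hev _))
    set σ : Fin n × Fin n → Bool := fun p => if p ∈ sB n r R then decide (c (p.1.val - r) p.2.val = 1) else τ p with hσ
    have ag : ∀ p, p ∉ sB n r R → σ p = τ p := fun p hp => by simp [hσ, hp]
    have val : ∀ j ≤ R + 1, ∀ i ≤ m + 1, zb (σ (gp n (r + j) i)) = c j i := by
      intro j hj i hi
      by_cases hp : gp n (r + j) i ∈ sB n r R
      · have e : σ (gp n (r + j) i) = decide (c j i = 1) := by
          simp only [hσ, hp, if_true]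
          rw [gp_v1 _ oO, gp_v2 _ oO]; simp
        rw [e, zb_dec]
      · have hp' := hp
        rw [mem_sB _ _ oO oO] at hp'
        rw [bd σ ag j hj i hi oO]
        by_cases h0 : j = 0
        · subst h0
          rw [hc0 i hi]
          by_cases h1 : 1 ≤ i ∧ i ≤ m
          · simp [h1]
          · simp only [h1, and_false, decide_false, Bool.and_false, if_false]; rfl
        · have : zb (s && decide (j = 0 ∧ 1 ≤ i ∧ i ≤ m)) = 0 := by simp [h0, zb]
          rw [this]
          have : j = R + 1 ∨ i = 0 ∨ i = m + 1 := by omega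
          rcases this with rfl | rfl | rfl
          · rw [hcR]
          · rw [hcl]
          · rw [hcr j hj]
    refine ⟨σ, by rw [mem_filter]; exact ⟨mem_univ _, ag⟩, ?_⟩
    have zd : ∀ P Q : Prop, zp P = zp Q → (P ↔ Q) := by
      intro P Q; by_cases hP : P <;> by_cases hQ : Q <;> simp [hP, hQ, zp]
    ext e
    by_cases he : e ∈ rE K M m R
    · rcases rE_cases hm hR he with ⟨i, j, hi, hj, rfl⟩ | ⟨i, j, hi, hj, rfl⟩
      · apply zd
        rw [memH σ ag i oO j hj, val j oO _ oO, val (j+1) oO _ oO, ← hcH i oO j hj]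
      · apply zd
        rw [memV σ ag i oO j oO, val (j+1) oO _ oO, val (j+1) oO _ oO, ← hcV i oO j oO]
    · exact ⟨fun h => absurd (mem_filter.1 h).1 he, fun h => absurd (hF h) he⟩

theorem dual (β : ℝ) (hm : m + 1 < K) (hR : R + 1 < M) (hn : n = m + 2) (hr : r + R + 1 < n) (hm1 : 1 ≤ m) (hR1 : 1 ≤ R)
    (s : Bool) (τ : Fin n × Fin n → Bool)
    (hτ : ∀ j ≤ R + 1, ∀ i ≤ m + 1, (j = 0 ∨ j = R + 1 ∨ i = 0 ∨ i = m + 1) → τ (gp n (r + j) i) = (s && decide (j = 0 ∧ 1 ≤ i ∧ i ≤ m))) :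
    (∑ σ ∈ univ.filter (fun σ : Fin n × Fin n → Bool => ∀ p, p ∉ sB n r R → σ p = τ p),
      ∏ e ∈ tB (gE n) (sB n r R), exp (β * (spinVal (σ e.1) * spinVal (σ e.2)))) * 2 ^ (Fintype.card (ZMod K × ZMod M)) =
    exp β ^ #(rE K M m R) * bS (exp (-(2 * β))) (rE K M m R) (fun η => if s then spinVal (η (pt K M 0 0)) * spinVal (η (pt K M m 0)) else 1) := by
  have h1 : ∀ σ : Fin n × Fin n → Bool, ∏ e ∈ tB (gE n) (sB n r R), exp (β * (spinVal (σ e.1) * spinVal (σ e.2))) =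
      exp β ^ #(rE K M m R) * exp (-(2 * β)) ^ #((rE K M m R).filter (fun e => σ (pe n r e).1 ≠ σ (pe n r e).2)) := by
    intro σ
    rw [prod_tB hm hR hn hr hR1]
    have : ∀ e, exp (β * (spinVal (σ (pe n r e).1) * spinVal (σ (pe n r e).2))) =
      exp β * (if σ (pe n r (K := K) (M := M) e).1 ≠ σ (pe n r e).2 then exp (-(2 * β)) else 1) := by
      intro e
      cases σ (pe n r e).1 <;> cases σ (pe n r e).2 <;> simp [spinVal, ← exp_add] <;> ring
    simp only [this]
    rw [prod_mul_distrib, prod_const, ← prod_filter, prod_const]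
  have h2 : (fun η : ZMod K × ZMod M → Bool => if s then spinVal (η (pt K M 0 0)) * spinVal (η (pt K M m 0)) else 1) =
      fun η => ∏ v, spinVal (η v) ^ dv K M m s v := by
    funext η
    cases s
    · simp [dv]
    · simp only [dv, if_true, pow_add, prod_mul_distrib]
      congr 1 <;> (rw [Finset.prod_eq_single_of_mem _ (mem_univ _) (fun v _ hv => by rw [if_neg hv, pow_zero])]; simp)
  simp only [h1, ← mul_sum]
  rw [dual_bij hm hR hn hr hm1 s τ hτ (fun k => exp (-(2 * β)) ^ k), h2, ht_exp]
  ring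
end dual

section cond
variable {U : Type*} [Fintype U] [DecidableEq U]

structure LW (w : Fn U) : Prop where
  pos : ∀ σ, 0 < w σ
  lat : ∀ σ τ, w σ * w τ ≤ w (σ ⊓ τ) * w (σ ⊔ τ)

def ag (B : Finset U) (τ : U → Bool) : Finset (U → Bool) := univ.filter (fun σ => ∀ p, p ∉ B → σ p = τ p)

lemma mem_ag {B : Finset U} {τ σ : U → Bool} : σ ∈ ag B τ ↔ ∀ p, p ∉ B → σ p = τ p := by simp [ag]

lemma ag_self (B : Finset U) (τ : U → Bool) : τ ∈ ag B τ := mem_ag.2 fun _ _ => rfl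

lemma ag_congr {B : Finset U} {τ τ' : U → Bool} (h : ∀ p, p ∉ B → τ p = τ' p) : ag B τ = ag B τ' := by
  ext σ; rw [mem_ag, mem_ag]
  exact forall₂_congr fun p hp => by rw [h p hp]

lemma ag_symm {B : Finset U} {τ σ : U → Bool} (h : σ ∈ ag B τ) : ag B σ = ag B τ := ag_congr (mem_ag.1 h)

lemma ag_mono {B C : Finset U} (h : C ⊆ B) {τ σ : U → Bool} (hs : σ ∈ ag C τ) : σ ∈ ag B τ :=
  mem_ag.2 fun p hp => mem_ag.1 hs p fun hc => hp (h hc)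

variable {w : Fn U}

def ZF (w : Fn U) (B : Finset U) (F : Fn U) (τ : U → Bool) : ℝ := ∑ σ ∈ ag B τ, w σ * F σ
def ZZ (w : Fn U) (B : Finset U) (τ : U → Bool) : ℝ := ∑ σ ∈ ag B τ, w σ
def Pj (w : Fn U) (B : Finset U) (F : Fn U) (τ : U → Bool) : ℝ := ZF w B F τ / ZZ w B τ

lemma ZZ_pos (hw : LW w) (B : Finset U) (τ : U → Bool) : 0 < ZZ w B τ :=
  sum_pos (fun σ _ => hw.pos σ) ⟨τ, ag_self B τ⟩

lemma Pj_congr {B : Finset U} {τ τ' : U → Bool} (h : ∀ p, p ∉ B → τ p = τ' p) (F : Fn U) : Pj w B F τ = Pj w B F τ' := by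
  simp only [Pj, ZF, ZZ, ag_congr h]

lemma Pj_mono' (hw : LW w) {B : Finset U} {F G : Fn U} {τ : U → Bool} (h : ∀ σ ∈ ag B τ, F σ ≤ G σ) : Pj w B F τ ≤ Pj w B G τ :=
  div_le_div_of_nonneg_right (sum_le_sum fun σ hσ => mll (h σ hσ) (hw.pos σ).le) (ZZ_pos hw B τ).le

lemma Pj_mono (hw : LW w) (B : Finset U) {F G : Fn U} (h : F ≤ G) : Pj w B F ≤ Pj w B G :=
  fun _ => Pj_mono' hw fun σ _ => h σ

lemma Pj_add (B : Finset U) (F G : Fn U) : Pj w B (F + G) = Pj w B F + Pj w B G := by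
  funext τ; simp only [Pj, ZF, Pi.add_apply, mul_add, sum_add_distrib, add_div]

lemma Pj_smul (B : Finset U) (c : ℝ) (F : Fn U) : Pj w B (c • F) = c • Pj w B F := by
  funext τ; simp only [Pj, ZF, Pi.smul_apply, smul_eq_mul]
  rw [← mul_div_assoc, mul_sum]; congr 1; exact sum_congr rfl fun _ _ => by ring

lemma Pj_pull (hw : LW w) {B : Finset U} {G F : Fn U} {τ : U → Bool} (h : ∀ σ ∈ ag B τ, G σ = G τ) :
    Pj w B (G * F) τ = G τ * Pj w B F τ := by
  simp only [Pj, ZF, Pi.mul_apply]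
  rw [← mul_div_assoc, mul_sum]; congr 1
  exact sum_congr rfl fun σ hσ => by rw [h σ hσ]; ring

lemma Pj_one (hw : LW w) (B : Finset U) : Pj w B 1 = 1 := by
  funext τ; simp only [Pj, ZF, Pi.one_apply, mul_one]
  exact div_self (ZZ_pos hw B τ).ne'

lemma Pj_fix (hw : LW w) {B : Finset U} {G : Fn U} {τ : U → Bool} (h : ∀ σ ∈ ag B τ, G σ = G τ) : Pj w B G τ = G τ := by
  have := Pj_pull hw (F := 1) h
  rwa [mul_one, Pj_one hw, Pi.one_apply, mul_one] at this

lemma Pj_adj (hw : LW w) {B C : Finset U} (hCB : C ⊆ B) (g F : Fn U) (τ : U → Bool) :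
    Pj w B (g * Pj w C F) τ = Pj w B (Pj w C g * F) τ := by
  unfold Pj
  congr 1
  simp only [ZF, Pi.mul_apply]
  have h1 : ∀ σ ∈ ag B τ, ∀ f : (U → Bool) → ℝ, ∑ σ' ∈ ag C σ, f σ' = ∑ σ' ∈ ag B τ, if σ' ∈ ag C σ then f σ' else 0 := by
    intro σ hσ f
    rw [← sum_filter]
    refine sum_congr ?_ fun _ _ => rfl
    ext σ'
    rw [mem_filter]
    refine ⟨fun h => ⟨?_, h⟩, fun h => h.2⟩
    rw [← ag_symm hσ]; exact ag_mono hCB h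
  have h2 : ∀ σ ∈ ag B τ, w σ * (g σ * ((∑ σ' ∈ ag C σ, w σ' * F σ') / ZZ w C σ)) =
      ∑ σ' ∈ ag B τ, if σ' ∈ ag C σ then w σ * g σ * (w σ' * F σ') / ZZ w C σ else 0 := by
    intro σ hσ
    rw [← h1 σ hσ, ← sum_div, ← mul_sum]; ring
  have h3 : ∀ σ ∈ ag B τ, w σ * ((∑ σ' ∈ ag C σ, w σ' * g σ') / ZZ w C σ * F σ) =
      ∑ σ' ∈ ag B τ, if σ' ∈ ag C σ then w σ' * g σ' * (w σ * F σ) / ZZ w C σ else 0 := by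
    intro σ hσ
    rw [← h1 σ hσ, ← sum_div, ← sum_mul]; ring
  rw [sum_congr rfl h2, sum_congr rfl h3, sum_comm]
  refine sum_congr rfl fun σ _ => sum_congr rfl fun σ' _ => ?_
  by_cases h : σ ∈ ag C σ'
  · have e := ag_symm h
    have h' : σ' ∈ ag C σ := by rw [e]; exact ag_self _ _
    rw [if_pos h, if_pos h']
    simp only [ZZ, e]
  · have h' : ¬ σ' ∈ ag C σ := fun hh => h (by rw [ag_symm hh]; exact ag_self _ _)
    rw [if_neg h, if_neg h']

lemma Pj_tower (hw : LW w) {B C : Finset U} (hCB : C ⊆ B) (F : Fn U) : Pj w B (Pj w C F) = Pj w B F := by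
  funext τ
  have := Pj_adj hw hCB 1 F τ
  rwa [Pj_one hw, one_mul, one_mul] at this

lemma Pj_sub (B : Finset U) (F G : Fn U) : Pj w B (F - G) = Pj w B F - Pj w B G := by
  rw [sub_eq_add_neg, Pj_add, ← neg_one_smul ℝ G, Pj_smul, neg_one_smul, sub_eq_add_neg]

lemma Pj_const (hw : LW w) (B : Finset U) (c : ℝ) : Pj w B (fun _ => c) = fun _ => c := by
  funext τ; exact Pj_fix hw fun _ _ => rfl

lemma Pj_idem (hw : LW w) {B C : Finset U} (hCB : C ⊆ B) (F : Fn U) : Pj w C (Pj w B F) = Pj w B F := by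
  funext τ
  refine Pj_fix hw fun σ hσ => Pj_congr (fun p hp => mem_ag.1 hσ p fun hc => hp (hCB hc)) F

lemma ff (hw : LW w) (B : Finset U) (τ1 τ2 τ3 τ4 : U → Bool) (h3 : ∀ p, p ∉ B → τ3 p = (τ1 ⊓ τ2) p) (h4 : ∀ p, p ∉ B → τ4 p = (τ1 ⊔ τ2) p)
    (f1 f2 f3 f4 : Fn U) (p1 : 0 ≤ f1) (p2 : 0 ≤ f2) (p3 : 0 ≤ f3) (p4 : 0 ≤ f4)
    (h : ∀ a b, f1 a * f2 b ≤ f3 (a ⊓ b) * f4 (a ⊔ b)) :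
    ZF w B f1 τ1 * ZF w B f2 τ2 ≤ ZF w B f3 τ3 * ZF w B f4 τ4 := by
  have e : ∀ (f : Fn U) τ, ZF w B f τ = ∑ σ, if σ ∈ ag B τ then w σ * f σ else 0 := by
    intro f τ; rw [ZF, sum_ite_mem, univ_inter]
  have pp : ∀ (f : Fn U) τ, 0 ≤ f → (0 : Fn U) ≤ fun σ => if σ ∈ ag B τ then w σ * f σ else 0 := by
    intro f τ hf σ
    show (0:ℝ) ≤ if σ ∈ ag B τ then w σ * f σ else 0
    split_ifs
    · exact mul_nonneg (hw.pos σ).le (hf σ)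
    · exact le_rfl
  simp only [e]
  refine four_functions_theorem_univ _ _ _ _ (pp f1 τ1 p1) (pp f2 τ2 p2) (pp f3 τ3 p3) (pp f4 τ4 p4) fun a b => ?_
  by_cases ha : a ∈ ag B τ1
  · by_cases hb : b ∈ ag B τ2
    · have hi : a ⊓ b ∈ ag B τ3 := mem_ag.2 fun p hp => by
        rw [h3 p hp, Pi.inf_apply, Pi.inf_apply, mem_ag.1 ha p hp, mem_ag.1 hb p hp]
      have hs : a ⊔ b ∈ ag B τ4 := mem_ag.2 fun p hp => by
        rw [h4 p hp, Pi.sup_apply, Pi.sup_apply, mem_ag.1 ha p hp, mem_ag.1 hb p hp]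
      rw [if_pos ha, if_pos hb, if_pos hi, if_pos hs]
      calc _ = (w a * w b) * (f1 a * f2 b) := by ring
        _ ≤ (w (a ⊓ b) * w (a ⊔ b)) * (f3 (a ⊓ b) * f4 (a ⊔ b)) :=
          mul_le_mul (hw.lat a b) (h a b) (mul_nonneg (p1 a) (p2 b)) (mul_nonneg (hw.pos _).le (hw.pos _).le)
        _ = _ := by ring
    · rw [if_neg hb, mul_zero]; exact mul_nonneg (pp f3 τ3 p3 _) (pp f4 τ4 p4 _)
  · rw [if_neg ha, zero_mul]; exact mul_nonneg (pp f3 τ3 p3 _) (pp f4 τ4 p4 _)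

lemma ZF_one (B : Finset U) (τ : U → Bool) : ZF w B 1 τ = ZZ w B τ := by simp [ZF, ZZ]

lemma ZZ_lat (hw : LW w) (B : Finset U) (τ1 τ2 τ3 τ4 : U → Bool) (h3 : ∀ p, p ∉ B → τ3 p = (τ1 ⊓ τ2) p) (h4 : ∀ p, p ∉ B → τ4 p = (τ1 ⊔ τ2) p) :
    ZZ w B τ1 * ZZ w B τ2 ≤ ZZ w B τ3 * ZZ w B τ4 := by
  simp only [← ZF_one]
  exact ff hw B τ1 τ2 τ3 τ4 h3 h4 1 1 1 1 zero_le_one zero_le_one zero_le_one zero_le_one fun _ _ => le_rfl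

lemma shift_fn (F : Fn U) (hF : Monotone F) : ∃ (c : ℝ) (F' : Fn U), 0 ≤ F' ∧ Monotone F' ∧ F = F' + fun _ => c := by
  refine ⟨F ⊥, fun σ => F σ - F ⊥, fun σ => sub_nonneg.2 (hF bot_le), fun a b h => sub_le_sub_right (hF h) _, ?_⟩
  funext σ; simp

lemma Pj_monotone (hw : LW w) (B : Finset U) {F : Fn U} (hF : Monotone F) : Monotone (Pj w B F) := by
  obtain ⟨c, F', h0, hm, rfl⟩ := shift_fn F hF
  rw [Pj_add, Pj_const hw]
  intro τ τ' h
  refine add_le_add_left (?_ : Pj w B F' τ ≤ Pj w B F' τ') c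
  unfold Pj
  rw [div_le_div_iff₀ (ZZ_pos hw B τ) (ZZ_pos hw B τ'), ← ZF_one, ← ZF_one, mul_comm (ZF w B F' τ')]
  refine ff hw B τ τ' τ τ' (fun p _ => ?_) (fun p _ => ?_) F' 1 1 F' h0 zero_le_one zero_le_one h0 fun a b => ?_
  · rw [inf_eq_left.2 h]
  · rw [sup_eq_right.2 h]
  · simpa using hm le_sup_left

lemma Pj_fkg (hw : LW w) (B : Finset U) {g F : Fn U} (hg : Monotone g) (hF : Monotone F) :
    Pj w B g * Pj w B F ≤ Pj w B (g * F) := by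
  obtain ⟨c, F', h0, hm, rfl⟩ := shift_fn F hF
  obtain ⟨d, g', k0, km, rfl⟩ := shift_fn g hg
  have base : ∀ τ, Pj w B g' τ * Pj w B F' τ ≤ Pj w B (g' * F') τ := by
    intro τ
    unfold Pj
    rw [div_mul_div_comm, div_le_div_iff₀ (mul_pos (ZZ_pos hw B τ) (ZZ_pos hw B τ)) (ZZ_pos hw B τ), ← mul_assoc]
    refine mlr ?_ (ZZ_pos hw B τ).le
    rw [← ZF_one, mul_comm (ZF w B (g' * F') τ)]
    refine ff hw B τ τ τ τ (fun p _ => by simp) (fun p _ => by simp) g' F' 1 (g' * F') k0 h0 zero_le_one (mul_nonneg k0 h0) fun a b => ?_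
    simp only [Pi.one_apply, one_mul, Pi.mul_apply]
    exact mul_le_mul (km le_sup_left) (hm le_sup_right) (h0 _) (k0 _)
  intro τ
  have e : (g' + fun _ => d) * (F' + fun _ => c) = g' * F' + c • g' + d • F' + fun _ => d * c := by
    funext σ; simp; ring
  rw [e, Pj_add, Pj_add, Pj_add, Pj_add, Pj_add, Pj_smul, Pj_smul, Pj_const hw, Pj_const hw, Pj_const hw]
  simp only [Pi.mul_apply, Pi.add_apply, Pi.smul_apply, smul_eq_mul]
  linarith [base τ]
end cond

section cens
variable {U : Type*} [Fintype U] [DecidableEq U] {w : Fn U}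

def Kop (w : Fn U) (A : Finset U) (v : U) (F : Fn U) (σ : U → Bool) : ℝ :=
  if v ∈ A then F (Function.update σ v false) else Pj w {v} F σ

lemma Kop_add (A : Finset U) (v : U) (F G : Fn U) : Kop w A v (F + G) = Kop w A v F + Kop w A v G := by
  funext σ; simp only [Kop, Pi.add_apply, Pj_add]; split_ifs <;> rfl

lemma Kop_smul (A : Finset U) (v : U) (c : ℝ) (F : Fn U) : Kop w A v (c • F) = c • Kop w A v F := by
  funext σ; simp only [Kop, Pi.smul_apply, Pj_smul]; split_ifs <;> rfl

lemma Kop_sub (A : Finset U) (v : U) (F G : Fn U) : Kop w A v (F - G) = Kop w A v F - Kop w A v G := by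
  funext σ; simp only [Kop, Pi.sub_apply, Pj_sub]; split_ifs <;> rfl

lemma Kop_const (hw : LW w) (A : Finset U) (v : U) (c : ℝ) : Kop w A v (fun _ => c) = fun _ => c := by
  funext σ; simp only [Kop, Pj_const hw]; split_ifs <;> rfl

lemma Kop_mono (hw : LW w) (A : Finset U) (v : U) {F G : Fn U} (h : F ≤ G) : Kop w A v F ≤ Kop w A v G := by
  intro σ; simp only [Kop]; split_ifs
  · exact h _
  · exact Pj_mono hw _ h σ

lemma Kop_le (hw : LW w) (A : Finset U) (v : U) {F : Fn U} {c : ℝ} (h : ∀ σ, F σ ≤ c) (σ : U → Bool) : Kop w A v F σ ≤ c := by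
  have := Kop_mono hw A v (F := F) (G := fun _ => c) h σ
  rwa [Kop_const hw] at this

lemma le_Kop (hw : LW w) (A : Finset U) (v : U) {F : Fn U} {c : ℝ} (h : ∀ σ, c ≤ F σ) (σ : U → Bool) : c ≤ Kop w A v F σ := by
  have := Kop_mono hw A v (F := fun _ => c) (G := F) h σ
  rwa [Kop_const hw] at this

lemma Kop_monotone (hw : LW w) (A : Finset U) (v : U) {F : Fn U} (h : Monotone F) : Monotone (Kop w A v F) := by
  intro σ τ hs; simp only [Kop]; split_ifs
  · refine h fun u => ?_
    by_cases hu : u = v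
    · subst hu; simp
    · simpa [Function.update_of_ne hu] using hs u
  · exact Pj_monotone hw _ h hs

def pE (w : Fn U) (A : Finset U) (F : Fn U) : ℝ := Pj w Aᶜ F ⊥

lemma supp_A {A : Finset U} {σ : U → Bool} (h : σ ∈ ag Aᶜ ⊥) {v : U} (hv : v ∈ A) : σ v = false :=
  mem_ag.1 h v (by simpa using hv)

lemma pE_add (A : Finset U) (F G : Fn U) : pE w A (F + G) = pE w A F + pE w A G := by
  simp [pE, Pj_add]

lemma pE_smul (A : Finset U) (c : ℝ) (F : Fn U) : pE w A (c • F) = c * pE w A F := by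
  simp [pE, Pj_smul]

lemma pE_congr (hw : LW w) (A : Finset U) {F G : Fn U} (h : ∀ σ ∈ ag Aᶜ ⊥, F σ = G σ) : pE w A F = pE w A G :=
  le_antisymm (Pj_mono' hw fun σ hσ => (h σ hσ).le) (Pj_mono' hw fun σ hσ => (h σ hσ).ge)

lemma Kop_adj (hw : LW w) (A : Finset U) (v : U) (g F : Fn U) : pE w A (g * Kop w A v F) = pE w A (Kop w A v g * F) := by
  by_cases hv : v ∈ A
  · refine pE_congr hw A fun σ hσ => ?_
    have : Function.update σ v false = σ := by rw [← supp_A hσ hv]; simp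
    simp [Kop, hv, this]
  · have e : ∀ G, Kop w A v G = Pj w {v} G := fun G => by funext σ; simp [Kop, hv]
    rw [e, e]
    exact Pj_adj hw (by simpa using hv) g F ⊥

def pre (w : Fn U) (A : Finset U) (F G : Fn U) : Prop := ∀ g, Monotone g → pE w A (g * F) ≤ pE w A (g * G)

lemma pre.trans {A : Finset U} {F G H : Fn U} (h : pre w A F G) (h' : pre w A G H) : pre w A F H := fun g hg => (h g hg).trans (h' g hg)
lemma pre.refl' (A : Finset U) (F : Fn U) : pre w A F F := fun _ _ => le_rfl
lemma pre.add {A : Finset U} {F G F' G' : Fn U} (h : pre w A F G) (h' : pre w A F' G') : pre w A (F + F') (G + G') := fun g hg => by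
  rw [mul_add, mul_add, pE_add, pE_add]; exact add_le_add (h g hg) (h' g hg)
lemma pre.smul {A : Finset U} {F G : Fn U} {c : ℝ} (hc : 0 ≤ c) (h : pre w A F G) : pre w A (c • F) (c • G) := fun g hg => by
  rw [mul_smul_comm, mul_smul_comm, pE_smul, pE_smul]; exact mll (h g hg) hc

lemma Kop_pre (hw : LW w) (A : Finset U) (v : U) {F : Fn U} (hF : Monotone F) : pre w A (Kop w A v F) F := by
  intro g hg
  by_cases hv : v ∈ A
  · refine (pE_congr hw A fun σ hσ => ?_).le
    have : Function.update σ v false = σ := by rw [← supp_A hσ hv]; simp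
    simp [Kop, hv, this]
  · have e : ∀ G, Kop w A v G = Pj w {v} G := fun G => by funext σ; simp [Kop, hv]
    have hs : ({v} : Finset U) ⊆ Aᶜ := by simpa using hv
    rw [e]
    unfold pE
    rw [← Pj_tower hw hs, ← Pj_tower hw hs (g * F)]
    refine Pj_mono hw _ (fun σ => ?_) ⊥
    refine le_trans (le_of_eq ?_) (Pj_fkg hw _ hg hF σ)
    rw [mul_comm g, Pj_pull hw, Pi.mul_apply, mul_comm]
    intro τ hτ
    exact Pj_congr (mem_ag.1 hτ) F

lemma pre_Kop (hw : LW w) (A : Finset U) (v : U) {F G : Fn U} (h : pre w A F G) : pre w A (Kop w A v F) (Kop w A v G) := by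
  intro g hg
  rw [Kop_adj hw, Kop_adj hw]
  exact h _ (Kop_monotone hw A v hg)

def Pop (w : Fn U) (A : Finset U) (F : Fn U) : (U → Bool) → ℝ :=
  (Fintype.card U : ℝ)⁻¹ • ∑ v : U, Kop w A v F

lemma pre_sum {A : Finset U} {ι : Type*} (s : Finset ι) {F G : ι → (U → Bool) → ℝ} (h : ∀ i ∈ s, pre w A (F i) (G i)) : pre w A (∑ i ∈ s, F i) (∑ i ∈ s, G i) := by
  induction s using Finset.induction_on with
  | empty => simpa using pre.refl' A 0
  | insert a s ha ih =>
    rw [sum_insert ha, sum_insert ha]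
    exact (h a (mem_insert_self _ _)).add (ih fun i hi => h i (mem_insert_of_mem hi))

lemma pre_Pop (hw : LW w) (A : Finset U) {F G : Fn U} (h : pre w A F G) : pre w A (Pop w A F) (Pop w A G) :=
  (pre_sum _ fun v _ => pre_Kop hw A v h).smul pP

lemma Pop_add (A : Finset U) (F G : Fn U) : Pop w A (F + G) = Pop w A F + Pop w A G := by
  simp only [Pop, Kop_add, sum_add_distrib, smul_add]

lemma Pop_smul (A : Finset U) (c : ℝ) (F : Fn U) : Pop w A (c • F) = c • Pop w A F := by
  simp only [Pop, Kop_smul, ← smul_sum, smul_comm c]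

lemma Pop_const [Nonempty U] (hw : LW w) (A : Finset U) (c : ℝ) : Pop w A (fun _ => c) = fun _ => c := by
  funext σ
  simp only [Pop, Kop_const hw, Pi.smul_apply, smul_eq_mul, sum_const, card_univ]
  have : (Fintype.card U : ℝ) ≠ 0 := by exact_mod_cast Fintype.card_ne_zero
  rw [nsmul_eq_mul, inv_mul_cancel_left₀ this]

lemma Pop_mono (hw : LW w) (A : Finset U) {F G : Fn U} (h : F ≤ G) : Pop w A F ≤ Pop w A G :=
  smul_le_smul_of_nonneg_left (sum_le_sum fun v _ => Kop_mono hw A v h) pP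

lemma Pop_monotone (hw : LW w) (A : Finset U) {F : Fn U} (h : Monotone F) : Monotone (Pop w A F) := by
  intro σ τ hs
  simp only [Pop, Pi.smul_apply, Finset.sum_apply, smul_eq_mul]
  exact mll (sum_le_sum fun v _ => Kop_monotone hw A v h hs) pP

lemma iter_mono (hw : LW w) (A : Finset U) {F G : Fn U} (h : F ≤ G) (T : ℕ) : (Pop w A)^[T] F ≤ (Pop w A)^[T] G := by
  induction T with
  | zero => exact h
  | succ T ih => rw [Function.iterate_succ_apply', Function.iterate_succ_apply']; exact Pop_mono hw A ih

lemma iter_monotone (hw : LW w) (A : Finset U) {F : Fn U} (h : Monotone F) (T : ℕ) : Monotone ((Pop w A)^[T] F) := by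
  induction T with
  | zero => exact h
  | succ T ih => rw [Function.iterate_succ_apply']; exact Pop_monotone hw A ih

lemma iter_const [Nonempty U] (hw : LW w) (A : Finset U) (c : ℝ) (T : ℕ) : (Pop w A)^[T] (fun _ => c) = fun _ => c := by
  induction T with
  | zero => rfl
  | succ T ih => rw [Function.iterate_succ_apply', ih, Pop_const hw]

lemma iter_add (A : Finset U) (F G : Fn U) (T : ℕ) : (Pop w A)^[T] (F + G) = (Pop w A)^[T] F + (Pop w A)^[T] G := by
  induction T with
  | zero => rfl
  | succ T ih => simp only [Function.iterate_succ_apply', ih, Pop_add]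

lemma iter_smul (A : Finset U) (c : ℝ) (F : Fn U) (T : ℕ) : (Pop w A)^[T] (c • F) = c • (Pop w A)^[T] F := by
  induction T with
  | zero => rfl
  | succ T ih => simp only [Function.iterate_succ_apply', ih, Pop_smul]

lemma pre_iter (hw : LW w) (A : Finset U) {F G : Fn U} (h : pre w A F G) (T : ℕ) : pre w A ((Pop w A)^[T] F) ((Pop w A)^[T] G) := by
  induction T with
  | zero => exact h
  | succ T ih => rw [Function.iterate_succ_apply', Function.iterate_succ_apply']; exact pre_Pop hw A ih

def rr (U : Type*) [Fintype U] : ℝ := 1 - (Fintype.card U : ℝ)⁻¹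

lemma rr_nonneg (U : Type*) [Fintype U] : 0 ≤ rr U := by
  unfold rr
  rcases Nat.eq_zero_or_pos (Fintype.card U) with h | h
  · rw [h]; norm_num
  · have : (Fintype.card U : ℝ)⁻¹ ≤ 1 := inv_le_one_of_one_le₀ (by exact_mod_cast h)
    linarith

lemma rr_le (U : Type*) [Fintype U] : rr U ≤ 1 := by
  unfold rr; have : 0 ≤ (Fintype.card U : ℝ)⁻¹ := by positivity
  linarith

lemma Pop_pre (hw : LW w) (A : Finset U) (v : U) {F : Fn U} (hF : Monotone F) :
    pre w A (Pop w A F) ((1 - rr U) • Kop w A v F + rr U • F) := by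
  have h : pre w A (∑ u : U, Kop w A u F) (∑ u : U, if u = v then Kop w A v F else F) := by
    refine pre_sum _ fun u _ => ?_
    by_cases hu : u = v
    · subst hu; simpa using pre.refl' A _
    · rw [if_neg hu]; exact Kop_pre hw A u hF
  have h2 := h.smul (c := (Fintype.card U : ℝ)⁻¹) pP
  refine h2.trans ?_
  have : (Fintype.card U : ℝ)⁻¹ • (∑ u : U, if u = v then Kop w A v F else F) = (1 - rr U) • Kop w A v F + rr U • F := by
    have e : (∑ u : U, if u = v then Kop w A v F else F) = (Kop w A v F - F) + (Fintype.card U : ℝ) • F := by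
      have : ∀ u : U, (if u = v then Kop w A v F else F) = (if u = v then Kop w A v F - F else 0) + F := by
        intro u; split_ifs <;> simp
      rw [sum_congr rfl fun u _ => this u, sum_add_distrib, sum_ite_eq' univ v, if_pos (mem_univ v), sum_const, card_univ, Nat.cast_smul_eq_nsmul]
    have hc : (Fintype.card U : ℝ) ≠ 0 := by
      haveI : Nonempty U := ⟨v⟩
      exact_mod_cast Fintype.card_ne_zero
    rw [e]; funext σ; simp only [rr, Pi.smul_apply, Pi.add_apply, Pi.sub_apply, smul_eq_mul]
    field_simp; ring
  rw [this]; exact pre.refl' A _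

def Qop (w : Fn U) (A : Finset U) (T : ℕ) (v : U) (F : Fn U) : (U → Bool) → ℝ :=
  (1 - rr U ^ T) • Kop w A v F + rr U ^ T • F

lemma rrT (U : Type*) [Fintype U] (T : ℕ) : 0 ≤ rr U ^ T ∧ 0 ≤ 1 - rr U ^ T :=
  ⟨pow_nonneg (rr_nonneg U) T, sub_nonneg.2 (pow_le_one₀ (rr_nonneg U) (rr_le U))⟩

lemma iter_pre (hw : LW w) (A : Finset U) (v : U) {F : Fn U} (hF : Monotone F) (T : ℕ) :
    pre w A ((Pop w A)^[T] F) (Qop w A T v F) := by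
  induction T with
  | zero => simpa [Qop] using pre.refl' A F
  | succ T ih =>
    rw [Function.iterate_succ_apply']
    refine (pre_Pop hw A ih).trans ?_
    rw [Qop, Pop_add, Pop_smul, Pop_smul]
    have h1 : pre w A (Pop w A (Kop w A v F)) (Kop w A v F) := by
      have := Pop_pre hw A v (Kop_monotone hw A v hF)
      refine this.trans ?_
      have h2 := Kop_pre hw A v (Kop_monotone hw A v hF)
      have h3 := (h2.smul (c := 1 - rr U) (by linarith [rr_le U])).add (pre.refl' (w := w) A (rr U • Kop w A v F))
      refine h3.trans ?_
      rw [← add_smul]; simpa using pre.refl' A _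
    refine ((h1.smul (rrT U T).2).add ((Pop_pre hw A v hF).smul (rrT U T).1)).trans ?_
    have : (1 - rr U ^ T) • Kop w A v F + rr U ^ T • ((1 - rr U) • Kop w A v F + rr U • F) = Qop w A (T+1) v F := by
      funext σ; simp only [Qop, Pi.smul_apply, Pi.add_apply, smul_eq_mul]; ring
    rw [this]; exact pre.refl' A _

lemma Qop_monotone (hw : LW w) (A : Finset U) (T : ℕ) (v : U) {F : Fn U} (h : Monotone F) : Monotone (Qop w A T v F) := by
  intro σ τ hs
  simp only [Qop, Pi.smul_apply, Pi.add_apply, smul_eq_mul]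
  exact add_le_add (mll (Kop_monotone hw A v h hs) (rrT U T).2) (mll (h hs) (rrT U T).1)

lemma fold_monotone (hw : LW w) (A : Finset U) (T : ℕ) (l : List U) {F : Fn U} (h : Monotone F) : Monotone (l.foldr (Qop w A T) F) := by
  induction l with
  | nil => exact h
  | cons v l ih => exact Qop_monotone hw A T v ih

lemma fold_pre (hw : LW w) (A : Finset U) (T : ℕ) (l : List U) {F : Fn U} (h : Monotone F) :
    pre w A ((Pop w A)^[T * l.length] F) (l.foldr (Qop w A T) F) := by
  induction l with
  | nil => exact pre.refl' A F
  | cons v l ih =>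
    rw [List.length_cons, mul_add, mul_one, add_comm, Function.iterate_add_apply]
    exact (pre_iter hw A ih T).trans (iter_pre hw A v (fold_monotone hw A T l h) T)

abbrev Ks (w : Fn U) (A : Finset U) (l : List U) (F : Fn U) : (U → Bool) → ℝ := l.foldr (Kop w A) F

lemma Ks_bd (hw : LW w) (A : Finset U) (l : List U) {F : Fn U} {c d : ℝ} (h : ∀ σ, c ≤ F σ ∧ F σ ≤ d) :
    ∀ σ, c ≤ Ks w A l F σ ∧ Ks w A l F σ ≤ d := by
  induction l with
  | nil => exact h
  | cons v l ih => exact fun σ => ⟨le_Kop hw A v (fun τ => (ih τ).1) σ, Kop_le hw A v (fun τ => (ih τ).2) σ⟩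

lemma QK (hw : LW w) (A : Finset U) (T : ℕ) (l : List U) {F : Fn U} {D : ℝ} (h : ∀ σ, 0 ≤ F σ ∧ F σ ≤ D) :
    (∀ σ, 0 ≤ l.foldr (Qop w A T) F σ ∧ l.foldr (Qop w A T) F σ ≤ D) ∧
    ∀ σ, |l.foldr (Qop w A T) F σ - Ks w A l F σ| ≤ l.length * rr U ^ T * D := by
  induction l with
  | nil => exact ⟨h, fun σ => by simp [Ks]⟩
  | cons v l ih =>
    obtain ⟨i1, i2⟩ := ih
    obtain ⟨r0, r1⟩ := rrT U T
    have b1 := fun σ => le_Kop hw A v (fun τ => (i1 τ).1) σ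
    have b2 := fun σ => Kop_le hw A v (fun τ => (i1 τ).2) σ
    refine ⟨fun σ => ?_, fun σ => ?_⟩
    · simp only [List.foldr_cons]
      simp only [Qop, Pi.add_apply, Pi.smul_apply, smul_eq_mul] at *
      constructor
      · exact add_nonneg (mul_nonneg r1 (b1 σ)) (mul_nonneg r0 (i1 σ).1)
      · nlinarith [mll (b2 σ) r1, mll (i1 σ).2 r0]
    · have c1 := fun σ => le_Kop hw A v (F := l.foldr (Qop w A T) F - Ks w A l F) (c := -(l.length * rr U ^ T * D)) (fun τ => (abs_le.1 (i2 τ)).1) σ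
      have c2 := fun σ => Kop_le hw A v (F := l.foldr (Qop w A T) F - Ks w A l F) (c := l.length * rr U ^ T * D) (fun τ => (abs_le.1 (i2 τ)).2) σ
      rw [Kop_sub] at c1 c2
      have c1 := c1 σ; have c2 := c2 σ
      have b1 := b1 σ; have b2 := b2 σ; have i1 := i1 σ
      simp only [List.foldr_cons, List.length_cons, Ks] at *
      rw [Qop]
      simp only [Pi.add_apply, Pi.sub_apply, Pi.smul_apply, smul_eq_mul] at *
      push_cast
      rw [abs_le]
      constructor
      · nlinarith [mll b2 r0, mul_nonneg r0 i1.1]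
      · nlinarith [mul_nonneg r0 b1, mll i1.2 r0]

def topA (A : Finset U) : U → Bool := fun v => decide (v ∉ A)

lemma topA_mem (A : Finset U) : topA A ∈ ag Aᶜ (⊥ : U → Bool) := mem_ag.2 fun p hp => by
  have : p ∈ A := by simpa using hp
  simp [topA, this]

lemma le_topA {A : Finset U} {σ : U → Bool} (h : σ ∈ ag Aᶜ (⊥ : U → Bool)) : σ ≤ topA A := by
  intro v
  by_cases hv : v ∈ A
  · rw [supp_A h hv]; exact bot_le
  · simp [topA, hv]

lemma pE_ind (hw : LW w) (A : Finset U) {ρ : U → Bool} (hρ : ρ ∈ ag Aᶜ (⊥ : U → Bool)) {g : Fn U} (c : ℝ)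
    (hg : ∀ σ ∈ ag Aᶜ (⊥ : U → Bool), g σ = if σ = ρ then c else 0) (F : Fn U) :
    pE w A (g * F) = w ρ * (c * F ρ) / ZZ w Aᶜ ⊥ := by
  simp only [pE, Pj, ZF, Pi.mul_apply]
  rw [sum_eq_single_of_mem ρ hρ]
  · rw [hg ρ hρ, if_pos rfl]
  · intro σ hσ hne; rw [hg σ hσ, if_neg hne]; ring

lemma pre_top (hw : LW w) (A : Finset U) {F G : Fn U} (h : pre w A F G) : F (topA A) ≤ G (topA A) := by
  have hg : Monotone (fun σ : U → Bool => if topA A ≤ σ then (1:ℝ) else 0) := by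
    intro σ τ hs
    dsimp only
    split_ifs with h1 h2 h2
    · exact le_rfl
    · exact absurd (h1.trans hs) h2
    · exact zero_le_one
    · exact le_rfl
  have := h _ hg
  have e : ∀ σ ∈ ag Aᶜ (⊥ : U → Bool), (if topA A ≤ σ then (1:ℝ) else 0) = if σ = topA A then 1 else 0 := by
    intro σ hσ
    congr 1
    exact propext ⟨fun h => le_antisymm (le_topA hσ) h, fun h => h.ge⟩
  rw [pE_ind hw A (topA_mem A) 1 e, pE_ind hw A (topA_mem A) 1 e, div_le_div_iff_of_pos_right (ZZ_pos hw _ _), one_mul, one_mul] at this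
  exact le_of_mul_le_mul_left this (hw.pos _)

lemma pre_bot (hw : LW w) (A : Finset U) {F G : Fn U} (h : pre w A F G) : G ⊥ ≤ F ⊥ := by
  have hg : Monotone (fun σ : U → Bool => if σ ≤ ⊥ then (-1:ℝ) else 0) := by
    intro σ τ hs
    dsimp only
    split_ifs with h1 h2 h2
    · exact le_rfl
    · norm_num
    · exact absurd (hs.trans h2) h1
    · exact le_rfl
  have := h _ hg
  have e : ∀ σ ∈ ag Aᶜ (⊥ : U → Bool), (if σ ≤ ⊥ then (-1:ℝ) else 0) = if σ = ⊥ then -1 else 0 := by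
    intro σ hσ
    congr 1
    exact propext le_bot_iff
  rw [pE_ind hw A (ag_self _ _) (-1) e, pE_ind hw A (ag_self _ _) (-1) e, div_le_div_iff_of_pos_right (ZZ_pos hw _ _)] at this
  have := le_of_mul_le_mul_left this (hw.pos _)
  linarith

lemma cens (hw : LW w) (A : Finset U) (T : ℕ) (l : List U) {F : Fn U} {D : ℝ} (h : ∀ σ, 0 ≤ F σ ∧ F σ ≤ D) (hF : Monotone F) :
    (Pop w A)^[T * l.length] F (topA A) ≤ Ks w A l F (topA A) + l.length * rr U ^ T * D ∧
    Ks w A l F ⊥ - l.length * rr U ^ T * D ≤ (Pop w A)^[T * l.length] F ⊥ := by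
  have h1 := fold_pre hw A T l hF
  have h2 := (QK hw A T l h).2
  constructor
  · have := pre_top hw A h1
    have h3 := (abs_le.1 (h2 (topA A))).2
    linarith
  · have := pre_bot hw A h1
    have h3 := (abs_le.1 (h2 ⊥)).1
    linarith
end cens

section block
variable {U : Type*} [Fintype U] [DecidableEq U] {w : Fn U}

def mx (B : Finset U) (σ σ' : U → Bool) : U → Bool := fun p => if p ∈ B then σ' p else σ p

def hpp (w : Fn U) (B1 B2 : Finset U) (p : ℝ) : Prop :=
  ∀ σ σ' : U → Bool, (∀ x, x ∉ B1 → x ∉ B2 → σ x = σ' x) → p * (w σ * w σ') ≤ w (mx B2 σ σ') * w (mx B2 σ' σ)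

lemma blk_Z (hw : LW w) {B1 B2 : Finset U} (hd : Disjoint B1 B2) {p : ℝ} (h : hpp w B1 B2 p) (τ ξ : U → Bool) (hξ : ξ ∈ ag B1 τ) :
    p * (ZZ w B1 τ * ZZ w B2 ξ) ≤ w ξ * ZZ w (B1 ∪ B2) τ := by
  unfold ZZ
  rw [sum_mul_sum, ← sum_product', mul_sum]
  have hin : Set.InjOn (fun x : (U → Bool) × (U → Bool) => mx B2 x.1 x.2) (ag B1 τ ×ˢ ag B2 ξ : Finset _) := by
    rintro ⟨a, b⟩ hab ⟨a', b'⟩ hab' he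
    simp only [coe_product, Set.mem_prod, mem_coe] at hab hab'
    have e := fun x => congrFun he x
    simp only [mx] at e
    ext x
    · by_cases hx : x ∈ B2
      · have : x ∉ B1 := fun h1 => disjoint_left.1 hd h1 hx
        dsimp only; rw [mem_ag.1 hab.1 x this, mem_ag.1 hab'.1 x this]
      · have := e x; rwa [if_neg hx, if_neg hx] at this
    · by_cases hx : x ∈ B2
      · have := e x; rwa [if_pos hx, if_pos hx] at this
      · dsimp only; rw [mem_ag.1 hab.2 x hx, mem_ag.1 hab'.2 x hx]
  calc ∑ x ∈ ag B1 τ ×ˢ ag B2 ξ, p * (w x.1 * w x.2)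
      ≤ ∑ x ∈ ag B1 τ ×ˢ ag B2 ξ, w ξ * w (mx B2 x.1 x.2) := by
        refine sum_le_sum fun x hx => ?_
        rw [mem_product] at hx
        refine (h x.1 x.2 fun y h1 h2 => ?_).trans (le_of_eq ?_)
        · rw [mem_ag.1 hx.1 y h1, mem_ag.1 hx.2 y h2, mem_ag.1 hξ y h1]
        · rw [mul_comm]; congr 2
          funext y
          simp only [mx]
          split_ifs with hy
          · have : y ∉ B1 := fun h1 => disjoint_left.1 hd h1 hy
            rw [mem_ag.1 hx.1 y this, mem_ag.1 hξ y this]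
          · rw [mem_ag.1 hx.2 y hy]
    _ = w ξ * ∑ c ∈ (ag B1 τ ×ˢ ag B2 ξ).image (fun x => mx B2 x.1 x.2), w c := by
        rw [sum_image hin, mul_sum]
    _ ≤ _ := by
        refine mll (sum_le_sum_of_subset_of_nonneg ?_ fun σ _ _ => (hw.pos σ).le) (hw.pos ξ).le
        intro c hc
        obtain ⟨x, hx, rfl⟩ := mem_image.1 hc
        rw [mem_product] at hx
        refine mem_ag.2 fun y hy => ?_
        rw [mem_union, not_or] at hy
        simp only [mx]; rw [if_neg hy.2, mem_ag.1 hx.1 y hy.1]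

lemma ZF_split {B1 B2 : Finset U} (hd : Disjoint B1 B2) (F : Fn U) (τ : U → Bool) : ZF w (B1 ∪ B2) F τ = ∑ ξ ∈ ag B1 τ, ZF w B2 F ξ := by
  unfold ZF
  have hm : ∀ η ∈ ag (B1 ∪ B2) τ, mx B2 η τ ∈ ag B1 τ := by
    intro η hη
    refine mem_ag.2 fun y hy => ?_
    simp only [mx]; split_ifs with h2
    · rfl
    · exact mem_ag.1 hη y (by simp [hy, h2])
  rw [← sum_fiberwise_of_maps_to hm]
  refine sum_congr rfl fun ξ hξ => sum_congr ?_ fun _ _ => rfl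
  ext η
  rw [mem_filter, mem_ag, mem_ag]
  constructor
  · rintro ⟨h1, rfl⟩ y hy
    simp [mx, hy]
  · intro hη
    refine ⟨fun y hy => ?_, ?_⟩
    · rw [mem_union, not_or] at hy
      rw [hη y hy.2, mem_ag.1 hξ y hy.1]
    · funext y
      simp only [mx]; split_ifs with h2
      · exact (mem_ag.1 hξ y fun h1 => disjoint_left.1 hd h1 h2).symm
      · exact hη y h2

lemma blk (hw : LW w) {B1 B2 : Finset U} (hd : Disjoint B1 B2) {p : ℝ} (h : hpp w B1 B2 p) {F : Fn U} (hF : 0 ≤ F) :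
    p • Pj w (B1 ∪ B2) F ≤ Pj w B1 (Pj w B2 F) := by
  intro τ
  simp only [Pi.smul_apply, smul_eq_mul]
  have z1 := ZZ_pos hw B1 τ
  have zB := ZZ_pos hw (B1 ∪ B2) τ
  have e1 := ZF_split (w := w) hd F τ
  have e2 : Pj w B1 (Pj w B2 F) τ = ∑ ξ ∈ ag B1 τ, w ξ / (ZZ w B1 τ * ZZ w B2 ξ) * ZF w B2 F ξ := by
    unfold Pj
    rw [ZF, sum_div]
    refine sum_congr rfl fun ξ _ => ?_
    have := ZZ_pos hw B2 ξ
    field_simp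
  rw [e2, Pj, e1, sum_div, mul_sum]
  refine sum_le_sum fun ξ hξ => ?_
  have z2 := ZZ_pos hw B2 ξ
  have hb := blk_Z hw hd h τ ξ hξ
  have : p / ZZ w (B1 ∪ B2) τ ≤ w ξ / (ZZ w B1 τ * ZZ w B2 ξ) := by
    rw [div_le_div_iff₀ zB (mul_pos z1 z2)]; exact hb
  calc _ = p / ZZ w (B1 ∪ B2) τ * ZF w B2 F ξ := by ring
    _ ≤ _ := mlr this (sum_nonneg fun σ _ => mul_nonneg (hw.pos σ).le (hF σ))

def XX (w : Fn U) (B1 B2 : Finset U) (F : Fn U) := Pj w B1 (Pj w B2 F)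

lemma XX_smul (B1 B2 : Finset U) (c : ℝ) (F : Fn U) : XX w B1 B2 (c • F) = c • XX w B1 B2 F := by
  simp [XX, Pj_smul]
lemma XX_sub (B1 B2 : Finset U) (F G : Fn U) : XX w B1 B2 (F - G) = XX w B1 B2 F - XX w B1 B2 G := by
  simp [XX, Pj_sub]
lemma XX_const (hw : LW w) (B1 B2 : Finset U) (c : ℝ) : XX w B1 B2 (fun _ => c) = fun _ => c := by
  simp [XX, Pj_const hw]
lemma Pj_XX (hw : LW w) (B1 B2 : Finset U) (F : Fn U) : Pj w (B1 ∪ B2) (XX w B1 B2 F) = Pj w (B1 ∪ B2) F := by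
  rw [XX, Pj_tower hw subset_union_left, Pj_tower hw subset_union_right]
lemma Pj_iX (hw : LW w) (B1 B2 : Finset U) (F : Fn U) (m : ℕ) : Pj w (B1 ∪ B2) ((XX w B1 B2)^[m] F) = Pj w (B1 ∪ B2) F := by
  induction m with
  | zero => rfl
  | succ m ih => rw [Function.iterate_succ_apply', Pj_XX hw, ih]
lemma XX_Pj (hw : LW w) (B1 B2 : Finset U) (F : Fn U) : XX w B1 B2 (Pj w (B1 ∪ B2) F) = Pj w (B1 ∪ B2) F := by
  rw [XX, Pj_idem hw subset_union_right, Pj_idem hw subset_union_left]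
lemma iX_sub (B1 B2 : Finset U) (F G : Fn U) (m : ℕ) : (XX w B1 B2)^[m] (F - G) = (XX w B1 B2)^[m] F - (XX w B1 B2)^[m] G := by
  induction m with
  | zero => rfl
  | succ m ih => simp only [Function.iterate_succ_apply', ih, XX_sub]
lemma iX_const (hw : LW w) (B1 B2 : Finset U) (c : ℝ) (m : ℕ) : (XX w B1 B2)^[m] (fun _ => c) = fun _ => c := by
  induction m with
  | zero => rfl
  | succ m ih => rw [Function.iterate_succ_apply', ih, XX_const hw]

lemma iX_lower (hw : LW w) {B1 B2 : Finset U} (hd : Disjoint B1 B2) {p : ℝ} (h : hpp w B1 B2 p) {F : Fn U} (hF : 0 ≤ F) (m : ℕ) :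
    (1 - (1 - p)^m) • Pj w (B1 ∪ B2) F ≤ (XX w B1 B2)^[m] F := by
  induction m with
  | zero => simpa using hF
  | succ m ih =>
    rw [Function.iterate_succ_apply']
    set Y := (XX w B1 B2)^[m] F with hY
    set Q := Pj w (B1 ∪ B2) F with hQ
    have h1 := blk hw hd h (F := Y - (1 - (1 - p)^m) • Q) (sub_nonneg.2 ih)
    have h2 : Pj w (B1 ∪ B2) (Y - (1 - (1 - p)^m) • Q) = (1 - p)^m • Q := by
      rw [Pj_sub, Pj_smul, hY, Pj_iX hw, hQ, Pj_tower hw subset_rfl, sub_smul, one_smul, sub_sub_cancel]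
    rw [h2] at h1
    change _ ≤ XX w B1 B2 _ at h1
    rw [XX_sub, XX_smul, hQ, XX_Pj hw, ← hQ] at h1
    intro σ
    have := h1 σ
    simp only [Pi.smul_apply, Pi.sub_apply, smul_eq_mul] at this ⊢
    rw [pow_succ]; linarith

lemma iX_approx (hw : LW w) {B1 B2 : Finset U} (hd : Disjoint B1 B2) {p : ℝ} (hp1 : p ≤ 1) (h : hpp w B1 B2 p) {F : Fn U} {D : ℝ}
    (hF : ∀ σ, 0 ≤ F σ ∧ F σ ≤ D) (m : ℕ) (σ : U → Bool) : |(XX w B1 B2)^[m] F σ - Pj w (B1 ∪ B2) F σ| ≤ (1 - p)^m * D := by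
  have q0 : 0 ≤ (1 - p)^m := pow_nonneg lL m
  have l1 := iX_lower hw hd h (F := F) (fun σ => (hF σ).1) m σ
  have l2 := iX_lower hw hd h (F := (fun _ => D) - F) (fun σ => by simpa using (hF σ).2) m σ
  rw [iX_sub, Pj_sub, iX_const hw, Pj_const hw] at l2
  simp only [Pi.smul_apply, Pi.sub_apply, smul_eq_mul] at l1 l2
  have b1 : 0 ≤ Pj w (B1 ∪ B2) F σ := by
    have := Pj_mono hw (B1 ∪ B2) (F := fun _ => 0) (G := F) (fun σ => (hF σ).1) σ
    rwa [Pj_const hw] at this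
  have b2 : Pj w (B1 ∪ B2) F σ ≤ D := by
    have := Pj_mono hw (B1 ∪ B2) (F := F) (G := fun _ => D) (fun σ => (hF σ).2) σ
    rwa [Pj_const hw] at this
  rw [abs_le]
  constructor <;> nlinarith [mul_nonneg q0 b1, mll b2 q0]

def apx (w : Fn U) (A : Finset U) (l : List U) (B : Finset U) (e : ℝ) : Prop :=
  ∀ (D : ℝ) (F : Fn U), (∀ σ, 0 ≤ F σ ∧ F σ ≤ D) → ∀ σ, |Ks w A l F σ - Pj w B F σ| ≤ e * D

lemma Pj_bd (hw : LW w) (B : Finset U) {F : Fn U} {c d : ℝ} (h : ∀ σ, c ≤ F σ ∧ F σ ≤ d) (σ : U → Bool) : c ≤ Pj w B F σ ∧ Pj w B F σ ≤ d := by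
  have h1 := Pj_mono hw B (F := fun _ => c) (G := F) (fun σ => (h σ).1) σ
  have h2 := Pj_mono hw B (F := F) (G := fun _ => d) (fun σ => (h σ).2) σ
  rw [Pj_const hw] at h1 h2
  exact ⟨h1, h2⟩

lemma Pj_lip (hw : LW w) (B : Finset U) {F G : Fn U} {e : ℝ} (h : ∀ σ, |F σ - G σ| ≤ e) (σ : U → Bool) : |Pj w B F σ - Pj w B G σ| ≤ e := by
  have := Pj_bd hw B (F := F - G) (c := -e) (d := e) (fun σ => abs_le.1 (h σ)) σ
  rw [Pj_sub] at this
  exact abs_le.2 this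

lemma Ks_append (A : Finset U) (l l' : List U) (F : Fn U) : Ks w A (l ++ l') F = Ks w A l (Ks w A l' F) := by simp [Ks]

def rep (l : List U) : ℕ → List U
  | 0 => []
  | m+1 => l ++ rep l m

lemma rep_len (l : List U) (m : ℕ) : (rep l m).length = m * l.length := by
  induction m with
  | zero => simp [rep]
  | succ m ih => rw [rep, List.length_append, ih]; ring

lemma apx_two (hw : LW w) (A : Finset U) {l1 l2 : List U} {B1 B2 : Finset U} {e1 e2 : ℝ} (h1 : apx w A l1 B1 e1) (h2 : apx w A l2 B2 e2)
    (hd : Disjoint B1 B2) {p : ℝ} (hp1 : p ≤ 1) (h : hpp w B1 B2 p) (m : ℕ) :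
    apx w A (rep (l1 ++ l2) m) (B1 ∪ B2) (m * (e1 + e2) + (1 - p)^m) := by
  intro D F hF σ
  have key : ∀ m : ℕ, ∀ σ, |Ks w A (rep (l1 ++ l2) m) F σ - (XX w B1 B2)^[m] F σ| ≤ m * (e1 + e2) * D := by
    intro m
    induction m with
    | zero => intro σ; simp [rep, Ks]
    | succ m ih =>
      intro σ
      rw [Function.iterate_succ_apply', rep, Ks_append, Ks_append]
      set G := Ks w A (rep (l1 ++ l2) m) F with hG
      have hGb := Ks_bd hw A (rep (l1 ++ l2) m) hF
      have a1 := h1 D _ (Ks_bd hw A l2 hGb) σ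
      have a2 := Pj_lip hw B1 (h2 D _ hGb) σ
      have a3 := Pj_lip hw B1 (Pj_lip hw B2 ih) σ
      change |_ - Pj w B1 (Pj w B2 _) σ| ≤ _
      rw [abs_le] at *
      push_cast
      constructor <;> linarith [a1.1, a1.2, a2.1, a2.2, a3.1, a3.2]
  have k := key m σ
  have k2 := iX_approx hw hd hp1 h hF m σ
  rw [abs_le] at *
  constructor <;> linarith [k.1, k.2, k2.1, k2.2]

lemma apx_rec (hw : LW w) {A B : Finset U} (hBA : ∀ v ∈ B, v ∉ A) (idx : U → ℕ) (hi : Function.Injective idx) {p : ℝ} (hp0 : 0 ≤ p) (hp1 : p ≤ 1)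
    (h : ∀ a θ b, hpp w (B.filter fun v => a ≤ idx v ∧ idx v < θ) (B.filter fun v => θ ≤ idx v ∧ idx v < b) p) (m : ℕ) (hm : 1 ≤ m) (d a : ℕ) :
    ∃ l : List U, l.length ≤ (2 * m)^d ∧ apx w A l (B.filter fun v => a ≤ idx v ∧ idx v < a + 2^d) ((1 - p)^m * ((2 * m)^d - 1)) := by
  have q0 : 0 ≤ (1 - p)^m := pow_nonneg lL m
  induction d generalizing a with
  | zero =>
    by_cases hv : ∃ v ∈ B, idx v = a
    · obtain ⟨v, hvB, rfl⟩ := hv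
      refine ⟨[v], by simp, fun D F hF σ => ?_⟩
      have : B.filter (fun u => idx v ≤ idx u ∧ idx u < idx v + 2^0) = {v} := by
        ext u
        rw [mem_filter, mem_singleton]
        constructor
        · rintro ⟨_, h1, h2⟩; exact hi oO
        · rintro rfl; exact ⟨hvB, le_rfl, by simp⟩
      rw [this]
      simp [Ks, Kop, hBA v hvB]
    · refine ⟨[], by simp, fun D F hF σ => ?_⟩
      have : B.filter (fun u => a ≤ idx u ∧ idx u < a + 2^0) = ∅ := by
        rw [filter_eq_empty_iff]
        intro u hu hh
        exact hv ⟨u, hu, by omega⟩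
      rw [this, Pj_fix hw]
      · simp [Ks]
      · intro τ hτ
        rw [show τ = σ from funext fun x => mem_ag.1 hτ x (by simp)]
  | succ d ih =>
    obtain ⟨l1, h1, a1⟩ := ih a
    obtain ⟨l2, h2, a2⟩ := ih (a + 2^d)
    refine ⟨rep (l1 ++ l2) m, ?_, ?_⟩
    · rw [rep_len, List.length_append, pow_succ]
      nlinarith
    · have hd : Disjoint (B.filter fun v => a ≤ idx v ∧ idx v < a + 2^d) (B.filter fun v => a + 2^d ≤ idx v ∧ idx v < a + 2^d + 2^d) := by
        rw [disjoint_left]; intro u hu hu'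
        rw [mem_filter] at hu hu'; omega
      have := apx_two hw A a1 a2 hd hp1 (h a (a + 2^d) (a + 2^d + 2^d)) m
      have hU : (B.filter fun v => a ≤ idx v ∧ idx v < a + 2^d) ∪ (B.filter fun v => a + 2^d ≤ idx v ∧ idx v < a + 2^d + 2^d) =
          B.filter fun v => a ≤ idx v ∧ idx v < a + 2^(d+1) := by
        have h2 : 2^(d+1) = 2^d + 2^d := by ring
        ext u
        rw [mem_union, mem_filter, mem_filter, mem_filter, h2]
        constructor
        · rintro (⟨hb, h⟩ | ⟨hb, h⟩) <;> exact ⟨hb, by omega⟩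
        · rintro ⟨hb, h⟩
          by_cases hlt : idx u < a + 2^d
          · exact Or.inl ⟨hb, by omega⟩
          · exact Or.inr ⟨hb, by omega⟩
      rw [hU] at this
      intro D F hF σ
      refine (this D F hF σ).trans ?_
      have hD : 0 ≤ D := (hF σ).1.trans (hF σ).2
      refine mlr ?_ hD
      have hm' : (1:ℝ) ≤ m := by exact_mod_cast hm
      rw [pow_succ]
      nlinarith [mll hm' q0]
end block

section ising
variable {U : Type*} [Fintype U] [DecidableEq U]

def wE (β : ℝ) (E : Ed U) (σ : U → Bool) : ℝ := ∏ e ∈ E, exp (β * (spinVal (σ e.1) * spinVal (σ e.2)))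

lemma sv_lat (a b c d : Bool) : spinVal a * spinVal b + spinVal c * spinVal d ≤ spinVal (a ⊓ c) * spinVal (b ⊓ d) + spinVal (a ⊔ c) * spinVal (b ⊔ d) := by
  cases a <;> cases b <;> cases c <;> cases d <;> simp [spinVal] <;> norm_num

lemma wE_LW {β : ℝ} (hβ : 0 ≤ β) (E : Ed U) : LW (wE β E) where
  pos σ := prod_pos fun _ _ => exp_pos _
  lat σ τ := by
    simp only [wE, ← prod_mul_distrib, ← exp_add, ← mul_add]
    refine prod_le_prod (fun _ _ => (exp_pos _).le) fun e _ => exp_le_exp.2 (mll ?_ hβ)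
    exact sv_lat _ _ _ _

lemma sv_cross (a b c d : Bool) : -4 + (spinVal a * spinVal b + spinVal c * spinVal d) ≤ spinVal a * spinVal d + spinVal c * spinVal b := by
  cases a <;> cases b <;> cases c <;> cases d <;> simp [spinVal] <;> norm_num

lemma wE_hpp {β : ℝ} (hβ : 0 ≤ β) (E : Ed U) (B1 B2 : Finset U) (c : ℕ)
    (hc : #(E.filter fun e => (e.1 ∈ B1 ∧ e.2 ∈ B2) ∨ (e.1 ∈ B2 ∧ e.2 ∈ B1)) ≤ c) : hpp (wE β E) B1 B2 (exp (-(4 * β * c))) := by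
  intro σ σ' hs
  have h1 : exp (-(4 * β * c)) ≤ ∏ e ∈ E, exp (if (e.1 ∈ B1 ∧ e.2 ∈ B2) ∨ (e.1 ∈ B2 ∧ e.2 ∈ B1) then -(4 * β) else 0) := by
    rw [← exp_sum, exp_le_exp, ← sum_filter, sum_const, nsmul_eq_mul]
    have : (#(E.filter fun e => (e.1 ∈ B1 ∧ e.2 ∈ B2) ∨ (e.1 ∈ B2 ∧ e.2 ∈ B1)) : ℝ) ≤ c := by exact_mod_cast hc
    nlinarith
  refine (mlr h1 (mul_nonneg (prod_nonneg fun _ _ => (exp_pos _).le) (prod_nonneg fun _ _ => (exp_pos _).le))).trans ?_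
  simp only [wE, ← prod_mul_distrib, ← exp_add, ← mul_add]
  refine prod_le_prod (fun _ _ => (exp_pos _).le) fun e _ => exp_le_exp.2 ?_
  by_cases hx : (e.1 ∈ B1 ∧ e.2 ∈ B2) ∨ (e.1 ∈ B2 ∧ e.2 ∈ B1)
  · rw [if_pos hx]
    simp only [mx]
    have k1 := mll (sv_cross (σ e.1) (σ e.2) (σ' e.1) (σ' e.2)) hβ
    have k2 := mll (sv_cross (σ e.2) (σ e.1) (σ' e.2) (σ' e.1)) hβ
    split_ifs <;> first | linarith | nlinarith
  · rw [if_neg hx, zero_add]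
    refine mll (le_of_eq ?_) hβ
    simp only [mx]
    by_cases a2 : e.1 ∈ B2 <;> by_cases b2 : e.2 ∈ B2 <;> simp only [a2, b2, if_true, if_false]
    · ring
    · have b1 : e.2 ∉ B1 := fun h => hx (Or.inr ⟨a2, h⟩)
      rw [hs e.2 b1 b2]; ring
    · have a1 : e.1 ∉ B1 := fun h => hx (Or.inl ⟨h, b2⟩)
      rw [hs e.1 a1 a2]; ring

structure GE (G : SimpleGraph U) (E : Ed U) : Prop where
  adj : ∀ u v, G.Adj u v ↔ (u, v) ∈ E ∨ (v, u) ∈ E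
  asym : ∀ u v, (u, v) ∈ E → (v, u) ∉ E

lemma GE.ne {G : SimpleGraph U} {E : Ed U} (h : GE G E) {e : U × U} (he : e ∈ E) : e.1 ≠ e.2 :=
  fun hh => by
    have : (e.1, e.2) ∈ E := he
    have h2 := h.asym _ _ this
    rw [hh] at this h2; exact h2 this

lemma GE.nbr {G : SimpleGraph U} {E : Ed U} (h : GE G E) (σ : U → Bool) (v : U) :
    nbrSum G σ v = ∑ e ∈ E, ((if e.1 = v then spinVal (σ e.2) else 0) + (if e.2 = v then spinVal (σ e.1) else 0)) := by
  have key : ∀ f : U × U → ℝ, ∑ e ∈ E, f e = ∑ x : U, ∑ y : U, if (x, y) ∈ E then f (x, y) else 0 := by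
    intro f
    rw [← Fintype.sum_prod_type' (fun x y => if (x, y) ∈ E then f (x, y) else 0)]
    simp [sum_ite_mem]
  rw [sum_add_distrib, key, key]
  have e1 : (∑ x : U, ∑ y : U, if (x, y) ∈ E then (if (x, y).1 = v then spinVal (σ (x, y).2) else 0) else 0) = ∑ u : U, if (v, u) ∈ E then spinVal (σ u) else 0 := by
    rw [sum_eq_single v]
    · simp
    · intro x _ hx; simp [hx]
    · simp
  have e2 : (∑ x : U, ∑ y : U, if (x, y) ∈ E then (if (x, y).2 = v then spinVal (σ (x, y).1) else 0) else 0) = ∑ u : U, if (u, v) ∈ E then spinVal (σ u) else 0 := by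
    rw [sum_comm, sum_eq_single v]
    · simp
    · intro x _ hx; simp [hx]
    · simp
  rw [e1, e2, ← sum_add_distrib, nbrSum]
  refine sum_congr rfl fun u _ => ?_
  have ha := h.adj v u
  have hs := h.asym v u
  by_cases h1 : (v, u) ∈ E <;> by_cases h2 : (u, v) ∈ E <;> simp_all

lemma GE.flip {G : SimpleGraph U} {E : Ed U} (h : GE G E) (β : ℝ) (σ : U → Bool) (v : U) :
    wE β E (Function.update σ v true) * exp (-(β * nbrSum G σ v)) = wE β E (Function.update σ v false) * exp (β * nbrSum G σ v) := by
  rw [h.nbr, mul_sum, ← sum_neg_distrib, exp_sum, exp_sum, wE, wE, ← prod_mul_distrib, ← prod_mul_distrib]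
  refine prod_congr rfl fun e he => ?_
  rw [← exp_add, ← exp_add]
  congr 1
  have hne := h.ne he
  by_cases h1 : e.1 = v
  · have h2 : e.2 ≠ v := fun hh => hne (h1.trans hh.symm)
    rw [if_pos h1, if_neg h2, h1]
    simp [Function.update_of_ne h2, spinVal]
    split_ifs <;> ring
  · by_cases h2 : e.2 = v
    · rw [if_neg h1, if_pos h2, h2]
      simp [Function.update_of_ne h1, spinVal]
    · simp [Function.update_of_ne h1, Function.update_of_ne h2, h1, h2]

lemma ag_single (σ : U → Bool) (v : U) : ag {v} σ = {Function.update σ v true, Function.update σ v false} := by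
  ext τ
  rw [mem_ag, mem_insert, mem_singleton]
  constructor
  · intro h
    have : τ = Function.update σ v (τ v) := by
      funext x
      by_cases hx : x = v
      · subst hx; simp
      · rw [Function.update_of_ne hx]; exact h x (by simpa using hx)
    cases hv : τ v <;> rw [hv] at this
    · exact Or.inr this
    · exact Or.inl this
  · rintro (rfl | rfl) p hp <;> exact Function.update_of_ne (by simpa using hp) _ _

lemma upd_ne (σ : U → Bool) (v : U) : Function.update σ v true ≠ Function.update σ v false := fun h => by
  have := congrFun h v; simp at this

lemma GE.Pj {G : SimpleGraph U} {E : Ed U} (h : GE G E) {β : ℝ} (hβ : 0 ≤ β) (σ : U → Bool) (v : U) (F : Fn U) :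
    Pj (wE β E) {v} F σ = glauberP β G σ v * F (Function.update σ v true) + (1 - glauberP β G σ v) * F (Function.update σ v false) := by
  unfold _root_.Pj ZF ZZ
  rw [ag_single, sum_pair (upd_ne σ v), sum_pair (upd_ne σ v)]
  have hf := h.flip β σ v
  have p1 := (wE_LW hβ E).pos (Function.update σ v true)
  have p2 := (wE_LW hβ E).pos (Function.update σ v false)
  have hg : glauberP β G σ v = wE β E (Function.update σ v true) / (wE β E (Function.update σ v true) + wE β E (Function.update σ v false)) := by
    unfold glauberP
    rw [div_eq_div_iff pP pP]
    linarith
  rw [hg]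
  field_simp
  ring

lemma GE.step {G : SimpleGraph U} {E : Ed U} (h : GE G E) {β : ℝ} (hβ : 0 ≤ β) (A : Finset U) (F : Fn U) (σ : U → Bool) :
    ∑ σ', pinnedK G β A false σ σ' * F σ' = Pop (wE β E) A F σ := by
  simp only [pinnedK, Pop, Pi.smul_apply, Finset.sum_apply, smul_eq_mul]
  simp only [mul_assoc, ← mul_sum, sum_mul]
  congr 1
  rw [sum_comm]
  refine sum_congr rfl fun v _ => ?_
  unfold Kop
  by_cases hv : v ∈ A
  · simp [hv]
  · simp only [hv, if_false]
    rw [h.Pj hβ]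
    simp [add_mul, sum_add_distrib]

lemma GE.evo {G : SimpleGraph U} {E : Ed U} (h : GE G E) {β : ℝ} (hβ : 0 ≤ β) (A : Finset U) (σ₀ : U → Bool) (t : ℕ) (F : Fn U) :
    ∑ σ, evolve (pinnedK G β A false) t (delta σ₀) σ * F σ = (Pop (wE β E) A)^[t] F σ₀ := by
  induction t generalizing F with
  | zero => simp [evolve, delta]
  | succ t ih =>
    rw [Function.iterate_succ_apply, ← ih]
    simp only [evolve, sum_mul]
    rw [sum_comm]
    refine sum_congr rfl fun σ _ => ?_
    rw [← h.step hβ, mul_sum]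
    exact sum_congr rfl fun _ _ => by ring

lemma GE.ham {G : SimpleGraph U} {E : Ed U} (h : GE G E) (σ : U → Bool) :
    ham G σ = ∑ e ∈ E, spinVal (σ e.1) * spinVal (σ e.2) := by
  unfold _root_.ham
  symm
  refine sum_bij (fun e _ => s(e.1, e.2)) ?_ ?_ ?_ ?_
  · intro e he
    rw [SimpleGraph.mem_edgeFinset, SimpleGraph.mem_edgeSet]
    exact (h.adj _ _).2 (Or.inl he)
  · rintro ⟨a, b⟩ he ⟨c, d⟩ he' hh
    rw [Sym2.eq_iff] at hh
    rcases hh with ⟨h1, h2⟩ | ⟨h1, h2⟩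
    · exact Prod.ext h1 h2
    · simp only at h1 h2; subst h1; subst h2
      exact absurd he' (h.asym _ _ he)
  · intro e
    induction e using Sym2.ind with
    | _ a b =>
      intro he
      rw [SimpleGraph.mem_edgeFinset, SimpleGraph.mem_edgeSet] at he
      rcases (h.adj _ _).1 he with h1 | h1
      · exact ⟨(a, b), h1, rfl⟩
      · exact ⟨(b, a), h1, Sym2.eq_swap⟩
  · intro e _; rfl

lemma GE.exp {G : SimpleGraph U} {E : Ed U} (h : GE G E) (β : ℝ) (σ : U → Bool) : exp (β * _root_.ham G σ) = wE β E σ := by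
  rw [h.ham, mul_sum, exp_sum, wE]

lemma GE.cond {G : SimpleGraph U} {E : Ed U} (h : GE G E) {β : ℝ} (A : Finset U) (F : Fn U) :
    ∑ σ, condIsing G β A false σ * F σ = pE (wE β E) A F := by
  have hm : ∀ σ : U → Bool, (∀ v ∈ A, σ v = false) ↔ σ ∈ ag Aᶜ ⊥ := by
    intro σ; rw [mem_ag]
    exact forall_congr' fun v => by simp
  have hZ : condZ G β A false = ZZ (wE β E) Aᶜ ⊥ := by
    unfold condZ ZZ
    simp only [hm, h.exp, sum_ite_mem, univ_inter]
  simp only [condIsing, hZ, hm, h.exp]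
  unfold pE _root_.Pj ZF
  rw [sum_div, ← univ_inter (ag Aᶜ ⊥), ← sum_ite_mem]
  refine sum_congr rfl fun σ _ => ?_
  rw [univ_inter]
  split_ifs
  · ring
  · ring

lemma GE.tv [Nonempty U] {G : SimpleGraph U} {E : Ed U} (h : GE G E) {β : ℝ} (hβ : 0 ≤ β) (A : Finset U) (σ₀ : U → Bool) (t : ℕ) (e : ℝ)
    (H : ∀ f : (U → Bool) → ℝ, (∀ σ, 0 ≤ f σ ∧ f σ ≤ 1) → (Pop (wE β E) A)^[t] f σ₀ ≤ pE (wE β E) A f + e) :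
    tvDist (evolve (pinnedK G β A false) t (delta σ₀)) (condIsing G β A false) ≤ e := by
  set a := evolve (pinnedK G β A false) t (delta σ₀)
  set b := condIsing G β A false
  have hw := wE_LW hβ E
  have m1 : ∑ σ, a σ = 1 := by
    have := h.evo hβ A σ₀ t (fun _ => 1)
    rw [iter_const hw] at this
    simpa using this
  have m2 : ∑ σ, b σ = 1 := by
    have := h.cond (β := β) A (fun _ => 1)
    rw [pE, Pj_const hw] at this
    simpa using this
  have hf := H (fun σ => if b σ ≤ a σ then 1 else 0) (fun σ => by split_ifs <;> norm_num)
  rw [← h.evo hβ, ← h.cond] at hf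
  have : tvDist a b = ∑ σ, a σ * (if b σ ≤ a σ then 1 else 0) - ∑ σ, b σ * (if b σ ≤ a σ then 1 else 0) := by
    unfold tvDist
    have e : ∀ σ, |a σ - b σ| = 2 * (a σ * (if b σ ≤ a σ then 1 else 0) - b σ * (if b σ ≤ a σ then 1 else 0)) - (a σ - b σ) := by
      intro σ
      split_ifs with hh
      · rw [abs_of_nonneg lL]; ring
      · rw [abs_of_nonpos lL]; ring
    rw [sum_congr rfl fun σ _ => e σ, sum_sub_distrib, ← mul_sum, sum_sub_distrib, sum_sub_distrib, m1, m2]; ring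
  rw [this]; linarith
end ising

section gridd
variable {n : ℕ}

lemma grid_GE (n : ℕ) : GE (grid n) (gE n) where
  adj u v := by
    rw [grid, SimpleGraph.fromRel_adj]
    simp only [gE, mem_filter, mem_univ, true_and]
    constructor
    · rintro ⟨_, h⟩; exact h
    · intro h
      refine ⟨?_, h⟩
      rintro rfl
      rcases h with (⟨_, h⟩ | ⟨_, h⟩) | (⟨_, h⟩ | ⟨_, h⟩) <;> omega
  asym u v := by
    simp only [gE, mem_filter, mem_univ, true_and]
    rintro (⟨h1, h⟩ | ⟨h1, h⟩) (⟨h2, h'⟩ | ⟨h2, h'⟩)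
    · omega
    · rw [h2] at h; omega
    · rw [h1] at h'; omega
    · omega

def gidx (p : Fin n × Fin n) : ℕ := p.2.val * n + p.1.val

lemma gidx_inj : Function.Injective (gidx (n := n)) := by
  intro p q h
  unfold gidx at h
  have h1 := p.1.isLt; have h2 := q.1.isLt
  have e2 : p.2.val = q.2.val := by
    have : (p.2.val * n + p.1.val) / n = (q.2.val * n + q.1.val) / n := by rw [h]
    rwa [mul_comm, mul_comm q.2.val, Nat.mul_add_div oO, Nat.mul_add_div oO, Nat.div_eq_of_lt h1, Nat.div_eq_of_lt h2, add_zero, add_zero] at this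
  rw [e2] at h
  exact Prod.ext (Fin.ext oO) (Fin.ext e2)

lemma gidx_lt (p : Fin n × Fin n) : gidx p < n * n := by
  unfold gidx
  have h1 := p.1.isLt; have h2 := p.2.isLt
  nlinarith

lemma cross_card (r R : ℕ) (a θ b : ℕ) :
    #((gE n).filter fun e => (e.1 ∈ (sB n r R).filter (fun v => a ≤ gidx v ∧ gidx v < θ) ∧ e.2 ∈ (sB n r R).filter (fun v => θ ≤ gidx v ∧ gidx v < b)) ∨
      (e.1 ∈ (sB n r R).filter (fun v => θ ≤ gidx v ∧ gidx v < b) ∧ e.2 ∈ (sB n r R).filter (fun v => a ≤ gidx v ∧ gidx v < θ))) ≤ R + 1 := by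
  have hsub : ∀ e ∈ (gE n).filter (fun e => (e.1 ∈ (sB n r R).filter (fun v => a ≤ gidx v ∧ gidx v < θ) ∧ e.2 ∈ (sB n r R).filter (fun v => θ ≤ gidx v ∧ gidx v < b)) ∨
      (e.1 ∈ (sB n r R).filter (fun v => θ ≤ gidx v ∧ gidx v < b) ∧ e.2 ∈ (sB n r R).filter (fun v => a ≤ gidx v ∧ gidx v < θ))),
      r < e.1.1.val ∧ e.1.1.val ≤ r + R ∧ gidx e.1 < θ ∧ θ ≤ gidx e.2 ∧ ((e.1.1=e.2.1 ∧ gidx e.2 = gidx e.1 + n ∧ e.1.2.val+1=e.2.2.val) ∨ (e.1.2 = e.2.2 ∧ gidx e.2 = gidx e.1 + 1 ∧ e.1.1.val+1=e.2.1.val)) := by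
    intro e he
    simp only [mem_filter, gE, sB, mem_univ, true_and] at he
    obtain ⟨he1, he2⟩ := he
    have key : (e.1.1=e.2.1 ∧ gidx e.2 = gidx e.1 + n ∧ e.1.2.val+1=e.2.2.val) ∨ (e.1.2 = e.2.2 ∧ gidx e.2 = gidx e.1 + 1 ∧ e.1.1.val+1=e.2.1.val) := by
      rcases he1 with ⟨h1, h2⟩ | ⟨h1, h2⟩
      · exact Or.inl ⟨h1, by unfold gidx; rw [← h2, h1]; ring, h2⟩
      · exact Or.inr ⟨h1, by unfold gidx; rw [← h2, h1]; ring, h2⟩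
    rcases he2 with ⟨⟨h1, h2⟩, h3, h4⟩ | ⟨⟨h1, h2⟩, h3, h4⟩
    · exact ⟨h1.1, h1.2.1, h2.2, h4.1, key⟩
    · exfalso
      rcases key with k | k <;> omega
  have hcard : #(insert 0 (Ioc r (r + R))) ≤ R + 1 := by
    refine (card_insert_le _ _).trans ?_
    rw [Nat.card_Ioc]; omega
  refine le_trans (card_le_card_of_injOn (fun e => if e.1.1 = e.2.1 then e.1.1.val else 0) ?_ ?_) hcard
  · intro e he
    have h := hsub e he
    simp only [coe_insert, Set.mem_insert_iff, mem_coe, mem_Ioc]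
    split_ifs
    · exact Or.inr ⟨h.1, h.2.1⟩
    · exact Or.inl rfl
  · intro e he e' he' hh
    have h := hsub e he
    have h' := hsub e' he'
    have fin : gidx e.1 = gidx e'.1 → gidx e.2 = gidx e'.2 → e = e' := fun h1 h2 => Prod.ext (gidx_inj h1) (gidx_inj h2)
    dsimp only at hh
    obtain ⟨h1, h2, h3, h4, h5⟩ := h
    obtain ⟨h1', h2', h3', h4', h5'⟩ := h'
    rcases h5 with ⟨a1, a2, a3⟩ | ⟨a1, a2, a3⟩ <;> rcases h5' with ⟨b1, b2, b3⟩ | ⟨b1, b2, b3⟩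
    · rw [if_pos a1, if_pos b1] at hh
      have : gidx e.1 = gidx e'.1 := by
        unfold gidx at *
        have l1 := e.1.1.isLt
        have hc : e.1.2.val = e'.1.2.val := by
          rcases lt_trichotomy e.1.2.val e'.1.2.val with hlt | heq | hgt
          · have := Nat.mul_le_mul_right n (Nat.succ_le_of_lt hlt)
            rw [Nat.succ_mul] at this; omega
          · exact heq
          · have := Nat.mul_le_mul_right n (Nat.succ_le_of_lt hgt)
            rw [Nat.succ_mul] at this; omega
        rw [hc, hh]
      exact fin this oO
    · have : e'.1.1 ≠ e'.2.1 := fun h => by rw [h] at b3; omega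
      rw [if_pos a1, if_neg this] at hh; omega
    · have : e.1.1 ≠ e.2.1 := fun h => by rw [h] at a3; omega
      rw [if_pos b1, if_neg this] at hh; omega
    · exact fin oO oO

lemma sB_int {r R : ℕ} (h : r + R + 1 < n) {v : Fin n × Fin n} (hv : v ∈ sB n r R) : v ∉ gridBoundary n := by
  simp only [sB, gridBoundary, mem_filter, mem_univ, true_and] at *
  omega

lemma strip_apx {β : ℝ} (hβ : 0 ≤ β) {r R : ℕ} (h : r + R + 1 < n) (m : ℕ) (hm : 1 ≤ m) (d : ℕ) (hd : n * n ≤ 2^d) :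
    ∃ l : List (Fin n × Fin n), l.length ≤ (2 * m)^d ∧ apx (wE β (gE n)) (gridBoundary n) l (sB n r R) ((1 - exp (-(4 * β * (R + 1))))^m * ((2 * m)^d - 1)) := by
  have := apx_rec (wE_LW hβ (gE n)) (A := gridBoundary n) (B := sB n r R) (fun v hv => sB_int h hv) gidx gidx_inj (p := exp (-(4 * β * (R + 1))))
    (exp_pos _).le (exp_le_one_iff.2 (by have : 0 ≤ 4 * β * (R + 1) := by positivity
                                         linarith))
    (fun a θ b => by
      have := wE_hpp hβ (gE n) ((sB n r R).filter (fun v => a ≤ gidx v ∧ gidx v < θ)) ((sB n r R).filter (fun v => θ ≤ gidx v ∧ gidx v < b)) (R + 1)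
      push_cast at this
      exact this (cross_card r R a θ b)) m hm d 0
  obtain ⟨l, h1, h2⟩ := this
  refine ⟨l, h1, ?_⟩
  rwa [filter_true_of_mem] at h2
  intro v _
  exact ⟨Nat.zero_le _, by have := gidx_lt v; omega⟩
end gridd

section eqq
variable {n : ℕ} [NeZero n] {K M : ℕ} [NeZero K] [NeZero M]

def tp (n r : ℕ) : Fin n × Fin n → Bool := fun p => decide (1 ≤ p.1.val ∧ p.1.val ≤ r ∧ 1 ≤ p.2.val ∧ p.2.val + 1 < n)

def fe (β : ℝ) (σ : Fin n × Fin n → Bool) (e : (Fin n × Fin n) × (Fin n × Fin n)) : ℝ := exp (β * (spinVal (σ e.1) * spinVal (σ e.2)))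

def cE (β : ℝ) (B : Finset (Fin n × Fin n)) (τ : Fin n × Fin n → Bool) : ℝ :=
  ∏ e ∈ (gE n).filter (fun e => ¬ (e.1 ∈ B ∨ e.2 ∈ B)), fe β τ e

def Sg (β : ℝ) (B : Finset (Fin n × Fin n)) (τ : Fin n × Fin n → Bool) : ℝ :=
  ∑ σ ∈ ag B τ, ∏ e ∈ tB (gE n) B, fe β σ e

lemma ZZ_Sg (β : ℝ) (B : Finset (Fin n × Fin n)) (τ : Fin n × Fin n → Bool) : ZZ (wE β (gE n)) B τ = cE β B τ * Sg β B τ := by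
  rw [ZZ, Sg, mul_sum]
  refine sum_congr rfl fun σ hσ => ?_
  rw [wE, ← prod_filter_not_mul_prod_filter (gE n) (fun e => e.1 ∈ B ∨ e.2 ∈ B), cE, tB]
  refine congr (congrArg _ ?_) ?_
  · refine prod_congr rfl fun e he => ?_
    rw [mem_filter, not_or] at he
    rw [fe, mem_ag.1 hσ _ he.2.1, mem_ag.1 hσ _ he.2.2]
  · refine prod_congr ?_ fun e he => rfl
    ext e; simp only [mem_filter]

lemma fe_pos (β : ℝ) (σ : Fin n × Fin n → Bool) (e : (Fin n × Fin n) × (Fin n × Fin n)) : 0 < fe β σ e := exp_pos _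

lemma cE_pos (β : ℝ) (B : Finset (Fin n × Fin n)) (τ : Fin n × Fin n → Bool) : 0 < cE β B τ := prod_pos fun _ _ => fe_pos _ _ _

lemma cE_ratio (β : ℝ) {r L R : ℕ} (hL1 : 1 ≤ L) (hLR : L ≤ R) :
    cE β (sB n r L) (tp n r) * cE β (sB n r R) ⊥ = cE β (sB n r L) ⊥ * cE β (sB n r R) (tp n r) := by
  have hs : sB n r L ⊆ sB n r R := fun p hp => by
    simp only [sB, mem_filter, mem_univ, true_and] at *; omega
  have hsub : (gE n).filter (fun e => ¬ (e.1 ∈ sB n r R ∨ e.2 ∈ sB n r R)) ⊆ (gE n).filter (fun e => ¬ (e.1 ∈ sB n r L ∨ e.2 ∈ sB n r L)) := by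
    intro e he
    rw [mem_filter] at *
    exact ⟨he.1, fun h => he.2 (h.imp (fun h => hs h) (fun h => hs h))⟩
  have h1 : ∀ τ, cE β (sB n r L) τ = (∏ e ∈ (gE n).filter (fun e => ¬ (e.1 ∈ sB n r L ∨ e.2 ∈ sB n r L)) \ (gE n).filter (fun e => ¬ (e.1 ∈ sB n r R ∨ e.2 ∈ sB n r R)), fe β τ e) * cE β (sB n r R) τ := by
    intro τ
    exact (prod_sdiff hsub).symm
  rw [h1, h1]
  have h2 : ∀ e ∈ (gE n).filter (fun e => ¬ (e.1 ∈ sB n r L ∨ e.2 ∈ sB n r L)) \ (gE n).filter (fun e => ¬ (e.1 ∈ sB n r R ∨ e.2 ∈ sB n r R)), fe β (tp n r) e = fe β ⊥ e := by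
    intro e he
    have hh : r < e.1.1.val ∧ r < e.2.1.val := by
      simp only [mem_sdiff, mem_filter, gE, sB, mem_univ, true_and, not_and, not_not, Fin.ext_iff] at he
      obtain ⟨⟨h1, h2⟩, h3⟩ := he
      have h3 := h3 h1
      omega
    have t1 : tp n r e.1 = false := by simp only [tp, decide_eq_false_iff_not]; omega
    have t2 : tp n r e.2 = false := by simp only [tp, decide_eq_false_iff_not]; omega
    rw [fe, fe, t1, t2]; rfl
  rw [prod_congr rfl h2]; ring

abbrev GG (K M : ℕ) [NeZero K] [NeZero M] (β : ℝ) (m R : ℕ) : ℝ := cG (exp (-(2 * β))) (rE K M m R) (pt K M 0 0) (pt K M m 0)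

lemma Sg_ratio {β : ℝ} (hβ : 0 ≤ exp (-(2*β)) ∧ exp (-(2*β)) ≤ 1/2) {m r R : ℕ} (hm : m + 1 < K) (hR : R + 1 < M) (hn : n = m + 2) (hr : r + R + 1 < n) (hm1 : 1 ≤ m) (hR1 : 1 ≤ R) (hr1 : 1 ≤ r) :
    Sg β (sB n r R) (tp n r) = GG K M β m R * Sg β (sB n r R) ⊥ := by
  have d1 := dual (K := K) (M := M) β hm hR hn hr hm1 hR1 true (tp n r) (by
    intro j hj i hi _
    simp only [tp, Bool.true_and]
    congr 1
    rw [gp_v1 _ oO, gp_v2 _ oO]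
    refine propext ⟨fun h => ?_, fun h => ?_⟩ <;> omega)
  have d2 := dual (K := K) (M := M) β hm hR hn hr hm1 hR1 false ⊥ (by
    intro j hj i hi _
    simp)
  simp only [if_true] at d1
  simp only [Bool.false_eq_true, if_false] at d2
  change Sg β (sB n r R) (tp n r) * _ = _ at d1
  change Sg β (sB n r R) ⊥ * _ = _ at d2
  have hp : (0:ℝ) < 2 ^ (Fintype.card (ZMod K × ZMod M)) := by positivity
  have hb := bS_one_pos hβ.1 (by linarith [hβ.2]) (rE K M m R)
  refine mul_right_cancel₀ hp.ne' ?_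
  rw [d1, mul_assoc, d2, GG, cG]
  field_simp

lemma Sg_pos (β : ℝ) (B : Finset (Fin n × Fin n)) (τ : Fin n × Fin n → Bool) : 0 < Sg β B τ :=
  sum_pos (fun _ _ => prod_pos fun _ _ => fe_pos _ _ _) ⟨τ, ag_self _ _⟩

lemma EQ {β : ℝ} (hβ0 : 0 ≤ β) (hβ : exp (-(2*β)) ≤ 1/2) {m r L R : ℕ} (hm : m + 1 < K) (hR : R + 1 < M) (hn : n = m + 2) (hr : r + R + 1 < n) (hm1 : 1 ≤ m)
    (hL1 : 1 ≤ L) (hLR : L ≤ R) (hr1 : 1 ≤ r) {F : (Fin n × Fin n → Bool) → ℝ} {D : ℝ} (hF : ∀ σ, 0 ≤ F σ ∧ F σ ≤ D)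
    (hd : ∀ σ σ', (∀ p : Fin n × Fin n, r + L < p.1.val → σ p = σ' p) → F σ = F σ') :
    GG K M β m R * (Pj (wE β (gE n)) (sB n r R) F (tp n r) - Pj (wE β (gE n)) (sB n r R) F ⊥) ≤ (GG K M β m R - GG K M β m L) * D := by
  have hw := wE_LW hβ0 (gE n)
  have hβ' : 0 ≤ exp (-(2*β)) ∧ exp (-(2*β)) ≤ 1/2 := ⟨(exp_pos _).le, hβ⟩
  have hs : sB n r L ⊆ sB n r R := fun p hp => by
    simp only [sB, mem_filter, mem_univ, true_and] at *; omega
  have hdj : Disjoint (sB n r R \ sB n r L) (sB n r L) := sdiff_disjoint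
  have hun : sB n r R = (sB n r R \ sB n r L) ∪ sB n r L := (sdiff_union_of_subset hs).symm
  have main : ∀ H : (Fin n × Fin n → Bool) → ℝ, 0 ≤ H → (∀ σ σ', (∀ p : Fin n × Fin n, r + L < p.1.val → σ p = σ' p) → H σ = H σ') →
      ZF (wE β (gE n)) (sB n r R) H ⊥ * ZZ (wE β (gE n)) (sB n r L) (tp n r) ≤ ZZ (wE β (gE n)) (sB n r L) ⊥ * ZF (wE β (gE n)) (sB n r R) H (tp n r) := by
    intro H hH hHd
    have inv : ∀ ξ, ZF (wE β (gE n)) (sB n r L) H ξ = H ξ * ZZ (wE β (gE n)) (sB n r L) ξ := by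
      intro ξ
      rw [ZF, ZZ, mul_sum]
      refine sum_congr rfl fun σ hσ => ?_
      rw [hHd σ ξ, mul_comm]
      intro p hp
      refine mem_ag.1 hσ p ?_
      simp only [sB, mem_filter, mem_univ, true_and]; omega
    have hbij : ∑ ξ ∈ ag (sB n r R \ sB n r L) (tp n r), H ξ * ZZ (wE β (gE n)) (sB n r L) ξ =
        ∑ ξ ∈ ag (sB n r R \ sB n r L) ⊥, H (ξ ⊔ tp n r) * ZZ (wE β (gE n)) (sB n r L) (ξ ⊔ tp n r) := by
      have htp : ∀ p ∈ sB n r R \ sB n r L, tp n r p = false := by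
        intro p hp
        simp only [mem_sdiff, sB, mem_filter, mem_univ, true_and, tp, decide_eq_false_iff_not] at *; omega
      symm
      refine sum_bij (fun ξ _ => ξ ⊔ tp n r) ?_ ?_ ?_ (fun _ _ => rfl)
      · intro ξ hξ
        refine mem_ag.2 fun p hp => ?_
        rw [Pi.sup_apply, mem_ag.1 hξ p hp]; simp
      · intro ξ hξ ξ' hξ' he
        funext p
        by_cases hp : p ∈ sB n r R \ sB n r L
        · have := congrFun he p
          simpa [htp p hp] using this
        · rw [mem_ag.1 hξ p hp, mem_ag.1 hξ' p hp]
      · intro ζ hζ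
        refine ⟨fun p => if p ∈ sB n r R \ sB n r L then ζ p else false, mem_ag.2 fun p hp => by simp only [hp, if_false]; rfl, ?_⟩
        funext p
        by_cases hp : p ∈ sB n r R \ sB n r L
        · simp only [Pi.sup_apply, hp, if_true, htp p hp]; simp
        · rw [mem_ag.1 hζ p hp]; simp only [Pi.sup_apply, hp, if_false]; simp
    rw [hun, ZF_split hdj, ZF_split hdj]
    simp only [inv]
    rw [hbij, sum_mul, mul_sum]
    refine sum_le_sum fun ξ hξ => ?_
    have hHe : H (ξ ⊔ tp n r) = H ξ := by
      refine hHd _ _ fun p hp => ?_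
      have : tp n r p = false := by simp only [tp, decide_eq_false_iff_not]; omega
      rw [Pi.sup_apply, this]; simp
    have lat := ZZ_lat hw (sB n r L) ξ (tp n r) ⊥ (ξ ⊔ tp n r) (by
      intro p _
      rw [Pi.inf_apply]
      by_cases hp : p ∈ sB n r R \ sB n r L
      · have : tp n r p = false := by
          simp only [mem_sdiff, sB, mem_filter, mem_univ, true_and, tp, decide_eq_false_iff_not] at *; omega
        rw [this]; simp
      · rw [mem_ag.1 hξ p hp]; simp) (fun _ _ => rfl)
    rw [hHe]
    calc _ = H ξ * (ZZ (wE β (gE n)) (sB n r L) ξ * ZZ (wE β (gE n)) (sB n r L) (tp n r)) := by ring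
      _ ≤ H ξ * (ZZ (wE β (gE n)) (sB n r L) ⊥ * ZZ (wE β (gE n)) (sB n r L) (ξ ⊔ tp n r)) := mll lat (hH ξ)
      _ = _ := by ring
  have sR := Sg_ratio (K := K) (M := M) hβ' hm hR hn hr hm1 (hL1.trans hLR) hr1
  have sL := Sg_ratio (K := K) (M := M) (r := r) (R := L) hβ' hm oO hn oO hm1 hL1 hr1
  have cr := cE_ratio (n := n) β (r := r) hL1 hLR
  have main2 : ∀ H : (Fin n × Fin n → Bool) → ℝ, 0 ≤ H → (∀ σ σ', (∀ p : Fin n × Fin n, r + L < p.1.val → σ p = σ' p) → H σ = H σ') →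
      GG K M β m L * Pj (wE β (gE n)) (sB n r R) H ⊥ ≤ GG K M β m R * Pj (wE β (gE n)) (sB n r R) H (tp n r) := by
    intro H h1 h2
    have h3 := main H h1 h2
    have e : ∀ τ, ZF (wE β (gE n)) (sB n r R) H τ = ZZ (wE β (gE n)) (sB n r R) τ * Pj (wE β (gE n)) (sB n r R) H τ := by
      intro τ
      have := ZZ_pos hw (sB n r R) τ
      rw [Pj]; field_simp
    rw [e, e] at h3
    simp only [ZZ_Sg, sR, sL] at h3
    set P1 := Pj (wE β (gE n)) (sB n r R) H ⊥
    set P2 := Pj (wE β (gE n)) (sB n r R) H (tp n r)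
    have pos : 0 < cE β (sB n r L) (tp n r) * cE β (sB n r R) ⊥ * Sg β (sB n r R) ⊥ * Sg β (sB n r L) ⊥ :=
      mul_pos (mul_pos (mul_pos (cE_pos _ _ _) (cE_pos _ _ _)) (Sg_pos _ _ _)) (Sg_pos _ _ _)
    refine le_of_mul_le_mul_left ?_ pos
    calc _ = _ := by ring
      _ ≤ _ := h3
      _ = (cE β (sB n r L) ⊥ * cE β (sB n r R) (tp n r)) * Sg β (sB n r R) ⊥ * Sg β (sB n r L) ⊥ * (GG K M β m R * P2) := by ring
      _ = _ := by rw [← cr]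
  have k1 := main2 (fun σ => D - F σ) (fun σ => sub_nonneg.2 (hF σ).2) (fun σ σ' h => by rw [hd σ σ' h])
  have k2 := main2 1 zero_le_one (fun _ _ _ => rfl)
  have e : (fun σ => D - F σ) = (fun _ => D) - F := rfl
  rw [e, Pj_sub, Pj_const hw] at k1
  rw [Pj_one hw] at k2
  simp only [Pi.sub_apply, Pi.one_apply, mul_one] at k1 k2
  have b := Pj_bd hw (sB n r R) hF ⊥
  nlinarith [mul_nonneg (sub_nonneg.2 k2) b.1]
end eqq

section sweep
variable {n : ℕ}

def Rr (n r : ℕ) := sB n r (n - 2 - r)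
def Br (n L r : ℕ) := sB n r (min (L + 1) (n - 2 - r))

lemma mem_Rr {r : ℕ} (hr : r + 2 ≤ n) {p : Fin n × Fin n} : p ∈ Rr n r ↔ r < p.1.val ∧ p.1.val + 1 < n ∧ 1 ≤ p.2.val ∧ p.2.val + 1 < n := by
  simp only [Rr, sB, mem_filter, mem_univ, true_and]; omega

lemma mem_Br {L r : ℕ} (hr : r + 2 ≤ n) {p : Fin n × Fin n} : p ∈ Br n L r ↔ r < p.1.val ∧ p.1.val ≤ r + 1 + L ∧ p.1.val + 1 < n ∧ 1 ≤ p.2.val ∧ p.2.val + 1 < n := by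
  simp only [Br, sB, mem_filter, mem_univ, true_and]; omega

def EQh (w : (Fin n × Fin n → Bool) → ℝ) (L : ℕ) (δ : ℝ) : Prop :=
  ∀ r, 1 ≤ r → r + 2 ≤ n → ∀ (F : (Fin n × Fin n → Bool) → ℝ) (D : ℝ), (∀ σ, 0 ≤ F σ ∧ F σ ≤ D) →
    (∀ σ σ', (∀ p : Fin n × Fin n, r + L < p.1.val → σ p = σ' p) → F σ = F σ') →
    Pj w (Rr n r) F (tp n r) - Pj w (Rr n r) F ⊥ ≤ δ * D

variable {w : (Fin n × Fin n → Bool) → ℝ}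

def frz (L r : ℕ) (τ σ : Fin n × Fin n → Bool) : Fin n × Fin n → Bool := fun p => if p.1.val ≤ r + 1 + L then τ p else σ p

lemma frz_mono (L r : ℕ) (τ : Fin n × Fin n → Bool) : Monotone (frz L r τ) := by
  intro σ σ' h p
  simp only [frz]; split_ifs
  · exact le_rfl
  · exact h p

lemma Pj_eq_of (hw : LW w) {B : Finset (Fin n × Fin n)} {F G : (Fin n × Fin n → Bool) → ℝ} {τ : Fin n × Fin n → Bool} (h : ∀ σ ∈ ag B τ, F σ = G σ) : Pj w B F τ = Pj w B G τ :=
  le_antisymm (Pj_mono' hw fun σ hσ => (h σ hσ).le) (Pj_mono' hw fun σ hσ => (h σ hσ).ge)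

lemma frz_eq {L r k : ℕ} (hr : r + 2 ≤ n) (hk : k + 2 ≤ n) (hrk : r ≤ k) (hk1 : k ≤ r + 1) {τ τ' : Fin n × Fin n → Bool} (ht : ∀ p, p ∉ Br n L r → p ∉ Rr n k → p.1.val ≤ r + 1 + L → τ' p = τ p)
    (H0 : (Fin n × Fin n → Bool) → ℝ) {σ : Fin n × Fin n → Bool} (hσ : σ ∈ ag (Rr n k) τ') : Pj w (Br n L r) H0 σ = Pj w (Br n L r) H0 (frz L r τ σ) := by
  refine Pj_congr (fun p hp => ?_) H0
  simp only [frz]; split_ifs with h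
  · have : p ∉ Rr n k := by
      rw [mem_Rr hk]; rw [mem_Br hr] at hp; omega
    rw [mem_ag.1 hσ p this, ht p hp this h]
  · rfl

lemma Br_sub {L r : ℕ} (hr : r + 2 ≤ n) : Br n L r ⊆ Rr n r := fun p hp => by
  rw [mem_Rr hr]; rw [mem_Br hr] at hp; omega

lemma Rr_sub {r : ℕ} (hr : r + 3 ≤ n) : Rr n (r+1) ⊆ Rr n r := fun p hp => by
  rw [mem_Rr oO] at *; omega

lemma step_up (hw : LW w) {L : ℕ} {δ : ℝ} (hE : EQh w L δ) {r : ℕ} (hr : r + 3 ≤ n) {F : (Fin n × Fin n → Bool) → ℝ} {D : ℝ} (hF : ∀ σ, 0 ≤ F σ ∧ F σ ≤ D) (hm : Monotone F) :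
    Pj w (Rr n (r+1)) (Pj w (Br n L r) F) (tp n (r+1)) ≤ Pj w (Rr n r) F (tp n r) + δ * D := by
  set H := Pj w (Br n L r) F with hH
  set H' : (Fin n × Fin n → Bool) → ℝ := fun σ => H (frz L r (tp n r) σ) with hH'
  have mono : Monotone H' := (Pj_monotone hw _ hm).comp (frz_mono L r _)
  have e1 : Pj w (Rr n (r+1)) H (tp n (r+1)) = Pj w (Rr n (r+1)) H' (tp n (r+1)) :=
    Pj_eq_of hw fun σ hσ => frz_eq oO oO oO le_rfl (by
      intro p h1 h2 h3
      rw [mem_Br oO] at h1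
      simp only [tp]; congr 1; refine propext ⟨fun h => ?_, fun h => ?_⟩ <;> omega) F hσ
  have e2 : Pj w (Rr n r) F (tp n r) = Pj w (Rr n r) H' (tp n r) := by
    rw [← Pj_tower hw (Br_sub (L := L) (n := n) (r := r) oO) F]
    exact Pj_eq_of hw fun σ hσ => frz_eq oO oO le_rfl oO (fun _ _ _ _ => rfl) F hσ
  have e3 := hE (r+1) oO oO H' D (fun σ => Pj_bd hw _ hF _) (by
    intro σ σ' h
    simp only [hH']; congr 1; funext p
    simp only [frz]; split_ifs with hp
    · rfl
    · exact h p oO)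
  have e4 : Pj w (Rr n (r+1)) H' ⊥ ≤ Pj w (Rr n r) H' (tp n r) := by
    rw [← Pj_tower hw (Rr_sub hr) H']
    have := Pj_mono hw (Rr n r) (F := fun _ => Pj w (Rr n (r+1)) H' ⊥) (G := Pj w (Rr n (r+1)) H') (fun σ => Pj_monotone hw _ mono bot_le) (tp n r)
    rwa [Pj_const hw] at this
  rw [e1, e2]; linarith

lemma step_dn (hw : LW w) {L : ℕ} {δ : ℝ} (hE : EQh w L δ) {r : ℕ} (hr : r + 3 ≤ n) {F : (Fin n × Fin n → Bool) → ℝ} {D : ℝ} (hF : ∀ σ, 0 ≤ F σ ∧ F σ ≤ D) (hm : Monotone F) :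
    Pj w (Rr n r) F ⊥ - δ * D ≤ Pj w (Rr n (r+1)) (Pj w (Br n L r) F) ⊥ := by
  set H := Pj w (Br n L r) F with hH
  set H' : (Fin n × Fin n → Bool) → ℝ := fun σ => H (frz L r ⊥ σ) with hH'
  have mono : Monotone H' := (Pj_monotone hw _ hm).comp (frz_mono L r _)
  have e1 : Pj w (Rr n (r+1)) H ⊥ = Pj w (Rr n (r+1)) H' ⊥ :=
    Pj_eq_of hw fun σ hσ => frz_eq oO oO oO le_rfl (fun _ _ _ _ => rfl) F hσ
  have e2 : Pj w (Rr n r) F ⊥ = Pj w (Rr n r) H' ⊥ := by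
    rw [← Pj_tower hw (Br_sub (L := L) (n := n) (r := r) oO) F]
    exact Pj_eq_of hw fun σ hσ => frz_eq oO oO le_rfl oO (fun _ _ _ _ => rfl) F hσ
  have e3 := hE (r+1) oO oO H' D (fun σ => Pj_bd hw _ hF _) (by
    intro σ σ' h
    simp only [hH']; congr 1; funext p
    simp only [frz]; split_ifs with hp
    · rfl
    · exact h p oO)
  have e4 : Pj w (Rr n r) H' ⊥ ≤ Pj w (Rr n (r+1)) H' (tp n (r+1)) := by
    rw [← Pj_tower hw (Rr_sub hr) H']
    have := Pj_mono' hw (B := Rr n r) (G := fun _ => Pj w (Rr n (r+1)) H' (tp n (r+1))) (F := Pj w (Rr n (r+1)) H') (τ := ⊥) (fun σ hσ => by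
      rw [Pj_congr (τ := σ) (τ' := fun p => if p ∈ Rr n (r+1) then false else σ p) (fun p hp => by simp [hp])]
      refine Pj_monotone hw _ mono fun p => ?_
      dsimp only
      split_ifs with hp
      · exact bot_le
      · by_cases h2 : p ∈ Rr n r
        · have : tp n (r+1) p = true := by
            rw [mem_Rr oO] at hp h2
            simp only [tp, decide_eq_true_iff]; omega
          rw [this]; exact le_top
        · rw [mem_ag.1 hσ p h2]; exact bot_le)
    rwa [Pj_const hw] at this
  rw [e1, e2]; linarith

def GGs (w : (Fin n × Fin n → Bool) → ℝ) (L : ℕ) (F : (Fin n × Fin n → Bool) → ℝ) : ℕ → (Fin n × Fin n → Bool) → ℝ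
  | 0 => F
  | r+1 => Pj w (Br n L r) (GGs w L F r)

lemma GGs_prop (hw : LW w) {L : ℕ} {δ : ℝ} (hE : EQh w L δ) {F : (Fin n × Fin n → Bool) → ℝ} {D : ℝ} (hF : ∀ σ, 0 ≤ F σ ∧ F σ ≤ D) (hm : Monotone F)
    (r : ℕ) (hr : r + 2 ≤ n) : Monotone (GGs w L F r) ∧ (∀ σ, 0 ≤ GGs w L F r σ ∧ GGs w L F r σ ≤ D) ∧
      Pj w (Rr n r) (GGs w L F r) (tp n r) ≤ Pj w (Rr n 0) F ⊥ + r * (δ * D) ∧ Pj w (Rr n 0) F ⊥ - r * (δ * D) ≤ Pj w (Rr n r) (GGs w L F r) ⊥ := by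
  induction r with
  | zero =>
    refine ⟨hm, hF, ?_, by simp [GGs]⟩
    have : tp n 0 = ⊥ := by
      funext p
      have : tp n 0 p = false := by simp only [tp, decide_eq_false_iff_not]; omega
      rw [this]; rfl
    rw [this]; simp [GGs]
  | succ r ih =>
    obtain ⟨h1, h2, h3, h4⟩ := ih oO
    have u := step_up hw hE (r := r) oO h2 h1
    have d := step_dn hw hE (r := r) oO h2 h1
    refine ⟨Pj_monotone hw _ h1, fun σ => Pj_bd hw _ h2 σ, ?_, ?_⟩
    · push_cast; rw [GGs]; linarith
    · push_cast; rw [GGs]; linarith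

lemma Rr_zero (hn : 2 ≤ n) : Rr n 0 = (gridBoundary n)ᶜ := by
  ext p
  rw [mem_Rr oO, mem_compl]
  simp only [gridBoundary, mem_filter, mem_univ, true_and]
  omega

lemma tp_top (hn : 2 ≤ n) : tp n (n-2) = topA (gridBoundary n) := by
  funext p
  have := p.1.isLt
  have := p.2.isLt
  simp only [tp, topA, gridBoundary, mem_filter, mem_univ, true_and]
  congr 1
  refine propext ⟨fun h => ?_, fun h => ?_⟩ <;> omega

lemma Rr_last (hn : 2 ≤ n) (F : (Fin n × Fin n → Bool) → ℝ) (hw : LW w) (τ : Fin n × Fin n → Bool) : Pj w (Rr n (n-2)) F τ = F τ := by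
  refine Pj_fix hw fun σ hσ => ?_
  rw [show σ = τ from funext fun x => mem_ag.1 hσ x (by rw [mem_Rr oO]; omega)]

lemma sweep_apx (hw : LW w) {L Λ : ℕ} {e : ℝ} (h : ∀ r, r + 2 ≤ n → ∃ l : List (Fin n × Fin n), l.length ≤ Λ ∧ apx w (gridBoundary n) l (Br n L r) e) (r : ℕ) (hr : r + 2 ≤ n) :
    ∃ l : List (Fin n × Fin n), l.length ≤ r * Λ ∧ ∀ (D : ℝ) (F : (Fin n × Fin n → Bool) → ℝ), (∀ σ, 0 ≤ F σ ∧ F σ ≤ D) → ∀ σ, |Ks w (gridBoundary n) l F σ - GGs w L F r σ| ≤ r * e * D := by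
  induction r with
  | zero => exact ⟨[], by simp, fun D F hF σ => by simp [Ks, GGs]⟩
  | succ r ih =>
    obtain ⟨l, h1, h2⟩ := ih oO
    obtain ⟨l', h1', h2'⟩ := h r oO
    refine ⟨l' ++ l, ?_, fun D F hF σ => ?_⟩
    · rw [List.length_append]; nlinarith
    · rw [Ks_append, GGs]
      have a1 := h2' D (Ks w (gridBoundary n) l F) (Ks_bd hw (gridBoundary n) l hF) σ
      have a2 := Pj_lip hw (Br n L r) (h2 D F hF) σ
      rw [abs_le] at *
      push_cast
      constructor <;> linarith [a1.1, a1.2, a2.1, a2.2]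

lemma sweep {β : ℝ} (hβ : 0 ≤ β) (hn : 2 ≤ n) {L : ℕ} {δ : ℝ} (hE : EQh (wE β (gE n)) L δ) (m : ℕ) (hm : 1 ≤ m) (d : ℕ) (hd : n * n ≤ 2^d) :
    ∃ l : List (Fin n × Fin n), l.length ≤ n * (2 * m)^d ∧ ∀ (D : ℝ) (F : (Fin n × Fin n → Bool) → ℝ), (∀ σ, 0 ≤ F σ ∧ F σ ≤ D) → Monotone F →
      Ks (wE β (gE n)) (gridBoundary n) l F (topA (gridBoundary n)) ≤ pE (wE β (gE n)) (gridBoundary n) F + (n - 2 : ℕ) * ((1 - exp (-(4 * β * (L + 2))))^m * (2 * m)^d + δ) * D ∧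
      pE (wE β (gE n)) (gridBoundary n) F - (n - 2 : ℕ) * ((1 - exp (-(4 * β * (L + 2))))^m * (2 * m)^d + δ) * D ≤ Ks (wE β (gE n)) (gridBoundary n) l F ⊥ := by
  have hw := wE_LW hβ (gE n)
  obtain ⟨l, h1, h2⟩ := sweep_apx hw (L := L) (Λ := (2*m)^d) (e := (1 - exp (-(4 * β * (L + 2))))^m * (2 * m)^d) (by
    intro r hr
    obtain ⟨l, h1, h2⟩ := strip_apx hβ (n := n) (r := r) (R := min (L + 1) (n - 2 - r)) oO m hm d hd
    refine ⟨l, h1, fun D F hF σ => (h2 D F hF σ).trans (mlr ?_ ((hF σ).1.trans (hF σ).2))⟩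
    have hR : ((min (L + 1) (n - 2 - r) : ℕ) : ℝ) ≤ L + 1 := by exact_mod_cast min_le_left _ _
    have hx : exp (-(4 * β * (L + 2))) ≤ exp (-(4 * β * ((min (L + 1) (n - 2 - r) : ℕ) + 1))) := by
      rw [exp_le_exp]; nlinarith
    have hx1 : exp (-(4 * β * ((min (L + 1) (n - 2 - r) : ℕ) + 1))) ≤ 1 := exp_le_one_iff.2 (by
      have : 0 ≤ 4 * β * (((min (L + 1) (n - 2 - r) : ℕ) : ℝ) + 1) := by positivity
      linarith)
    have hp : (1 - exp (-(4 * β * ((min (L + 1) (n - 2 - r) : ℕ) + 1))))^m ≤ (1 - exp (-(4 * β * (L + 2))))^m := pow_le_pow_left₀ lL lL m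
    have hp0 : 0 ≤ (1 - exp (-(4 * β * ((min (L + 1) (n - 2 - r) : ℕ) + 1))))^m := pow_nonneg lL m
    have hq : (0:ℝ) ≤ (2 * m)^d := by positivity
    calc _ ≤ (1 - exp (-(4 * β * ((min (L + 1) (n - 2 - r) : ℕ) + 1))))^m * (2 * m)^d := mll lL hp0
      _ ≤ _ := mlr hp hq) (n-2) oO
  refine ⟨l, h1.trans (Nat.mul_le_mul_right _ oO), fun D F hF hmono => ?_⟩
  obtain ⟨_, _, g3, g4⟩ := GGs_prop hw hE hF hmono (n-2) oO
  rw [Rr_last hn _ hw] at g3 g4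
  rw [tp_top hn] at g3
  rw [Rr_zero hn] at g3 g4
  have a1 := h2 D F hF (topA (gridBoundary n))
  have a2 := h2 D F hF ⊥
  rw [abs_le] at a1 a2
  unfold pE
  constructor <;> linarith [a1.2, a2.1]
end sweep

section eqh
variable {n : ℕ} {K M : ℕ} [NeZero K] [NeZero M]

lemma rE_mono (m : ℕ) {L R : ℕ} (h : L ≤ R) : rE K M m L ⊆ rE K M m R := by
  intro e he
  simp only [rE, rc, mem_filter, mem_univ, true_and] at *
  refine ⟨he.1, ⟨he.2.1.1, ?_⟩, ⟨he.2.2.1, ?_⟩⟩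
  · exact he.2.1.2.trans h
  · exact he.2.2.2.trans h

lemma EQh_of {β : ℝ} (hβ0 : 0 ≤ β) (hβ : exp (-(2*β)) ≤ 1/1000) (I h L l i0 : ℕ) (hn : 3 ≤ n) (hMI : M = 4 * 2 ^ I) (hK : K = 2 * h)
    (hh : 2 * (2 ^ I + M + 1) ≤ h) (hnI : n ≤ 2 ^ I) (hL : 1 ≤ L) (hl : 2 * l ≤ L) (hlm : 2 * l ≤ n - 2) (hi0 : i0 ≤ I)
    (H : (K * M * 4 ^ (I + 3) * exp (-(2 * (1/10 * (2/3) ^ I * l)))) * (4 * M * 4 ^ (I + 3)) ≤ 1) {δ : ℝ} (hδ0 : 0 ≤ δ)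
    (hδ : (K * M * exp (-(2 * (1/10 * (2/3) ^ i0 * L))) * 2 ^ (2 * i0 + 4 + (n - 2) / 2 ^ i0) * (4 * M * 4 ^ (I + 3))) ≤ δ * exp (-(2*β)) ^ (4 * l + 1)) :
    EQh (wE β (gE n)) L δ := by
  intro r hr1 hr F D hF hd
  have hw := wE_LW hβ0 (gE n)
  have hD : 0 ≤ D := (hF ⊥).1.trans (hF ⊥).2
  have : NeZero n := ⟨by omega⟩
  by_cases hc : r + L ≤ n - 2
  · have ht : 0 < exp (-(2*β)) := exp_pos _
    have g := geo (K := K) (M := M) ht hβ I h (n-2) (n-2-r) L l i0 hMI hK hh oO oO oO hl hlm hi0 H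
    have q := EQ (n := n) (K := K) (M := M) hβ0 lL (m := n-2) (r := r) (L := L) (R := n-2-r) oO oO oO oO oO hL oO hr1 hF hd
    have hpos : 0 < GG K M β (n-2) (n-2-r) := by
      have := rE_hor (K := K) (M := M) ht.le lL (n-2) (n-2-r) 0 0 (n-2) oO oO oO oO
      rw [zero_add] at this
      exact (pow_pos ht _).trans_le this
    have hmo : GG K M β (n-2) L ≤ GG K M β (n-2) (n-2-r) := cG_mono ht.le lL (rE_mono _ oO) _ _
    have h0 : 0 ≤ GG K M β (n-2) L := cG_nonneg ht.le lL _ _ _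
    have hk := pow_pos ht (4*l+1)
    have s1 : (GG K M β (n-2) (n-2-r) - GG K M β (n-2) L) * exp (-(2*β)) ^ (4 * l + 1) ≤ (δ * GG K M β (n-2) (n-2-r)) * exp (-(2*β)) ^ (4 * l + 1) := by
      refine g.trans ((mlr hδ h0).trans ?_)
      have := mll hmo (mul_nonneg hδ0 hk.le)
      linarith
    have s2 := le_of_mul_le_mul_right s1 hk
    have s3 := q.trans (mlr s2 hD)
    rw [show δ * GG K M β (n-2) (n-2-r) * D = GG K M β (n-2) (n-2-r) * (δ * D) by ring] at s3
    exact le_of_mul_le_mul_left s3 hpos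
  · have key : ∀ τ, Pj (wE β (gE n)) (Rr n r) F τ = F τ := fun τ => Pj_fix hw fun σ hσ =>
      hd _ _ fun p hp => mem_ag.1 hσ p (by rw [mem_Rr hr]; omega)
    rw [key, key, hd (tp n r) ⊥ fun p hp => by
      have : tp n r p = false := by simp only [tp, decide_eq_false_iff_not]; omega
      rw [this]; rfl]
    simpa using mul_nonneg hδ0 hD

end eqh

section tvs
variable {U : Type*} [Fintype U] [DecidableEq U] {w : Fn U}

def xv (v : U) (σ : U → Bool) : ℝ := if σ v then 1 else 0

lemma xv_bd (v : U) (σ : U → Bool) : 0 ≤ xv v σ ∧ xv v σ ≤ 1 := by unfold xv; split_ifs <;> norm_num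

lemma bool_tf : ¬ ((true : Bool) ≤ false) := by decide

lemma xv_mono (v : U) : Monotone (xv v) := by
  intro σ τ h
  have := h v
  unfold xv
  cases h1 : σ v <;> cases h2 : τ v
  · simp
  · simp
  · rw [h1, h2] at this; exact absurd this bool_tf
  · simp

lemma Pop_xv [Nonempty U] (hw : LW w) {A : Finset U} {v : U} (hv : v ∈ A) : Pop w A (xv v) = rr U • xv v := by
  have hk : ∀ u, Kop w A u (xv v) = if u = v then 0 else xv v := by
    intro u
    funext σ
    by_cases huv : u = v
    · subst huv; simp [Kop, hv, xv]
    · rw [if_neg huv]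
      simp only [Kop]
      split_ifs
      · simp only [xv]; rw [Function.update_of_ne (Ne.symm huv)]
      · refine Pj_fix hw fun τ hτ => ?_
        simp only [xv]
        rw [mem_ag.1 hτ v (by simpa using Ne.symm huv)]
  have hN : (Fintype.card U : ℝ) ≠ 0 := by exact_mod_cast Fintype.card_ne_zero
  have hs : ∑ u : U, Kop w A u (xv v) = ((Fintype.card U : ℝ) - 1) • xv v := by
    simp only [hk]
    have e : ∀ u : U, (if u = v then (0 : Fn U) else xv v) = xv v - (if u = v then xv v else 0) := by
      intro u; split_ifs <;> simp
    simp only [e, sum_sub_distrib, sum_ite_eq', mem_univ, if_true, sum_const, card_univ]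
    rw [sub_smul, one_smul, Nat.cast_smul_eq_nsmul]
  rw [Pop, hs, smul_smul, rr]
  congr 1
  field_simp

lemma iter_xv [Nonempty U] (hw : LW w) {A : Finset U} (T : ℕ) (B : Finset U) (hB : B ⊆ A) : (Pop w A)^[T] (∑ v ∈ B, xv v) = (rr U)^T • ∑ v ∈ B, xv v := by
  have h1 : ∀ v ∈ A, ∀ T, (Pop w A)^[T] (xv v) = (rr U)^T • xv v := by
    intro v hv T
    induction T with
    | zero => simp
    | succ T ih => rw [Function.iterate_succ_apply', ih, Pop_smul, Pop_xv hw hv, smul_smul, pow_succ]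
  induction B using Finset.induction_on with
  | empty =>
    simp only [sum_empty, smul_zero]
    exact iter_const hw A 0 T
  | insert a s ha ih =>
    rw [sum_insert ha, iter_add, ih (fun x hx => hB (mem_insert_of_mem hx)), h1 a (hB (mem_insert_self _ _)), smul_add]

lemma iter_bd [Nonempty U] (hw : LW w) (A : Finset U) {F : Fn U} {D : ℝ} (h : ∀ σ, 0 ≤ F σ ∧ F σ ≤ D) (T : ℕ) (σ : U → Bool) :
    0 ≤ (Pop w A)^[T] F σ ∧ (Pop w A)^[T] F σ ≤ D := by
  have a := iter_mono hw A (F := fun _ => 0) (G := F) (fun σ => (h σ).1) T σ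
  have b := iter_mono hw A (F := F) (G := fun _ => D) (fun σ => (h σ).2) T σ
  rw [iter_const hw] at a b
  exact ⟨a, b⟩

lemma iter_top [Nonempty U] (hw : LW w) (A : Finset U) {F : Fn U} {D : ℝ} (h : ∀ σ, 0 ≤ F σ ∧ F σ ≤ D) (hF : Monotone F) (T s : ℕ) (σ : U → Bool) :
    (Pop w A)^[T + s] F σ ≤ (Pop w A)^[s] F (topA A) + Fintype.card U * rr U ^ T * D := by
  rw [Function.iterate_add_apply]
  have hD : 0 ≤ D := (h ⊥).1.trans (h ⊥).2
  have hb := iter_bd hw A h s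
  have hm := iter_monotone hw A hF s
  set G := (Pop w A)^[s] F
  have hle : G ≤ (fun _ => G (topA A)) + D • ∑ v ∈ A, xv v := by
    intro τ
    simp only [Pi.add_apply, Pi.smul_apply, Finset.sum_apply, smul_eq_mul]
    by_cases hc : ∀ v ∈ A, τ v = false
    · have : τ ≤ topA A := le_topA (mem_ag.2 fun p hp => by
        have : p ∈ A := by simpa using hp
        rw [hc p this]; rfl)
      have h2 : 0 ≤ D * ∑ v ∈ A, xv v τ := mul_nonneg hD (sum_nonneg fun v _ => (xv_bd v τ).1)
      linarith [hm this]
    · push Not at hc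
      obtain ⟨v, hv, hv'⟩ := hc
      have h1 : xv v τ = 1 := by simp only [xv]; rw [if_pos (by simpa using hv')]
      have h2 : xv v τ ≤ ∑ v ∈ A, xv v τ := single_le_sum (f := fun v => xv v τ) (fun v _ => (xv_bd v τ).1) hv
      rw [h1] at h2
      have := mll h2 hD
      linarith [(hb τ).2, (hb (topA A)).1]
  have := iter_mono hw A hle T σ
  rw [iter_add, iter_smul, iter_const hw, iter_xv hw T A subset_rfl] at this
  simp only [Pi.add_apply, Pi.smul_apply, Finset.sum_apply, smul_eq_mul] at this
  have hs : ∑ v ∈ A, xv v σ ≤ Fintype.card U := by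
    refine (sum_le_sum fun v _ => (xv_bd v σ).2).trans ?_
    simp only [sum_const, nsmul_eq_mul, mul_one]
    exact_mod_cast card_le_univ A
  have h3 := mll hs (mul_nonneg hD (rrT U T).1)
  linarith

lemma tv_main [Nonempty U] (hw : LW w) (A : Finset U) (T1 T : ℕ) (l : List U) (e0 : ℝ)
    (H : ∀ (D : ℝ) (F : Fn U), (∀ σ, 0 ≤ F σ ∧ F σ ≤ D) → Monotone F →
      Ks w A l F (topA A) ≤ pE w A F + e0 * D ∧ pE w A F - e0 * D ≤ Ks w A l F ⊥)
    (f : Fn U) (hf : ∀ σ, 0 ≤ f σ ∧ f σ ≤ 1) (σ₀ : U → Bool) :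
    (Pop w A)^[T1 + T * l.length] f σ₀ ≤ pE w A f + (2 * (e0 + l.length * rr U ^ T) + Fintype.card U * rr U ^ T1) * (Fintype.card U + 1) := by
  set N : ℝ := (Fintype.card U : ℝ) with hN
  set h : (U → Bool) → ℝ := ∑ v, xv v with hh
  have hha : ∀ σ, h σ = ∑ v, xv v σ := fun σ => by rw [hh, Finset.sum_apply]
  have hhb : ∀ σ, 0 ≤ h σ ∧ h σ ≤ N + 1 := fun σ => by
    rw [hha]
    refine ⟨sum_nonneg fun v _ => (xv_bd v σ).1, (sum_le_sum fun v _ => (xv_bd v σ).2).trans ?_⟩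
    simp [hN]
  have hhm : Monotone h := fun σ τ hs => by
    rw [hha, hha]; exact sum_le_sum fun v _ => xv_mono v hs
  have hgb : ∀ σ, 0 ≤ (f + h) σ ∧ (f + h) σ ≤ N + 1 := fun σ => by
    simp only [Pi.add_apply]
    refine ⟨add_nonneg (hf σ).1 (hhb σ).1, ?_⟩
    have : h σ ≤ N := by
      rw [hha]; refine (sum_le_sum fun v _ => (xv_bd v σ).2).trans ?_
      simp [hN]
    linarith [(hf σ).2]
  have hgm : Monotone (f + h) := fun σ τ hs => by
    simp only [Pi.add_apply]
    by_cases hc : σ = τ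
    · rw [hc]
    · obtain ⟨v, hv⟩ := Function.ne_iff.1 hc
      have h1 := hs v
      have h2 : 1 ≤ xv v τ - xv v σ := by
        unfold xv
        cases a : σ v <;> cases b : τ v
        · exact absurd (a.trans b.symm) hv
        · simp
        · rw [a, b] at h1; exact absurd h1 bool_tf
        · exact absurd (a.trans b.symm) hv
      have h3 : xv v τ - xv v σ ≤ ∑ u, (xv u τ - xv u σ) :=
        single_le_sum (f := fun u => xv u τ - xv u σ) (fun u _ => sub_nonneg.2 (xv_mono u hs)) (mem_univ v)
      rw [sum_sub_distrib, ← hha, ← hha] at h3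
      linarith [(hf σ).2, (hf τ).1]
  have u1 := iter_top hw A hgb hgm T1 (T * l.length) σ₀
  have u2 := (cens hw A T l hgb hgm).1
  have u3 := (H _ _ hgb hgm).1
  have d2 := (cens hw A T l hhb hhm).2
  have d3 := (H _ _ hhb hhm).2
  have d1 : (Pop w A)^[T * l.length] h ⊥ ≤ (Pop w A)^[T1 + T * l.length] h σ₀ := by
    rw [Function.iterate_add_apply]
    have := iter_mono hw A (F := fun _ => (Pop w A)^[T * l.length] h ⊥) (G := (Pop w A)^[T * l.length] h) (fun τ => iter_monotone hw A hhm _ bot_le) T1 σ₀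
    rwa [iter_const hw] at this
  rw [iter_add, Pi.add_apply] at u1
  rw [pE_add] at u3
  linarith

end tvs

section fin
variable {n : ℕ}

lemma rr_exp (U : Type*) [Fintype U] (m : ℕ) : rr U ^ (Fintype.card U * m) ≤ exp (-m) ∨ Fintype.card U = 0 := by
  rcases Nat.eq_zero_or_pos (Fintype.card U) with h | h
  · exact Or.inr h
  · left
    have hN : (0:ℝ) < Fintype.card U := by exact_mod_cast h
    have : rr U ≤ exp (-(Fintype.card U : ℝ)⁻¹) := by
      have := add_one_le_exp (-(Fintype.card U : ℝ)⁻¹)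
      rw [rr]; linarith
    refine (pow_le_pow_left₀ (rr_nonneg U) this _).trans_eq ?_
    rw [← exp_nat_mul]
    congr 1
    push_cast
    field_simp

lemma mix_le {β : ℝ} (hβ : 0 ≤ β) (hn : 3 ≤ n) {L : ℕ} {δ : ℝ} (hE : EQh (wE β (gE n)) L δ) (m : ℕ) (hm : 1 ≤ m) (d : ℕ) (hd : n * n ≤ 2^d)
    (he : (2 * ((n - 2 : ℕ) * ((1 - exp (-(4 * β * (L + 2))))^m * (2 * m)^d + δ) + (n * (2 * m)^d) * exp (-m)) + (n * n) * exp (-m)) * (n * n + 1) ≤ 1/4) :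
    (mixingTime (pinnedK (grid n) β (gridBoundary n) false) (condIsing (grid n) β (gridBoundary n) false) : ℝ) ≤ (n * n) * m * (1 + n * (2 * m)^d) := by
  have hw := wE_LW hβ (gE n)
  have : Nonempty (Fin n × Fin n) := ⟨(⟨0, by omega⟩, ⟨0, by omega⟩)⟩
  obtain ⟨l, hl, H⟩ := sweep hβ oO hE m hm d hd
  have hc : Fintype.card (Fin n × Fin n) = n * n := by simp
  have hr : rr (Fin n × Fin n) ^ (n * n * m) ≤ exp (-m) := by
    have := rr_exp (Fin n × Fin n) m
    rw [hc] at this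
    rcases this with h | h
    · exact h
    · nlinarith
  have hlR : (l.length : ℝ) ≤ n * (2 * m)^d := by exact_mod_cast hl
  have key : mixingTime (pinnedK (grid n) β (gridBoundary n) false) (condIsing (grid n) β (gridBoundary n) false) ≤ n * n * m + n * n * m * l.length := by
    refine Nat.sInf_le fun σ₀ => ?_
    refine (GE.tv (grid_GE n) hβ (gridBoundary n) σ₀ _ _ fun f hf => tv_main hw (gridBoundary n) (n*n*m) (n*n*m) l _ H f hf σ₀).trans ?_
    refine le_trans ?_ he
    rw [hc]
    push_cast
    have h0 := (rrT (Fin n × Fin n) (n*n*m)).1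
    gcongr
  have : ((mixingTime (pinnedK (grid n) β (gridBoundary n) false) (condIsing (grid n) β (gridBoundary n) false) : ℕ) : ℝ) ≤ n * n * m + n * n * m * l.length := by
    exact_mod_cast key
  refine this.trans ?_
  have := mll hlR (show (0:ℝ) ≤ n * n * m by positivity)
  linarith

lemma card_bd (n : ℕ) : (gridBoundary n).card ≤ 4 * n := by
  rcases Nat.eq_zero_or_pos n with h | h
  · subst h; simp [gridBoundary]
  · have hs : gridBoundary n ⊆ (univ.image fun j : Fin n => ((⟨0, h⟩ : Fin n), j)) ∪ (univ.image fun j : Fin n => ((⟨n-1, by omega⟩ : Fin n), j)) ∪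
        (univ.image fun j : Fin n => (j, (⟨0, h⟩ : Fin n))) ∪ (univ.image fun j : Fin n => (j, (⟨n-1, by omega⟩ : Fin n))) := by
      intro p hp
      simp only [gridBoundary, mem_filter, mem_univ, true_and] at hp
      simp only [mem_union, mem_image, mem_univ, true_and, Prod.ext_iff, Fin.ext_iff]
      rcases hp with hp | hp | hp | hp
      · exact Or.inl (Or.inl (Or.inl ⟨p.2, hp.symm, rfl⟩))
      · exact Or.inl (Or.inl (Or.inr ⟨p.2, hp.symm, rfl⟩))
      · exact Or.inl (Or.inr ⟨p.1, rfl, hp.symm⟩)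
      · exact Or.inr ⟨p.1, rfl, hp.symm⟩
    have hi : ∀ f : Fin n → Fin n × Fin n, (univ.image f).card ≤ n := fun f => card_image_le.trans (by simp)
    refine (card_le_card hs).trans ?_
    refine (card_union_le _ _).trans ?_
    refine (Nat.add_le_add_right (card_union_le _ _) _).trans ?_
    refine (Nat.add_le_add_right (Nat.add_le_add_right (card_union_le _ _) _) _).trans ?_
    have h1 := hi (fun j : Fin n => ((⟨0, h⟩ : Fin n), j))
    have h2 := hi (fun j : Fin n => ((⟨n-1, by omega⟩ : Fin n), j))
    have h3 := hi (fun j : Fin n => (j, (⟨0, h⟩ : Fin n)))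
    have h4 := hi (fun j : Fin n => (j, (⟨n-1, by omega⟩ : Fin n)))
    omega

lemma ev_pow {a b : ℝ} (ha : 0 ≤ a) (hab : a < b) (C : ℝ) : ∀ᶠ J : ℕ in Filter.atTop, C * (J + 1) * a^J ≤ b^J := by
  have hb : 0 < b := ha.trans_lt hab
  have hr : |a / b| < 1 := by
    rw [abs_of_nonneg pP, div_lt_one hb]; exact hab
  have h1 := tendsto_pow_const_mul_const_pow_of_abs_lt_one 1 hr
  have h0 := tendsto_pow_const_mul_const_pow_of_abs_lt_one 0 hr
  have h2 := ((h1.add h0).const_mul C)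
  simp only [add_zero, mul_zero] at h2
  have := h2.eventually (ge_mem_nhds (show (0:ℝ) < 1 by norm_num))
  filter_upwards [this] with J hJ
  have hbJ := pow_pos hb J
  rw [div_pow] at hJ
  have e : C * (J + 1) * a^J = (C * ((J:ℝ) ^ 1 * (a ^ J / b ^ J) + (J:ℝ) ^ 0 * (a ^ J / b ^ J))) * b^J := by
    field_simp
  rw [e]
  exact mul_le_of_le_one_left hbJ.le hJ

lemma ev_x : ∀ᶠ x : ℝ in Filter.atTop, 1 ≤ x ∧ 8 * x + 4 * x^2 + 10 ≤ exp x := by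
  have h := Real.tendsto_exp_div_pow_atTop 2
  filter_upwards [h.eventually_ge_atTop 22, Filter.eventually_ge_atTop (1:ℝ)] with x h1 h2
  refine ⟨h2, ?_⟩
  rw [le_div_iff₀ pP] at h1
  nlinarith

end fin

section asy

lemma two_pow_le_exp (k : ℕ) : (2:ℝ)^k ≤ exp k := by
  have h : (2:ℝ) ≤ exp 1 := by have := add_one_le_exp (1:ℝ); linarith
  calc (2:ℝ)^k ≤ (exp 1)^k := pow_le_pow_left₀ nN h k
    _ = exp k := by rw [← exp_nat_mul, mul_one]

lemma m_bd {x : ℝ} (hx : 1 ≤ x) (d : ℕ) : exp (2*x) ≤ ⌈exp (2*x)⌉₊ ∧ (2 * (⌈exp (2*x)⌉₊ : ℝ)) ≤ exp (4*x) ∧ (2 * (⌈exp (2*x)⌉₊ : ℝ))^d ≤ exp (4*x*d) := by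
  have h1 := Nat.ceil_lt_add_one (exp_pos (2*x)).le
  have h2 : 4 ≤ exp (2*x) := by
    have e : exp (2*x) = exp x * exp x := by rw [← exp_add]; ring_nf
    have := add_one_le_exp x
    rw [e]; nlinarith
  have h3 : exp (4*x) = exp (2*x) * exp (2*x) := by rw [← exp_add]; ring_nf
  have h4 : (2 * (⌈exp (2*x)⌉₊ : ℝ)) ≤ exp (4*x) := by rw [h3]; nlinarith
  refine ⟨Nat.le_ceil _, h4, (pow_le_pow_left₀ pP h4 d).trans_eq ?_⟩
  rw [← exp_nat_mul]; ring_nf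

lemma err_le {x : ℝ} {n d : ℕ} {δ : ℝ} (hx : 1 ≤ x) (hx2 : 8 * x + 4 * x^2 + 10 ≤ exp x) (hn : (n:ℝ) ≤ exp x) (hn2 : (n * n + 1 : ℝ) ≤ exp x) (hd : (d:ℝ) ≤ x)
    (hδ0 : 0 ≤ δ) (hδ : 2 * n * δ * (n * n + 1) ≤ 1/16) :
    (2 * ((n - 2 : ℕ) * ((1 - exp (-x))^⌈exp (2*x)⌉₊ * (2 * ⌈exp (2*x)⌉₊)^d + δ) + (n * (2 * ⌈exp (2*x)⌉₊)^d) * exp (-⌈exp (2*x)⌉₊)) + (n * n) * exp (-⌈exp (2*x)⌉₊)) * (n * n + 1) ≤ 1/4 := by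
  obtain ⟨m1, m2, m3⟩ := m_bd hx d
  set m := ⌈exp (2*x)⌉₊
  have hY : (2 * (m:ℝ))^d ≤ exp (4 * x^2) := m3.trans (exp_le_exp.2 (by nlinarith))
  have hY1 : 1 ≤ exp (4 * x^2) := one_le_exp pP
  have hE1 : exp (-(m:ℝ)) ≤ exp (-exp x) := exp_le_exp.2 (by
    have : exp x ≤ exp (2*x) := exp_le_exp.2 lL
    linarith)
  have hE2 : (1 - exp (-x))^m ≤ exp (-exp x) := by
    have h1 : 1 - exp (-x) ≤ exp (-exp (-x)) := by have := add_one_le_exp (-exp (-x)); linarith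
    have h0 : 0 ≤ 1 - exp (-x) := by
      have : exp (-x) ≤ 1 := exp_le_one_iff.2 lL
      linarith
    refine (pow_le_pow_left₀ h0 h1 m).trans ?_
    rw [← exp_nat_mul]
    refine exp_le_exp.2 ?_
    have : exp x = exp (2*x) * exp (-x) := by rw [← exp_add]; ring_nf
    rw [this]
    nlinarith [exp_pos (-x)]
  have hE0 := exp_pos (-exp x)
  have hW : exp x * exp x * exp (4 * x^2) * exp (-exp x) ≤ 1/32 := by
    rw [← exp_add, ← exp_add, ← exp_add]
    refine (exp_le_exp.2 (show _ ≤ (-10:ℝ) by linarith)).trans ?_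
    rw [exp_neg, inv_eq_one_div]
    refine one_div_le_one_div_of_le nN ?_
    have e : exp 10 = exp 5 * exp 5 := by rw [← exp_add]; norm_num
    have := add_one_le_exp (5:ℝ)
    rw [e]; nlinarith
  have hn' : ((n - 2 : ℕ) : ℝ) ≤ n := by exact_mod_cast Nat.sub_le n 2
  have hn0 : (0:ℝ) ≤ n := by positivity
  have hEm := exp_pos (-(m:ℝ))
  have h00 : 0 ≤ 1 - exp (-x) := by
    have : exp (-x) ≤ 1 := exp_le_one_iff.2 lL
    linarith
  have hq : 0 ≤ (1 - exp (-x))^m := pow_nonneg h00 m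
  generalize (1 - exp (-x))^m = q at *
  have a1 : n * (q * (2 * (m:ℝ))^d) * (n * n + 1) ≤ exp x * exp x * exp (4 * x^2) * exp (-exp x) := by
    calc n * (q * (2 * (m:ℝ))^d) * (n * n + 1) ≤ exp x * (exp (-exp x) * exp (4*x^2)) * exp x := by gcongr
      _ = _ := by ring
  have a2 : n * (2 * (m:ℝ))^d * exp (-(m:ℝ)) * (n * n + 1) ≤ exp x * exp x * exp (4 * x^2) * exp (-exp x) := by
    calc n * (2 * (m:ℝ))^d * exp (-(m:ℝ)) * (n * n + 1) ≤ exp x * exp (4*x^2) * exp (-exp x) * exp x := by gcongr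
      _ = _ := by ring
  have a3 : n * n * exp (-(m:ℝ)) * (n * n + 1) ≤ exp x * exp x * exp (4 * x^2) * exp (-exp x) := by
    have : (n:ℝ) * n ≤ exp x := by linarith
    calc n * n * exp (-(m:ℝ)) * (n * n + 1) ≤ exp x * exp (-exp x) * exp x := by gcongr
      _ = exp x * exp x * 1 * exp (-exp x) := by ring
      _ ≤ _ := by gcongr
  have h0 : 0 ≤ q * (2 * (m:ℝ))^d + δ := by
    positivity
  have a0 : ((n - 2 : ℕ) : ℝ) * (q * (2 * (m:ℝ))^d + δ) * (n * n + 1) ≤ n * (q * (2 * (m:ℝ))^d + δ) * (n * n + 1) := by gcongr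
  linarith

lemma time_le {x : ℝ} {n d : ℕ} (hx : 1 ≤ x) (hn : (n:ℝ) ≤ exp x) (hn2 : (n * n + 1 : ℝ) ≤ exp x) :
    (n * n : ℝ) * ⌈exp (2*x)⌉₊ * (1 + n * (2 * ⌈exp (2*x)⌉₊)^d) ≤ exp (7 * x + 4 * x * d) := by
  obtain ⟨m1, m2, m3⟩ := m_bd hx d
  set m := ⌈exp (2*x)⌉₊
  have h1 : (n * n : ℝ) ≤ exp x := by linarith
  have h2 : (m:ℝ) ≤ exp (4*x) := by
    have : (0:ℝ) ≤ m := by positivity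
    linarith
  have h4 : (n:ℝ) * (2 * m)^d ≤ exp x * exp (4*x*d) := by gcongr
  have h5 : 1 + exp x * exp (4*x*d) ≤ exp x * exp x * exp (4*x*d) := by
    have a := add_one_le_exp x
    have b : 1 ≤ exp (4*x*d) := one_le_exp pP
    have c : 1 ≤ exp x * exp (4*x*d) := by nlinarith
    nlinarith
  calc (n * n : ℝ) * m * (1 + n * (2 * m)^d) ≤ exp x * exp (4*x) * (exp x * exp x * exp (4*x*d)) := by
        gcongr; linarith
    _ = exp (7 * x + 4 * x * d) := by
        simp only [← exp_add]; ring_nf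

end asy

section par

lemma EQh_J {β : ℝ} (hβ1 : 4 ≤ β) (hβ : exp (-(2*β)) ≤ 1/1000) {J n : ℕ} (hJ : 2^J ≤ n) (hJ' : n < 2^(J+1))
    (E1 : (300 + 120 * β) * (J + 1) * (1.52:ℝ)^J ≤ 1.55^J) (E2 : 225 * ((J:ℝ) + 1) * 1^J ≤ (76/75)^J) (E3 : 10 * ((J:ℝ)+1) * 1.52^J ≤ 1.9^J) :
    3 ≤ n ∧ EQh (wE β (gE n)) ⌈(1.9:ℝ)^J⌉₊ (1/64^(J+2)) := by
  set l := ⌈(1.52:ℝ)^J⌉₊ with hl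
  set L := ⌈(1.9:ℝ)^J⌉₊ with hL
  have l1 : (1.52:ℝ)^J ≤ l := Nat.le_ceil _
  have l2 : (l:ℝ) < 1.52^J + 1 := Nat.ceil_lt_add_one pP
  have L1 : (1.9:ℝ)^J ≤ L := Nat.le_ceil _
  have hp : 1 ≤ (1.52:ℝ)^J := one_le_pow₀ nN
  have hJ0 : (0:ℝ) ≤ J := by positivity
  have hJp : (J:ℝ) + 1 ≤ (J+1) * 1.52^J := by nlinarith
  have hJq : (1.52:ℝ)^J ≤ (J+1) * 1.52^J := by nlinarith
  have h29 : (1.9:ℝ)^J ≤ 2^J := pow_le_pow_left₀ nN nN _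
  have hn2 : 2 * l + 3 ≤ n := by
    have : (2 * l + 3 : ℝ) ≤ n := by
      have : ((2^J : ℕ) : ℝ) ≤ n := by exact_mod_cast hJ
      push_cast at this
      linarith
    exact_mod_cast this
  have hlL : 2 * l ≤ L := by
    have : (2 * l : ℝ) ≤ L := by linarith
    exact_mod_cast this
  have hL0 : 1 ≤ L := by
    have : (1:ℝ) ≤ L := by linarith
    exact_mod_cast this
  have hl0 : 1 ≤ l := by
    have : (1:ℝ) ≤ l := by linarith
    exact_mod_cast this
  refine ⟨by omega, ?_⟩
  have hK0 : NeZero (2 * 2^(J+5)) := ⟨by positivity⟩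
  have hM0 : NeZero (4 * 2^(J+1)) := ⟨by positivity⟩
  have h4 : (4:ℝ)^J = (2^J)^2 := by rw [← pow_mul, mul_comm, pow_mul]; norm_num
  refine EQh_of (K := 2 * 2^(J+5)) (M := 4 * 2^(J+1)) lL hβ (J+1) (2^(J+5)) L l ((J+1)/2) oO rfl rfl ?_ hJ'.le hL0 hlL oO oO ?_ pP ?_
  · have := Nat.one_le_two_pow (n := J)
    simp only [pow_add]; omega
  · have e : ((2 * 2^(J+5) : ℕ) : ℝ) * ((4 * 2^(J+1) : ℕ) : ℝ) * 4^(J+1+3) * exp (-(2 * (1/10 * (2/3)^(J+1) * l))) * (4 * ((4 * 2^(J+1) : ℕ) : ℝ) * 4^(J+1+3)) =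
        2^(7*J+30) * exp (-(2 * (1/10 * (2/3)^(J+1) * l))) := by
      push_cast
      have : (2:ℝ)^(7*J) = (2^J)^7 := by rw [← pow_mul, mul_comm]
      simp only [pow_add, h4, this]; ring
    rw [e]
    refine (mlr (two_pow_le_exp _) (exp_pos _).le).trans ?_
    rw [← exp_add]
    refine exp_le_one_iff.2 ?_
    have h1 : (2/3:ℝ)^J * 1.52^J = (76/75)^J := by rw [← mul_pow]; norm_num
    have h2 : (2/3:ℝ)^J * 1.52^J ≤ (2/3)^J * l := by gcongr
    rw [one_pow] at E2
    push_cast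
    rw [pow_succ]
    linarith
  · set i0 := (J+1)/2 with hi0
    have e : ((2 * 2^(J+5) : ℕ) : ℝ) * ((4 * 2^(J+1) : ℕ) : ℝ) * exp (-(2 * (1/10 * (2/3)^i0 * L))) * 2^(2*i0+4+(n-2)/2^i0) * (4 * ((4 * 2^(J+1) : ℕ) : ℝ) * 4^(J+1+3)) =
        2^(5*J+22+(2*i0+4+(n-2)/2^i0)) * exp (-(2 * (1/10 * (2/3)^i0 * L))) := by
      push_cast
      have : (2:ℝ)^(5*J) = (2^J)^5 := by rw [← pow_mul, mul_comm]
      rw [pow_add 2 (5*J+22)]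
      generalize (2:ℝ)^(2*i0+4+(n-2)/2^i0) = z
      simp only [pow_add, h4, this]; ring
    rw [e]
    have r1 : exp (-(6*J+12)) * exp (-(2*β)*(4*l+1)) ≤ 1/64^(J+2) * exp (-(2*β))^(4*l+1) := by
      have a : exp (-(2*β))^(4*l+1) = exp (-(2*β)*(4*l+1)) := by
        rw [← exp_nat_mul]; push_cast; ring_nf
      have b : (64:ℝ)^(J+2) ≤ exp (6*J+12) := by
        have := two_pow_le_exp (6*(J+2))
        rw [pow_mul] at this
        norm_num at this ⊢
        refine this.trans_eq ?_
        ring_nf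
      rw [a]
      refine mlr ?_ (exp_pos _).le
      rw [exp_neg, inv_eq_one_div]
      exact one_div_le_one_div_of_le pP b
    refine le_trans ?_ r1
    refine (mlr (two_pow_le_exp _) (exp_pos _).le).trans ?_
    rw [← exp_add, ← exp_add]
    refine exp_le_exp.2 ?_
    have k1 : (n-2)/2^i0 ≤ 2^(J+1-i0) := by
      refine Nat.div_le_of_le_mul ?_
      rw [← pow_add, show i0 + (J+1-i0) = J+1 by omega]
      omega
    have k2 : (((n-2)/2^i0 : ℕ) : ℝ) ≤ 1.415^(J+2) := by
      have k1' : (((n-2)/2^i0 : ℕ) : ℝ) ≤ 2^(J+1-i0) := by exact_mod_cast k1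
      refine k1'.trans ?_
      calc (2:ℝ)^(J+1-i0) ≤ (1.415^2)^(J+1-i0) := pow_le_pow_left₀ nN nN _
        _ = 1.415^(2*(J+1-i0)) := by rw [pow_mul]
        _ ≤ _ := pow_le_pow_right₀ nN oO
    have k3 : (1.415:ℝ)^(J+2) ≤ 2.1 * 1.52^J := by
      have : (1.415:ℝ)^J ≤ 1.52^J := pow_le_pow_left₀ nN nN _
      rw [pow_add]; nlinarith
    have k4 : (0.816:ℝ)^(J+1) ≤ (2/3)^i0 := by
      calc (0.816:ℝ)^(J+1) ≤ 0.816^(2*i0) := pow_le_pow_of_le_one nN nN oO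
        _ = (0.816^2)^i0 := by rw [pow_mul]
        _ ≤ _ := pow_le_pow_left₀ nN nN _
    have k5 : (0.816:ℝ) * 1.55^J ≤ (2/3)^i0 * L := by
      calc (0.816:ℝ) * 1.55^J ≤ 0.816 * (0.816 * 1.9)^J := by gcongr; norm_num
        _ = 0.816^(J+1) * 1.9^J := by rw [mul_pow]; ring
        _ ≤ _ := by gcongr
    have k6 : ((i0 : ℕ) : ℝ) ≤ (J + 1)/2 := by
      have : 2 * i0 ≤ J + 1 := by omega
      have : (2 * i0 : ℝ) ≤ J + 1 := by exact_mod_cast this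
      linarith
    have k7 : β * l ≤ β * (2 * ((J+1) * 1.52^J)) := mll lL lL
    have k8 : β * 1 ≤ β * ((J+1) * 1.52^J) := mll lL lL
    push_cast
    push_cast at k2
    linarith

end par

lemma delta_bd {n J : ℕ} (nR : (n:ℝ) ≤ 2^(J+1)) : 2 * n * (1/64^(J+2) : ℝ) * (n * n + 1) ≤ 1/16 := by
  have h64 : (64:ℝ)^(J+2) = ((2^(J+1))^6) * 64 := by
    rw [← pow_mul, show (J+1)*6 = 6*(J+1) by ring, pow_mul, pow_succ]; norm_num
  have h4 : (2:ℝ) ≤ 2^(J+1) := by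
    rw [pow_succ]; have : (1:ℝ) ≤ 2^J := one_le_pow₀ nN
    linarith
  rw [h64]
  generalize (2:ℝ)^(J+1) = a at *
  have ha : 0 < a := by linarith
  have h5 : (n:ℝ) * (n * n + 1) ≤ a * (a * a + 1) := by gcongr
  rw [show 2 * (n:ℝ) * (1/(a^6*64)) * (n*n+1) = (2 * (n * (n*n+1))) / (a^6*64) by ring, div_le_div_iff₀ pP nN]
  have h6 : a * (a*a+1) ≤ 2 * a^3 := by
    have := mul_nonneg ha.le (show 0 ≤ a * a - 1 by nlinarith)
    linarith
  have h7 : 1 ≤ a^3 := one_le_pow₀ lL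
  have h8 : a^6 = a^3 * a^3 := by ring
  rw [h8]; nlinarith

set_option maxHeartbeats 2000000 in
lemma large_n {β : ℝ} (hβ : 4 ≤ β) : ∃ n0 : ℕ, ∀ n : ℕ, n0 ≤ n →
    (mixingTime (pinnedK (grid n) β (gridBoundary n) false) (condIsing (grid n) β (gridBoundary n) false) : ℝ) ≤ exp (1 * (n:ℝ) ^ (Real.logb 2 1.95)) := by
  have ht : exp (-(2*β)) ≤ 1/1000 := by
    rw [exp_neg, inv_eq_one_div]
    refine one_div_le_one_div_of_le nN ?_
    have h1 : exp 8 ≤ exp (2*β) := exp_le_exp.2 lL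
    have h2 : (1000:ℝ) ≤ exp 8 := by
      have e : exp 8 = (exp 1)^8 := by rw [← exp_nat_mul]; norm_num
      have : (2.7:ℝ) ≤ exp 1 := by have := Real.exp_one_gt_d9; linarith
      rw [e]
      refine le_trans ?_ (pow_le_pow_left₀ nN this 8)
      norm_num
    linarith
  obtain ⟨x0, hx0⟩ := Filter.eventually_atTop.1 ev_x
  have E1 := ev_pow (a := 1.52) (b := 1.55) nN nN (300 + 120 * β)
  have E2 := ev_pow (a := 1) (b := 76/75) nN nN 225
  have E3 := ev_pow (a := 1.52) (b := 1.9) nN nN 10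
  have E4 := ev_pow (a := 1) (b := 1.9) nN nN (|x0| + 4)
  have E5 := ev_pow (a := 1.9) (b := 1.95) nN nN (240 * β)
  obtain ⟨J0, hJ0⟩ := Filter.eventually_atTop.1 (E1.and (E2.and (E3.and (E4.and E5))))
  refine ⟨2^J0, fun n hn => ?_⟩
  have hn0 : n ≠ 0 := by have := Nat.one_le_two_pow (n := J0); omega
  set J := Nat.log 2 n with hJdef
  have hJ : 2^J ≤ n := Nat.pow_log_le_self 2 hn0
  have hJ' : n < 2^(J+1) := Nat.lt_pow_succ_log_self nN n
  have hJJ : J0 ≤ J := by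
    by_contra hc
    have : 2^(J+1) ≤ 2^J0 := Nat.pow_le_pow_right nN oO
    omega
  obtain ⟨e1, e2, e3, e4, e5⟩ := hJ0 J hJJ
  obtain ⟨n3, hE⟩ := EQh_J hβ ht hJ hJ' e1 e2 e3
  set L := ⌈(1.9:ℝ)^J⌉₊
  have L1 : (1.9:ℝ)^J ≤ L := Nat.le_ceil _
  have L2 : (L:ℝ) < 1.9^J + 1 := Nat.ceil_lt_add_one pP
  have hp : 1 ≤ (1.9:ℝ)^J := one_le_pow₀ nN
  have hJr : (0:ℝ) ≤ J := by positivity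
  set x := 4 * β * ((L:ℝ) + 2) with hx
  have xL : (1.9:ℝ)^J ≤ x := (show _ ≤ 1 * ((L:ℝ) + 2) by linarith).trans (mlr lL pP)
  rw [one_pow, mul_one] at e4
  have ax := abs_nonneg x0
  have ay := mul_nonneg ax hJr
  have xx0 : x0 ≤ x := by linarith [le_abs_self x0]
  have xJ : 2 * (J:ℝ) + 4 ≤ x := by linarith
  obtain ⟨hx1, hx2⟩ := hx0 x xx0
  have nR : (n:ℝ) ≤ 2^(J+1) := by exact_mod_cast hJ'.le
  have nx2 : (n * n + 1 : ℝ) ≤ exp x := by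
    have h1 := two_pow_le_exp (2*J+4)
    have h2 : exp ((2*J+4 : ℕ) : ℝ) ≤ exp x := exp_le_exp.2 (by push_cast; exact xJ)
    have h3 : (2:ℝ)^(2*J+4) = (2^(J+1)) * 2^(J+1) * 4 := by
      rw [show 2*J+4 = (J+1)+(J+1)+2 by ring, pow_add, pow_add]; norm_num
    have h4 : (1:ℝ) ≤ 2^(J+1) := one_le_pow₀ nN
    have h5 : (n:ℝ) * n ≤ 2^(J+1) * 2^(J+1) := by gcongr
    have h6 := one_le_mul_of_one_le_of_one_le h4 h4
    linarith
  have nx : (n:ℝ) ≤ exp x := by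
    have : (1:ℝ) ≤ n := by exact_mod_cast Nat.one_le_iff_ne_zero.2 hn0
    have := mll this (by linarith : (0:ℝ) ≤ n)
    linarith
  have hd : n * n ≤ 2^(2*J+2) := by
    rw [show 2*J+2 = (J+1)+(J+1) by ring, pow_add]; exact Nat.mul_le_mul hJ'.le hJ'.le
  have hδ := delta_bd nR
  have herr := err_le (d := 2*J+2) hx1 hx2 nx nx2 (by push_cast; linarith) pP hδ
  have hm1 : 1 ≤ ⌈exp (2*x)⌉₊ := Nat.one_le_iff_ne_zero.2 (Nat.ceil_pos.2 (exp_pos _)).ne'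
  refine (mix_le lL n3 hE ⌈exp (2*x)⌉₊ hm1 (2*J+2) hd herr).trans ?_
  refine (time_le hx1 nx nx2).trans (exp_le_exp.2 ?_)
  have hb : (1.95:ℝ)^J ≤ (n:ℝ)^(Real.logb 2 1.95) := by
    have h1 : ((2:ℝ)^J)^(Real.logb 2 1.95) ≤ (n:ℝ)^(Real.logb 2 1.95) := by
      refine Real.rpow_le_rpow pP (by exact_mod_cast hJ) (Real.logb_nonneg nN nN)
    refine le_trans (le_of_eq ?_) h1
    rw [← Real.rpow_natCast_mul nN, mul_comm, Real.rpow_mul_natCast nN, Real.rpow_logb nN nN nN]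
  rw [one_mul]
  refine le_trans ?_ (e5.trans hb)
  push_cast
  have xU : x ≤ 16 * β * 1.9^J := (mll (show (L:ℝ) + 2 ≤ 4 * 1.9^J by linarith) (by linarith : 0 ≤ 4 * β)).trans_eq (by ring)
  calc 7 * x + 4 * x * (2 * J + 2) = x * (8 * J + 15) := by ring
    _ ≤ (16 * β * 1.9^J) * (15 * (J + 1)) := by
        refine mul_le_mul xU lL pP pP
    _ = _ := by ring

theorem grid_boundary_corruption_fast_mixing :
    ∃ β₀ : ℝ, ∀ β : ℝ, β₀ ≤ β → ∃ c : ℝ, 0 < c ∧ ∃ ε : ℝ, 0 < ε ∧ ε < 1 ∧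
      ∀ n : ℕ,
        (gridBoundary n).card ≤ 4 * n ∧
        (mixingTime (pinnedK (grid n) β (gridBoundary n) false)
            (condIsing (grid n) β (gridBoundary n) false) : ℝ)
          ≤ exp (c * (n : ℝ) ^ ε) := by
  refine ⟨4, fun β hβ => ?_⟩
  obtain ⟨n0, h0⟩ := large_n hβ
  have hε : 0 < Real.logb 2 1.95 := Real.logb_pos nN nN
  set C : ℝ := ∑ n ∈ Finset.range n0, (mixingTime (pinnedK (grid n) β (gridBoundary n) false) (condIsing (grid n) β (gridBoundary n) false) : ℝ)
  have hC : 0 ≤ C := Finset.sum_nonneg fun _ _ => by positivity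
  refine ⟨1 + C, by linarith, Real.logb 2 1.95, hε, ?_, fun n => ⟨card_bd n, ?_⟩⟩
  · rw [Real.logb_lt_iff_lt_rpow nN nN]; norm_num
  · rcases Nat.eq_zero_or_pos n with hn | hn
    · subst hn
      have : mixingTime (pinnedK (grid 0) β (gridBoundary 0) false) (condIsing (grid 0) β (gridBoundary 0) false) ≤ 0 := by
        refine Nat.sInf_le fun σ₀ => ?_
        have hs : ∀ σ : Fin 0 × Fin 0 → Bool, σ = σ₀ := fun σ => Subsingleton.elim _ _
        have hz : condIsing (grid 0) β (gridBoundary 0) false σ₀ = 1 := by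
          have hv : ∀ v ∈ gridBoundary 0, σ₀ v = false := fun v => v.1.elim0
          rw [condIsing, if_pos hv, condZ, Fintype.sum_subsingleton _ σ₀, if_pos hv, div_self (exp_pos _).ne']
        rw [tvDist, Fintype.sum_subsingleton _ σ₀, hz]
        simp [evolve, delta]
      have h1 : mixingTime (pinnedK (grid 0) β (gridBoundary 0) false) (condIsing (grid 0) β (gridBoundary 0) false) = 0 := by omega
      rw [h1]; simpa using (exp_pos _).le
    · have h1 : (1:ℝ) ≤ (n:ℝ)^(Real.logb 2 1.95) := Real.one_le_rpow (by exact_mod_cast hn) hε.le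
      by_cases hc : n0 ≤ n
      · refine (h0 n hc).trans (exp_le_exp.2 ?_)
        nlinarith
      · have h2 : (mixingTime (pinnedK (grid n) β (gridBoundary n) false) (condIsing (grid n) β (gridBoundary n) false) : ℝ) ≤ C :=
          Finset.single_le_sum (f := fun n => (mixingTime (pinnedK (grid n) β (gridBoundary n) false) (condIsing (grid n) β (gridBoundary n) false) : ℝ)) (fun _ _ => by positivity) (Finset.mem_range.2 oO)
        have h3 := add_one_le_exp ((1 + C) * (n:ℝ)^(Real.logb 2 1.95))
        nlinarith

end
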